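/- arXiv:1511.09343 — 9 statements merged into one kernel-verified Lean document; each statement's English description precedes it below -/
import Mathlib

section
/- Let (v₁,v₂,λ₁,λ₂) be a solution of the one-dimensional system with viscosity ν. Then for each i ∈ {1,2} (with j = 3−i) the following identities hold: ν∫₀¹ v_i'(x)² dx + ∫₀¹ g_i(v_j(x)²) v_i(x)² dx = λ_i, and ν∫₀¹ (v_i'(x)/v_i(x))² dx + λ_i = ∫₀¹ g_i(v_j(x)²) dx. In particular the multipliers satisfy C_g⁻¹ ∫₀¹ v₁(x)² v₂(x)² dx ≤ λ_i ≤ C_g for i = 1,2. -/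
open Set Filter MeasureTheory

/-- Assumptions on the interaction functions `g`: `C²` on `[0,∞)`, strictly
increasing there, and `Cg⁻¹ s ≤ g s ≤ Cg s` for all `s ≥ 0`. -/
def GAss (Cg : ℝ) (g : ℝ → ℝ) : Prop :=
  ContDiffOn ℝ 2 g (Set.Ici 0) ∧ StrictMonoOn g (Set.Ici 0) ∧
    ∀ s : ℝ, 0 ≤ s → Cg⁻¹ * s ≤ g s ∧ g s ≤ Cg * s

/-- A solution of the one-dimensional system with viscosity `ν`:
`v₁, v₂` twice continuously differentiable, satisfying the ODEs on `[0,1]`,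
positive on `[0,1]`, with Neumann boundary conditions and unit `L²` mass. -/
def IsSolution (ν : ℝ) (g₁ g₂ v₁ v₂ : ℝ → ℝ) (l₁ l₂ : ℝ) : Prop :=
  ContDiff ℝ 2 v₁ ∧ ContDiff ℝ 2 v₂ ∧
    (∀ x ∈ Set.Icc (0:ℝ) 1,
      -ν * deriv (deriv v₁) x + g₁ ((v₂ x) ^ 2) * v₁ x = l₁ * v₁ x) ∧
    (∀ x ∈ Set.Icc (0:ℝ) 1,
      -ν * deriv (deriv v₂) x + g₂ ((v₁ x) ^ 2) * v₂ x = l₂ * v₂ x) ∧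
    (∀ x ∈ Set.Icc (0:ℝ) 1, 0 < v₁ x) ∧
    (∀ x ∈ Set.Icc (0:ℝ) 1, 0 < v₂ x) ∧
    deriv v₁ 0 = 0 ∧ deriv v₁ 1 = 0 ∧ deriv v₂ 0 = 0 ∧ deriv v₂ 1 = 0 ∧
    (∫ x in (0:ℝ)..1, (v₁ x) ^ 2) = 1 ∧ (∫ x in (0:ℝ)..1, (v₂ x) ^ 2) = 1

/-- The trivial (constant) solution: `v₁ ≡ v₂ ≡ 1` on `[0,1]`. -/
def IsTrivialSol (v₁ v₂ : ℝ → ℝ) : Prop :=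
  ∀ x ∈ Set.Icc (0:ℝ) 1, v₁ x = 1 ∧ v₂ x = 1

theorem helper_main (ν Cg l : ℝ) (g v w : ℝ → ℝ) (hν : 0 < ν) (hg : GAss Cg g)
    (hv : ContDiff ℝ 2 v) (hw : ContDiff ℝ 2 w)
    (hode : ∀ x ∈ Set.Icc (0:ℝ) 1,
      -ν * deriv (deriv v) x + g ((w x) ^ 2) * v x = l * v x)
    (hpos : ∀ x ∈ Set.Icc (0:ℝ) 1, 0 < v x)
    (h0 : deriv v 0 = 0) (h1 : deriv v 1 = 0)
    (hmv : (∫ x in (0:ℝ)..1, (v x) ^ 2) = 1) (hmw : (∫ x in (0:ℝ)..1, (w x) ^ 2) = 1) :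
    (ν * ∫ x in (0:ℝ)..1, (deriv v x) ^ 2)
        + (∫ x in (0:ℝ)..1, g ((w x) ^ 2) * (v x) ^ 2) = l ∧
    (ν * ∫ x in (0:ℝ)..1, (deriv v x / v x) ^ 2) + l
        = (∫ x in (0:ℝ)..1, g ((w x) ^ 2)) ∧
    Cg⁻¹ * (∫ x in (0:ℝ)..1, (v x) ^ 2 * (w x) ^ 2) ≤ l ∧ l ≤ Cg := by
  obtain ⟨hgc, -, hgb⟩ := hg
  have cv : Continuous v := hv.continuous
  have cw : Continuous w := hw.continuous
  have hv1 : ContDiff ℝ 1 (deriv v) := by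
    have h2 : ContDiff ℝ (1 + 1) v := by
      norm_num
      exact hv
    exact (contDiff_succ_iff_deriv.1 h2).2.2
  have dv : Differentiable ℝ v := hv.differentiable (by norm_num)
  have ddv : Differentiable ℝ (deriv v) := hv1.differentiable (by norm_num)
  have cv1 : Continuous (deriv v) := hv1.continuous
  have cv2 : Continuous (deriv (deriv v)) := hv1.continuous_deriv (by norm_num)
  have ch : Continuous (fun x => g ((w x) ^ 2)) :=
    hgc.continuousOn.comp_continuous (cw.pow 2) (fun x => sq_nonneg (w x))
  have hu : Set.uIcc (0:ℝ) 1 = Set.Icc 0 1 := Set.uIcc_of_le zero_le_one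
  have i1 : IntervalIntegrable (fun x => (deriv v x) ^ 2) volume 0 1 :=
    (cv1.pow 2).intervalIntegrable _ _
  have i2 : IntervalIntegrable (fun x => g ((w x) ^ 2) * (v x) ^ 2) volume 0 1 :=
    (ch.mul (cv.pow 2)).intervalIntegrable _ _
  have i3 : IntervalIntegrable (fun x => (v x) ^ 2) volume 0 1 :=
    (cv.pow 2).intervalIntegrable _ _
  have i4 : IntervalIntegrable (fun x => g ((w x) ^ 2)) volume 0 1 :=
    ch.intervalIntegrable _ _
  have cq : ContinuousOn (fun x => deriv v x / v x) (Set.Icc 0 1) :=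
    cv1.continuousOn.div cv.continuousOn (fun x hx => (hpos x hx).ne')
  have i5 : IntervalIntegrable (fun x => (deriv v x / v x) ^ 2) volume 0 1 := by
    apply ContinuousOn.intervalIntegrable
    rw [hu]
    exact cq.pow 2
  have e1 : (ν * ∫ x in (0:ℝ)..1, (deriv v x) ^ 2)
        + (∫ x in (0:ℝ)..1, g ((w x) ^ 2) * (v x) ^ 2) = l := by
    have key : (∫ x in (0:ℝ)..1, (ν * (deriv v x) ^ 2 + g ((w x) ^ 2) * (v x) ^ 2
        - l * (v x) ^ 2)) = ν * (v 1 * deriv v 1) - ν * (v 0 * deriv v 0) := by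
      apply intervalIntegral.integral_eq_sub_of_hasDerivAt
        (f := fun x => ν * (v x * deriv v x))
      · intro x hx
        rw [hu] at hx
        have := (((dv x).hasDerivAt.mul (ddv x).hasDerivAt).const_mul ν)
        refine HasDerivAt.congr_deriv this ?_
        linear_combination (-v x) * hode x hx
      · exact ((i1.const_mul ν).add i2).sub (i3.const_mul l)
    rw [intervalIntegral.integral_sub ((i1.const_mul ν).add i2) (i3.const_mul l),
      intervalIntegral.integral_add (i1.const_mul ν) i2,
      intervalIntegral.integral_const_mul, intervalIntegral.integral_const_mul, hmv, h0, h1] at key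
    linarith
  have e2 : (ν * ∫ x in (0:ℝ)..1, (deriv v x / v x) ^ 2) + l
        = (∫ x in (0:ℝ)..1, g ((w x) ^ 2)) := by
    have ic : IntervalIntegrable (fun _ : ℝ => l) volume 0 1 :=
      continuous_const.intervalIntegrable _ _
    have key : (∫ x in (0:ℝ)..1, (g ((w x) ^ 2) - l - ν * (deriv v x / v x) ^ 2))
        = ν * (deriv v 1 / v 1) - ν * (deriv v 0 / v 0) := by
      apply intervalIntegral.integral_eq_sub_of_hasDerivAt
        (f := fun x => ν * (deriv v x / v x))
      · intro x hx
        rw [hu] at hx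
        have hx0 := (hpos x hx).ne'
        have := (((ddv x).hasDerivAt.div (dv x).hasDerivAt hx0).const_mul ν)
        refine HasDerivAt.congr_deriv this ?_
        field_simp
        linear_combination (-v x) * hode x hx
      · exact (i4.sub ic).sub (i5.const_mul ν)
    rw [intervalIntegral.integral_sub (i4.sub ic) (i5.const_mul ν),
      intervalIntegral.integral_sub i4 ic,
      intervalIntegral.integral_const_mul, h0, h1] at key
    simp at key
    linarith
  refine ⟨e1, e2, ?_, ?_⟩
  · have n1 : 0 ≤ ∫ x in (0:ℝ)..1, (deriv v x) ^ 2 :=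
      intervalIntegral.integral_nonneg zero_le_one (fun x _ => sq_nonneg _)
    have : (∫ x in (0:ℝ)..1, Cg⁻¹ * ((v x) ^ 2 * (w x) ^ 2))
        ≤ ∫ x in (0:ℝ)..1, g ((w x) ^ 2) * (v x) ^ 2 := by
      apply intervalIntegral.integral_mono_on zero_le_one _ i2
      · intro x _
        have := mul_le_mul_of_nonneg_right (hgb _ (sq_nonneg (w x))).1 (sq_nonneg (v x))
        linarith
      · exact (continuous_const.mul ((cv.pow 2).mul (cw.pow 2))).intervalIntegrable _ _
    rw [intervalIntegral.integral_const_mul] at this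
    have := mul_nonneg hν.le n1
    linarith
  · have n1 : 0 ≤ ∫ x in (0:ℝ)..1, (deriv v x / v x) ^ 2 :=
      intervalIntegral.integral_nonneg zero_le_one (fun x _ => sq_nonneg _)
    have : (∫ x in (0:ℝ)..1, g ((w x) ^ 2)) ≤ ∫ x in (0:ℝ)..1, Cg * (w x) ^ 2 := by
      apply intervalIntegral.integral_mono_on zero_le_one i4
      · exact (continuous_const.mul (cw.pow 2)).intervalIntegrable _ _
      · intro x _
        exact (hgb _ (sq_nonneg (w x))).2
    rw [intervalIntegral.integral_const_mul, hmw] at this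
    have := mul_nonneg hν.le n1
    linarith

theorem stmt_0 (ν Cg l₁ l₂ : ℝ) (g₁ g₂ v₁ v₂ : ℝ → ℝ)
    (hν : 0 < ν) (hCg : 0 < Cg) (hg₁ : GAss Cg g₁) (hg₂ : GAss Cg g₂)
    (hsol : IsSolution ν g₁ g₂ v₁ v₂ l₁ l₂) :
    (ν * ∫ x in (0:ℝ)..1, (deriv v₁ x) ^ 2)
        + (∫ x in (0:ℝ)..1, g₁ ((v₂ x) ^ 2) * (v₁ x) ^ 2) = l₁ ∧
    (ν * ∫ x in (0:ℝ)..1, (deriv v₂ x) ^ 2)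
        + (∫ x in (0:ℝ)..1, g₂ ((v₁ x) ^ 2) * (v₂ x) ^ 2) = l₂ ∧
    (ν * ∫ x in (0:ℝ)..1, (deriv v₁ x / v₁ x) ^ 2) + l₁
        = (∫ x in (0:ℝ)..1, g₁ ((v₂ x) ^ 2)) ∧
    (ν * ∫ x in (0:ℝ)..1, (deriv v₂ x / v₂ x) ^ 2) + l₂
        = (∫ x in (0:ℝ)..1, g₂ ((v₁ x) ^ 2)) ∧
    Cg⁻¹ * (∫ x in (0:ℝ)..1, (v₁ x) ^ 2 * (v₂ x) ^ 2) ≤ l₁ ∧ l₁ ≤ Cg ∧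
    Cg⁻¹ * (∫ x in (0:ℝ)..1, (v₁ x) ^ 2 * (v₂ x) ^ 2) ≤ l₂ ∧ l₂ ≤ Cg := by
  obtain ⟨a1, a2, o1, o2, p1, p2, b1, b2, b3, b4, m1, m2⟩ := hsol
  obtain ⟨A1, A2, A3, A4⟩ := helper_main ν Cg l₁ g₁ v₁ v₂ hν hg₁ a1 a2 o1 p1 b1 b2 m1 m2
  obtain ⟨B1, B2, B3, B4⟩ := helper_main ν Cg l₂ g₂ v₂ v₁ hν hg₂ a2 a1 o2 p2 b3 b4 m2 m1
  refine ⟨A1, B1, A2, B2, A3, A4, ?_, B4⟩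
  simpa only [mul_comm ((v₁ _) ^ 2)] using B3
end

section
/- Let (v₁,v₂,λ₁,λ₂) be a solution of the one-dimensional system with viscosity ν. Then either the solution is trivial, or for each i ∈ {1,2} (with j = 3−i) one has min_{x∈[0,1]} g_i(v_j(x)²) < λ_i < max_{x∈[0,1]} g_i(v_j(x)²). -/
open Set Filter MeasureTheory

theorem aux_const (ν l : ℝ) (v h : ℝ → ℝ) (hν : 0 < ν) (hv : ContDiff ℝ 2 v)
    (he : ∀ x ∈ Set.Icc (0:ℝ) 1, -ν * deriv (deriv v) x + h x * v x = l * v x)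
    (hp : ∀ x ∈ Set.Icc (0:ℝ) 1, 0 < v x) (h0 : deriv v 0 = 0) (h1 : deriv v 1 = 0)
    (hs : (∀ x ∈ Set.Icc (0:ℝ) 1, l ≤ h x) ∨ (∀ x ∈ Set.Icc (0:ℝ) 1, h x ≤ l)) :
    ∀ x ∈ Set.Icc (0:ℝ) 1, h x = l ∧ v x = v 0 := by
  have hd1 : Differentiable ℝ v := hv.differentiable (by norm_num)
  have hd2 : Differentiable ℝ (deriv v) := by
    have : ContDiff ℝ 1 (deriv v) := ((contDiff_succ_iff_deriv (n := 1)).1 hv).2.2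
    exact this.differentiable (by norm_num)
  have m0 : (0:ℝ) ∈ Set.Icc (0:ℝ) 1 := by simp
  have m1 : (1:ℝ) ∈ Set.Icc (0:ℝ) 1 := by simp
  have hz : ∀ x ∈ Set.Icc (0:ℝ) 1, deriv v x = 0 := by
    rcases hs with hs | hs
    · have hm : MonotoneOn (deriv v) (Set.Icc (0:ℝ) 1) := by
        apply monotoneOn_of_deriv_nonneg (convex_Icc 0 1) hd2.continuous.continuousOn
          hd2.differentiableOn
        intro x hx
        have hx' := interior_subset hx
        have a := mul_nonneg (sub_nonneg.2 (hs x hx')) (hp x hx').le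
        have b := he x hx'
        by_contra hc
        push Not at hc
        nlinarith
      intro x hx
      have a := hm m0 hx hx.1
      have b := hm hx m1 hx.2
      linarith
    · have hm : AntitoneOn (deriv v) (Set.Icc (0:ℝ) 1) := by
        apply antitoneOn_of_deriv_nonpos (convex_Icc 0 1) hd2.continuous.continuousOn
          hd2.differentiableOn
        intro x hx
        have hx' := interior_subset hx
        have a := mul_nonneg (sub_nonneg.2 (hs x hx')) (hp x hx').le
        have b := he x hx'
        by_contra hc
        push Not at hc
        nlinarith
      intro x hx
      have a := hm m0 hx hx.1
      have b := hm hx m1 hx.2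
      linarith
  intro x hx
  constructor
  · have a : HasDerivWithinAt (deriv v) (deriv (deriv v) x) (Set.Icc 0 1) x :=
      (hd2 x).hasDerivAt.hasDerivWithinAt
    have b : HasDerivWithinAt (deriv v) 0 (Set.Icc 0 1) x :=
      (hasDerivWithinAt_const x (Set.Icc (0:ℝ) 1) (0:ℝ)).congr hz (hz x hx)
    have c := (uniqueDiffOn_Icc (zero_lt_one (α := ℝ)) x hx).eq_deriv _ a b
    have e := he x hx
    rw [c] at e
    have := (hp x hx).ne'
    apply mul_right_cancel₀ this
    linarith
  · exact constant_of_derivWithin_zero hd1.differentiableOn (fun y hy => by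
      have hy' : y ∈ Set.Icc (0:ℝ) 1 := ⟨hy.1, hy.2.le⟩
      rw [(hd1 y).derivWithin (uniqueDiffOn_Icc (zero_lt_one (α := ℝ)) y hy'), hz y hy']) x hx

theorem aux_one (v : ℝ → ℝ) (hp : ∀ x ∈ Set.Icc (0:ℝ) 1, 0 < v x)
    (hc : ∀ x ∈ Set.Icc (0:ℝ) 1, v x = v 0) (hi : (∫ x in (0:ℝ)..1, (v x) ^ 2) = 1) :
    ∀ x ∈ Set.Icc (0:ℝ) 1, v x = 1 := by
  have e : (∫ x in (0:ℝ)..1, (v x) ^ 2) = ∫ x in (0:ℝ)..1, (v 0) ^ 2 := by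
    apply intervalIntegral.integral_congr
    intro x hx
    rw [Set.uIcc_of_le zero_le_one] at hx
    simp only [hc x hx]
  rw [hi] at e
  simp only [intervalIntegral.integral_const, sub_zero, one_smul] at e
  have := hp 0 (by simp)
  intro x hx
  rw [hc x hx]
  nlinarith [e]

theorem aux_half (ν Cg l : ℝ) (g v w : ℝ → ℝ) (hν : 0 < ν) (hCg : 0 < Cg) (hg : GAss Cg g)
    (hv : ContDiff ℝ 2 v) (hw : ContDiff ℝ 2 w)
    (he : ∀ x ∈ Set.Icc (0:ℝ) 1,
      -ν * deriv (deriv v) x + g ((w x) ^ 2) * v x = l * v x)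
    (hp : ∀ x ∈ Set.Icc (0:ℝ) 1, 0 < v x) (hq : ∀ x ∈ Set.Icc (0:ℝ) 1, 0 < w x)
    (h0 : deriv v 0 = 0) (h1 : deriv v 1 = 0)
    (hi : (∫ x in (0:ℝ)..1, (v x) ^ 2) = 1) (hj : (∫ x in (0:ℝ)..1, (w x) ^ 2) = 1)
    (hnt : ¬ IsTrivialSol v w) :
    sInf ((fun x => g ((w x) ^ 2)) '' Set.Icc (0:ℝ) 1) < l ∧
        l < sSup ((fun x => g ((w x) ^ 2)) '' Set.Icc (0:ℝ) 1) := by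
  have key : ¬ ((∀ x ∈ Set.Icc (0:ℝ) 1, l ≤ g ((w x) ^ 2)) ∨
      (∀ x ∈ Set.Icc (0:ℝ) 1, g ((w x) ^ 2) ≤ l)) := by
    intro hs
    apply hnt
    have hc := aux_const ν l v (fun x => g ((w x) ^ 2)) hν hv he hp h0 h1 hs
    have hwc : ∀ x ∈ Set.Icc (0:ℝ) 1, w x = w 0 := by
      intro x hx
      have m0 : (0:ℝ) ∈ Set.Icc (0:ℝ) 1 := by simp
      have a : g ((w x) ^ 2) = g ((w 0) ^ 2) := (hc x hx).1.trans (hc 0 m0).1.symm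
      have b := hg.2.1.injOn (Set.mem_Ici.2 (sq_nonneg (w x))) (Set.mem_Ici.2 (sq_nonneg (w 0))) a
      exact (pow_left_inj₀ (hq x hx).le (hq 0 m0).le two_ne_zero).1 b
    exact fun x hx => ⟨aux_one v hp (fun y hy => (hc y hy).2) hi x hx, aux_one w hq hwc hj x hx⟩
  have hcont : ContinuousOn (fun x => g ((w x) ^ 2)) (Set.Icc (0:ℝ) 1) :=
    hg.1.continuousOn.comp (hw.continuous.pow 2).continuousOn (fun x _ => sq_nonneg (w x))
  have hK := isCompact_Icc.image_of_continuousOn hcont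
  constructor
  · by_contra hc
    push Not at hc
    exact key (Or.inl fun x hx => hc.trans (csInf_le hK.bddBelow ⟨x, hx, rfl⟩))
  · by_contra hc
    push Not at hc
    exact key (Or.inr fun x hx => (le_csSup hK.bddAbove ⟨x, hx, rfl⟩).trans hc)

theorem stmt_1 (ν Cg l₁ l₂ : ℝ) (g₁ g₂ v₁ v₂ : ℝ → ℝ)
    (hν : 0 < ν) (hCg : 0 < Cg) (hg₁ : GAss Cg g₁) (hg₂ : GAss Cg g₂)
    (hsol : IsSolution ν g₁ g₂ v₁ v₂ l₁ l₂) :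
    IsTrivialSol v₁ v₂ ∨
      ((sInf ((fun x => g₁ ((v₂ x) ^ 2)) '' Set.Icc (0:ℝ) 1) < l₁ ∧
        l₁ < sSup ((fun x => g₁ ((v₂ x) ^ 2)) '' Set.Icc (0:ℝ) 1)) ∧
       (sInf ((fun x => g₂ ((v₁ x) ^ 2)) '' Set.Icc (0:ℝ) 1) < l₂ ∧
        l₂ < sSup ((fun x => g₂ ((v₁ x) ^ 2)) '' Set.Icc (0:ℝ) 1))) := by
  obtain ⟨a1, a2, e1, e2, p1, p2, z1, z2, z3, z4, i1, i2⟩ := hsol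
  by_cases hnt : IsTrivialSol v₁ v₂
  · exact Or.inl hnt
  · exact Or.inr ⟨aux_half ν Cg l₁ g₁ v₁ v₂ hν hCg hg₁ a1 a2 e1 p1 p2 z1 z2 i1 i2 hnt,
      aux_half ν Cg l₂ g₂ v₂ v₁ hν hCg hg₂ a2 a1 e2 p2 p1 z3 z4 i2 i1
        (fun h => hnt fun x hx => (h x hx).symm)⟩
end

section
/- Let (v₁,v₂,λ₁,λ₂) be a solution of the one-dimensional system with viscosity ν. Then v₁ and v₂ have opposite concavity at the endpoints: for each i ∈ {1,2} (with j = 3−i), g_i(v_j(0)²) > λ_i if and only if g_j(v_i(0)²) < λ_j, and g_i(v_j(1)²) > λ_i if and only if g_j(v_i(1)²) < λ_j. -/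
open Set Filter MeasureTheory

/-- Comparison argument: if `p` starts out strictly convex and each of `p`, `q` forces convexity
of the other one once it exceeds its initial value, then `p'` cannot vanish at `1`. -/
theorem coop_aux (p p1 p2 q q1 q2 : ℝ → ℝ)
    (hp : ∀ x, HasDerivAt p (p1 x) x) (hp1 : ∀ x, HasDerivAt p1 (p2 x) x)
    (hq : ∀ x, HasDerivAt q (q1 x) x) (hq1 : ∀ x, HasDerivAt q1 (q2 x) x)
    (hp0 : p1 0 = 0) (hq0 : q1 0 = 0) (hpe : p1 1 = 0)
    (hA : ∀ x ∈ Set.Icc (0:ℝ) 1, q 0 < q x → 0 < p2 x)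
    (hB : ∀ x ∈ Set.Icc (0:ℝ) 1, p 0 < p x → 0 < q2 x)
    (h0 : 0 < p2 0) : False := by
  have mono : ∀ (f f1 : ℝ → ℝ), (∀ x, HasDerivAt f (f1 x) x) → ∀ t : ℝ,
      (∀ x, 0 < x → x < t → 0 < f1 x) → ∀ x, 0 < x → x ≤ t → f 0 < f x := by
    intro f f1 hf t h x hx hxt
    have hs : StrictMonoOn f (Set.Icc 0 t) := by
      apply strictMonoOn_of_deriv_pos (convex_Icc 0 t)
      · exact fun y _ => (hf y).continuousAt.continuousWithinAt
      · intro y hy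
        rw [interior_Icc] at hy
        rw [(hf y).deriv]
        exact h y hy.1 hy.2
    exact hs ⟨le_refl _, hx.le.trans hxt⟩ ⟨hx.le, hxt⟩ hx
  have cp1 : Continuous p1 := continuous_iff_continuousAt.2 fun x => (hp1 x).continuousAt
  have cq1 : Continuous q1 := continuous_iff_continuousAt.2 fun x => (hq1 x).continuousAt
  obtain ⟨d, hd, hpd⟩ : ∃ d : ℝ, 0 < d ∧ ∀ x, 0 < x → x < d → 0 < p1 x := by
    have h1 := (hasDerivAt_iff_tendsto_slope.1 (hp1 0)).eventually (lt_mem_nhds h0)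
    have h2 := h1.filter_mono (nhdsWithin_mono 0 (fun y (hy : y ∈ Set.Ioi (0:ℝ)) => ne_of_gt hy))
    obtain ⟨d, hd, hs⟩ := mem_nhdsGT_iff_exists_Ioo_subset.1 h2
    refine ⟨d, hd, fun x hx hxd => ?_⟩
    have h3 : 0 < slope p1 0 x := hs ⟨hx, hxd⟩
    rw [slope_def_field, hp0, sub_zero, sub_zero] at h3
    exact (div_pos_iff_of_pos_right hx).1 h3
  have hd1 : d ≤ 1 := by
    by_contra hcon
    have := hpd 1 one_pos (not_le.1 hcon)
    linarith
  have hqd : ∀ x, 0 < x → x < d → 0 < q1 x := by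
    intro x hx hxd
    have := mono q1 q2 hq1 x (fun y hy hyx => hB y ⟨hy.le, by linarith⟩
      (mono p p1 hp d hpd y hy (by linarith))) x hx le_rfl
    linarith
  obtain ⟨T, ⟨⟨hTd, hT1⟩, hTw⟩, hmin⟩ : ∃ T, IsLeast
      (Set.Icc d 1 ∩ {x | min (p1 x) (q1 x) ≤ 0}) T := by
    apply IsCompact.exists_isLeast
    · exact isCompact_Icc.inter_right (isClosed_le (cp1.min cq1) continuous_const)
    · exact ⟨1, ⟨hd1, le_rfl⟩, by simp [hpe]⟩
  have hw : ∀ x, 0 < x → x < T → 0 < p1 x ∧ 0 < q1 x := by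
    intro x hx hxT
    rcases lt_or_ge x d with h | h
    · exact ⟨hpd x hx h, hqd x hx h⟩
    · by_contra hcon
      have : T ≤ x := hmin ⟨⟨h, by linarith⟩, by
        show min (p1 x) (q1 x) ≤ 0
        by_contra h'
        exact hcon (lt_min_iff.1 (not_le.1 h'))⟩
      linarith
  have hT0 : 0 < T := by linarith
  have e1 := mono p1 p2 hp1 T (fun y hy hyT => hA y ⟨hy.le, by linarith⟩
      (mono q q1 hq T (fun x hx hxT => (hw x hx hxT).2) y hy hyT.le)) T hT0 le_rfl
  have e2 := mono q1 q2 hq1 T (fun y hy hyT => hB y ⟨hy.le, by linarith⟩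
      (mono p p1 hp T (fun x hx hxT => (hw x hx hxT).1) y hy hyT.le)) T hT0 le_rfl
  rw [hp0] at e1
  rw [hq0] at e2
  exact absurd hTw (not_le.2 (lt_min e1 e2))

/-- The two forbidden sign patterns at the left endpoint. -/
theorem end_aux (ν l m : ℝ) (g h p p1 p2 q q1 q2 : ℝ → ℝ) (hν : 0 < ν)
    (hg : StrictMonoOn g (Set.Ici 0)) (hh : StrictMonoOn h (Set.Ici 0))
    (hp : ∀ x, HasDerivAt p (p1 x) x) (hp1 : ∀ x, HasDerivAt p1 (p2 x) x)
    (hq : ∀ x, HasDerivAt q (q1 x) x) (hq1 : ∀ x, HasDerivAt q1 (q2 x) x)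
    (hp0 : p1 0 = 0) (hq0 : q1 0 = 0) (hpe : p1 1 = 0)
    (ep : ∀ x ∈ Set.Icc (0:ℝ) 1, -ν * p2 x + g ((q x) ^ 2) * p x = l * p x)
    (eq : ∀ x ∈ Set.Icc (0:ℝ) 1, -ν * q2 x + h ((p x) ^ 2) * q x = m * q x)
    (pp : ∀ x ∈ Set.Icc (0:ℝ) 1, 0 < p x) (pq : ∀ x ∈ Set.Icc (0:ℝ) 1, 0 < q x) :
    (l < g ((q 0) ^ 2) → h ((p 0) ^ 2) < m) ∧ (g ((q 0) ^ 2) < l → m < h ((p 0) ^ 2)) := by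
  have z : (0:ℝ) ∈ Set.Icc (0:ℝ) 1 := ⟨le_rfl, zero_le_one⟩
  have pos : ∀ a b c k : ℝ, 0 < c → -ν * a + b * c = k * c → k < b → 0 < a := by
    intro a b c k hc e hk
    have : 0 < ν * a := by nlinarith [mul_pos hc (sub_pos.2 hk)]
    exact (mul_pos_iff_of_pos_left hν).1 this
  have neg : ∀ a b c k : ℝ, 0 < c → -ν * a + b * c = k * c → b < k → 0 < -a := by
    intro a b c k hc e hk
    have : 0 < ν * (-a) := by nlinarith [mul_pos hc (sub_pos.2 hk)]
    exact (mul_pos_iff_of_pos_left hν).1 this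
  have inc : ∀ f : ℝ → ℝ, StrictMonoOn f (Set.Ici 0) → ∀ a b : ℝ, 0 < a → a < b →
      f (a ^ 2) < f (b ^ 2) := by
    intro f hf a b ha hab
    exact hf (Set.mem_Ici.2 (sq_nonneg a)) (Set.mem_Ici.2 (sq_nonneg b)) (by nlinarith)
  constructor
  · intro h1
    by_contra h2
    refine coop_aux p p1 p2 q q1 q2 hp hp1 hq hq1 hp0 hq0 hpe ?_ ?_
      (pos _ _ _ _ (pp 0 z) (ep 0 z) h1)
    · intro x hx hlt
      exact pos _ _ _ _ (pp x hx) (ep x hx) (h1.trans (inc g hg _ _ (pq 0 z) hlt))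
    · intro x hx hlt
      exact pos _ _ _ _ (pq x hx) (eq x hx) ((not_lt.1 h2).trans_lt (inc h hh _ _ (pp 0 z) hlt))
  · intro h1
    by_contra h2
    refine coop_aux (fun x => - p x) (fun x => - p1 x) (fun x => - p2 x)
      (fun x => - q x) (fun x => - q1 x) (fun x => - q2 x)
      (fun x => (hp x).neg) (fun x => (hp1 x).neg) (fun x => (hq x).neg) (fun x => (hq1 x).neg)
      (by simp [hp0]) (by simp [hq0]) (by simp [hpe]) ?_ ?_
      (neg _ _ _ _ (pp 0 z) (ep 0 z) h1)
    · intro x hx hlt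
      exact neg _ _ _ _ (pp x hx) (ep x hx)
        ((inc g hg _ _ (pq x hx) (neg_lt_neg_iff.1 hlt)).trans h1)
    · intro x hx hlt
      exact neg _ _ _ _ (pq x hx) (eq x hx)
        ((inc h hh _ _ (pp x hx) (neg_lt_neg_iff.1 hlt)).trans_le (not_lt.1 h2))

theorem stmt_2 (ν Cg l₁ l₂ : ℝ) (g₁ g₂ v₁ v₂ : ℝ → ℝ)
    (hν : 0 < ν) (hCg : 0 < Cg) (hg₁ : GAss Cg g₁) (hg₂ : GAss Cg g₂)
    (hsol : IsSolution ν g₁ g₂ v₁ v₂ l₁ l₂) :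
    (g₁ ((v₂ 0) ^ 2) > l₁ ↔ g₂ ((v₁ 0) ^ 2) < l₂) ∧
    (g₂ ((v₁ 0) ^ 2) > l₂ ↔ g₁ ((v₂ 0) ^ 2) < l₁) ∧
    (g₁ ((v₂ 1) ^ 2) > l₁ ↔ g₂ ((v₁ 1) ^ 2) < l₂) ∧
    (g₂ ((v₁ 1) ^ 2) > l₂ ↔ g₁ ((v₂ 1) ^ 2) < l₁) := by
  obtain ⟨c1, c2, e1, e2, p1, p2, n10, n11, n20, n21, -, -⟩ := hsol
  have d : ∀ v : ℝ → ℝ, ContDiff ℝ 2 v → ∀ x, HasDerivAt v (deriv v x) x := fun v hv x =>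
    (hv.differentiable (by norm_num) x).hasDerivAt
  have dd : ∀ v : ℝ → ℝ, ContDiff ℝ 2 v → ∀ x, HasDerivAt (deriv v) (deriv (deriv v) x) x := by
    intro v hv x
    have h2 : ContDiff ℝ (1 + 1) v := by
      have : (1 + 1 : WithTop ℕ∞) = 2 := by norm_num
      rw [this]; exact hv
    exact (((contDiff_succ_iff_deriv.1 h2).2.2).differentiable (by norm_num) x).hasDerivAt
  have r : ∀ f f' : ℝ → ℝ, (∀ x, HasDerivAt f (f' x) x) →
      ∀ x, HasDerivAt (fun y => f (1 - y)) (- f' (1 - x)) x := by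
    intro f f' hf x
    have := (hf (1 - x)).comp x ((hasDerivAt_id x).const_sub 1)
    simpa [Function.comp_def] using this
  have rr : ∀ f f' : ℝ → ℝ, (∀ x, HasDerivAt f (f' x) x) →
      ∀ x, HasDerivAt (fun y => - f (1 - y)) (f' (1 - x)) x := by
    intro f f' hf x
    simpa using (r f f' hf x).fun_neg
  have rI : ∀ x ∈ Set.Icc (0:ℝ) 1, 1 - x ∈ Set.Icc (0:ℝ) 1 := by
    intro x hx
    exact ⟨by linarith [hx.2], by linarith [hx.1]⟩
  have A := end_aux ν l₁ l₂ g₁ g₂ v₁ _ _ v₂ _ _ hν hg₁.2.1 hg₂.2.1 (d v₁ c1) (dd v₁ c1)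
    (d v₂ c2) (dd v₂ c2) n10 n20 n11 e1 e2 p1 p2
  have B := end_aux ν l₂ l₁ g₂ g₁ v₂ _ _ v₁ _ _ hν hg₂.2.1 hg₁.2.1 (d v₂ c2) (dd v₂ c2)
    (d v₁ c1) (dd v₁ c1) n20 n10 n21 e2 e1 p2 p1
  have C := end_aux ν l₁ l₂ g₁ g₂ (fun x => v₁ (1 - x)) _ _ (fun x => v₂ (1 - x)) _ _ hν
    hg₁.2.1 hg₂.2.1 (r _ _ (d v₁ c1)) (rr _ _ (dd v₁ c1)) (r _ _ (d v₂ c2)) (rr _ _ (dd v₂ c2))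
    (by simp [n11]) (by simp [n21]) (by simp [n10]) (fun x hx => e1 _ (rI x hx))
    (fun x hx => e2 _ (rI x hx)) (fun x hx => p1 _ (rI x hx)) (fun x hx => p2 _ (rI x hx))
  have D := end_aux ν l₂ l₁ g₂ g₁ (fun x => v₂ (1 - x)) _ _ (fun x => v₁ (1 - x)) _ _ hν
    hg₂.2.1 hg₁.2.1 (r _ _ (d v₂ c2)) (rr _ _ (dd v₂ c2)) (r _ _ (d v₁ c1)) (rr _ _ (dd v₁ c1))
    (by simp [n21]) (by simp [n11]) (by simp [n20]) (fun x hx => e2 _ (rI x hx))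
    (fun x hx => e1 _ (rI x hx)) (fun x hx => p2 _ (rI x hx)) (fun x hx => p1 _ (rI x hx))
  simp only [sub_zero] at C D
  exact ⟨⟨A.1, B.2⟩, ⟨B.1, A.2⟩, ⟨C.1, D.2⟩, ⟨D.1, C.2⟩⟩
end

section
/- Let (v₁,v₂,λ₁,λ₂) be a solution of the one-dimensional system with viscosity ν and suppose one of the following conditions holds: (1) there exists ξ ∈ [0,1] with g₁(v₂(ξ)²) = λ₁, g₂(v₁(ξ)²) = λ₂ and v₁'(ξ) = v₂'(ξ) = 0; (2) there exist 0 ≤ x₁ < x₂ ≤ 1 such that, for some i ∈ {1,2}, v_i is constant on [x₁,x₂]; (3) g_i(v_j(0)²) = λ_i for some i (j = 3−i); (4) g_i(v_j(1)²) = λ_i for some i (j = 3−i). Then (v₁,v₂) is the trivial solution. -/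
open Set Filter MeasureTheory

theorem aux_mono (f : ℝ → ℝ) (hf : Differentiable ℝ f) (t : ℝ)
    (h : ∀ x, 0 ≤ x → x < t → 0 ≤ deriv f x) (x : ℝ) (hx0 : 0 ≤ x) (hxt : x ≤ t) :
    f 0 ≤ f x := by
  have hm : MonotoneOn f (Icc 0 t) := by
    apply monotoneOn_of_deriv_nonneg (convex_Icc 0 t) hf.continuous.continuousOn
      hf.differentiableOn
    intro y hy
    rw [interior_Icc] at hy
    exact h y hy.1.le hy.2
  exact hm ⟨le_rfl, hx0.trans hxt⟩ ⟨hx0, hxt⟩ hx0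

theorem aux_d (f : ℝ → ℝ) (hf : ContDiff ℝ 2 f) :
    Differentiable ℝ f ∧ Differentiable ℝ (deriv f) ∧ Continuous (deriv (deriv f)) := by
  have h1 : ContDiff ℝ 1 (deriv f) := by
    have h2 : ContDiff ℝ (1 + 1) f := by simpa [one_add_one_eq_two] using hf
    exact (contDiff_succ_iff_deriv.1 h2).2.2
  exact ⟨hf.differentiable (by norm_num), h1.differentiable (by norm_num),
    h1.continuous_deriv (by norm_num)⟩

/-- Convexity propagates, contradicting the Neumann condition at `1`. -/
theorem aux_sign (u w : ℝ → ℝ) (hu : ContDiff ℝ 2 u) (hw : ContDiff ℝ 2 w)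
    (hu0 : deriv u 0 = 0) (hw0 : deriv w 0 = 0) (hw1 : deriv w 1 = 0)
    (h1 : ∀ x ∈ Icc (0:ℝ) 1, w 0 ≤ w x → 0 ≤ deriv (deriv u) x)
    (h2 : ∀ x ∈ Icc (0:ℝ) 1, u 0 ≤ u x → 0 < deriv (deriv w) x) : False := by
  obtain ⟨hu1, hu2, hu3⟩ := aux_d u hu
  obtain ⟨hw1', hw2, hw3⟩ := aux_d w hw
  by_cases hZ : ∃ t ∈ Icc (0:ℝ) 1, deriv (deriv w) t ≤ 0
  · have hcomp : IsCompact (Icc (0:ℝ) 1 ∩ {t | deriv (deriv w) t ≤ 0}) :=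
      isCompact_Icc.inter_right (isClosed_le hw3 continuous_const)
    obtain ⟨t₀, ht₀, ht₀'⟩ := hZ
    obtain ⟨t, ⟨ht, htw⟩, hmin⟩ := hcomp.exists_isLeast ⟨t₀, ht₀, ht₀'⟩
    have hpos : ∀ x, 0 ≤ x → x < t → 0 ≤ deriv (deriv w) x := by
      intro x hx hxt
      by_contra hc
      have := hmin ⟨⟨hx, hxt.le.trans ht.2⟩, (not_le.1 hc).le⟩
      linarith
    have a1 := aux_mono (deriv w) hw2 t hpos
    have a2 := aux_mono w hw1' t (fun x hx hxt => by
      have := a1 x hx hxt.le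
      linarith)
    have a3 := aux_mono (deriv u) hu2 t (fun x hx hxt =>
      h1 x ⟨hx, hxt.le.trans ht.2⟩ (a2 x hx hxt.le))
    have a4 := aux_mono u hu1 t (fun x hx hxt => by
      have := a3 x hx hxt.le
      linarith)
    have := h2 t ht (a4 t ht.1 le_rfl)
    exact absurd htw (not_le.2 this)
  · push Not at hZ
    have hm : StrictMonoOn (deriv w) (Icc 0 1) := by
      apply strictMonoOn_of_deriv_pos (convex_Icc 0 1) hw2.continuous.continuousOn
      intro y hy
      rw [interior_Icc] at hy
      exact hZ y ⟨hy.1.le, hy.2.le⟩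
    have := hm (show (0:ℝ) ∈ Icc 0 1 by simp) (show (1:ℝ) ∈ Icc 0 1 by simp) one_pos
    linarith

/-- Forward uniqueness for a second order linear differential inequality. -/
theorem aux_unique (u w : ℝ → ℝ) (hu : ContDiff ℝ 2 u) (hw : ContDiff ℝ 2 w)
    (a b K c d : ℝ) (hua : u a = c) (hwa : w a = d)
    (hu0 : deriv u a = 0) (hw0 : deriv w a = 0)
    (h1 : ∀ x ∈ Icc a b, |deriv (deriv u) x| ≤ K * |w x - d|)
    (h2 : ∀ x ∈ Icc a b, |deriv (deriv w) x| ≤ K * |u x - c|) :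
    ∀ x ∈ Icc a b, u x = c ∧ w x = d := by
  obtain ⟨hu1, hu2, hu3⟩ := aux_d u hu
  obtain ⟨hw1', hw2, hw3⟩ := aux_d w hw
  have key := eq_zero_of_abs_deriv_le_mul_abs_self_of_eq_zero_right
    (f := fun x => ((u x - c, w x - d), (deriv u x, deriv w x)))
    (f' := fun x => ((deriv u x, deriv w x), (deriv (deriv u) x, deriv (deriv w) x)))
    (K := max K 1) (a := a) (b := b)
    (by
      have := hu1.continuous
      have := hw1'.continuous
      have := hu2.continuous
      have := hw2.continuous
      fun_prop)
    (by
      intro x hx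
      apply HasDerivAt.hasDerivWithinAt
      exact (((hu1 x).hasDerivAt.sub_const c).prodMk ((hw1' x).hasDerivAt.sub_const d)).prodMk
        ((hu2 x).hasDerivAt.prodMk (hw2 x).hasDerivAt))
    (by simp [hua, hwa, hu0, hw0])
    (by
      intro x hx
      have e1 := h1 x ⟨hx.1, hx.2.le⟩
      have e2 := h2 x ⟨hx.1, hx.2.le⟩
      simp only [Prod.norm_def, Real.norm_eq_abs]
      set N := max (max |u x - c| |w x - d|) (max |deriv u x| |deriv w x|) with hN
      have n1 : |u x - c| ≤ N := (le_max_left _ _).trans (le_max_left _ _)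
      have n2 : |w x - d| ≤ N := (le_max_right _ _).trans (le_max_left _ _)
      have n3 : |deriv u x| ≤ N := (le_max_left _ _).trans (le_max_right _ _)
      have n4 : |deriv w x| ≤ N := (le_max_right _ _).trans (le_max_right _ _)
      have hN0 : 0 ≤ N := (abs_nonneg _).trans n1
      have m1 : N ≤ max K 1 * N := by
        nlinarith [le_max_right K 1]
      have m2 : ∀ y, 0 ≤ y → y ≤ N → K * y ≤ max K 1 * N := by
        intro y hy hyN
        exact mul_le_mul (le_max_left _ _) hyN hy (zero_le_one.trans (le_max_right _ _))
      refine max_le (max_le (n3.trans m1) (n4.trans m1)) (max_le ?_ ?_)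
      · exact e1.trans (m2 _ (abs_nonneg _) n2)
      · exact e2.trans (m2 _ (abs_nonneg _) n1))
  intro x hx
  have := key x hx
  simp only [Prod.mk_eq_zero, sub_eq_zero] at this
  exact this.1

theorem sol_swap {ν : ℝ} {g₁ g₂ v₁ v₂ : ℝ → ℝ} {l₁ l₂ : ℝ}
    (h : IsSolution ν g₁ g₂ v₁ v₂ l₁ l₂) : IsSolution ν g₂ g₁ v₂ v₁ l₂ l₁ := by
  obtain ⟨a, b, c, d, e, f, p, q, r, s, t, u⟩ := h
  exact ⟨b, a, d, c, f, e, r, s, p, q, u, t⟩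

theorem aux_refl_deriv (v : ℝ → ℝ) : deriv (fun x => v (1 - x)) = fun x => - deriv v (1 - x) := by
  funext x
  exact deriv_comp_const_sub ..

theorem aux_refl_deriv2 (v : ℝ → ℝ) :
    deriv (deriv (fun x => v (1 - x))) = fun x => deriv (deriv v) (1 - x) := by
  rw [aux_refl_deriv]
  funext x
  rw [deriv.fun_neg, deriv_comp_const_sub, neg_neg]

theorem sol_refl {ν : ℝ} {g₁ g₂ v₁ v₂ : ℝ → ℝ} {l₁ l₂ : ℝ}
    (h : IsSolution ν g₁ g₂ v₁ v₂ l₁ l₂) :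
    IsSolution ν g₁ g₂ (fun x => v₁ (1 - x)) (fun x => v₂ (1 - x)) l₁ l₂ := by
  obtain ⟨a, b, c, d, e, f, p, q, r, s, t, u⟩ := h
  have hI : ∀ x ∈ Icc (0:ℝ) 1, 1 - x ∈ Icc (0:ℝ) 1 := fun x hx =>
    ⟨by linarith [hx.2], by linarith [hx.1]⟩
  refine ⟨a.comp (contDiff_const.sub contDiff_id), b.comp (contDiff_const.sub contDiff_id),
    ?_, ?_, fun x hx => e _ (hI x hx), fun x hx => f _ (hI x hx), ?_, ?_, ?_, ?_, ?_, ?_⟩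
  · intro x hx
    rw [aux_refl_deriv2]
    exact c _ (hI x hx)
  · intro x hx
    rw [aux_refl_deriv2]
    exact d _ (hI x hx)
  · simp [aux_refl_deriv, q]
  · simp [aux_refl_deriv, p]
  · simp [aux_refl_deriv, s]
  · simp [aux_refl_deriv, r]
  · rw [intervalIntegral.integral_comp_sub_left (fun x => v₁ x ^ 2)]
    simpa using t
  · rw [intervalIntegral.integral_comp_sub_left (fun x => v₂ x ^ 2)]
    simpa using u

/-- One-sided bound on the second derivative near an equilibrium. -/
theorem aux_bound {ν Cg l : ℝ} {g u w : ℝ → ℝ} (hν : 0 < ν) (hg : GAss Cg g)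
    (hu : Continuous u) (hw : Continuous w)
    (hode : ∀ x ∈ Icc (0:ℝ) 1, -ν * deriv (deriv u) x + g ((w x) ^ 2) * u x = l * u x)
    (d : ℝ) (ξ : ℝ) (hξ : ξ ∈ Icc (0:ℝ) 1) (hd : w ξ = d) (hl : g (d ^ 2) = l) :
    ∃ K : ℝ, ∀ x ∈ Icc (0:ℝ) 1, |deriv (deriv u) x| ≤ K * |w x - d| := by
  have hG : ContDiff ℝ 2 (fun y : ℝ => g (y ^ 2)) := by
    rw [← contDiffOn_univ]
    exact hg.1.comp ((contDiff_id.pow 2).contDiffOn) (fun y _ => sq_nonneg y)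
  have hG1 : ContDiff ℝ 1 (fun y : ℝ => g (y ^ 2)) := hG.of_le (by norm_num)
  have hcomp : IsCompact (w '' Icc (0:ℝ) 1) := isCompact_Icc.image hw
  obtain ⟨L, hL⟩ := LocallyLipschitzOn.exists_lipschitzOnWith_of_compact hcomp
    (hG1.locallyLipschitz.locallyLipschitzOn)
  obtain ⟨M, hM⟩ := (isCompact_Icc (a := (0:ℝ)) (b := 1)).exists_bound_of_continuousOn
    hu.continuousOn
  refine ⟨L * M / ν, fun x hx => ?_⟩
  have e := hode x hx
  have e1 : deriv (deriv u) x = (g (w x ^ 2) - g (d ^ 2)) * u x / ν := by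
    rw [hl]
    field_simp
    linarith
  have e2 := hL.dist_le_mul (w x) ⟨x, hx, rfl⟩ d ⟨ξ, hξ, hd⟩
  rw [Real.dist_eq, Real.dist_eq] at e2
  have e3 := hM x hx
  rw [Real.norm_eq_abs] at e3
  rw [e1, abs_div, abs_mul, abs_of_pos hν, div_mul_eq_mul_div]
  refine div_le_div_of_nonneg_right ?_ hν.le
  calc |g (w x ^ 2) - g (d ^ 2)| * |u x| ≤ (L * |w x - d|) * M := by gcongr
    _ = L * M * |w x - d| := by ring

theorem forward_const {ν Cg l₁ l₂ : ℝ} {g₁ g₂ v₁ v₂ : ℝ → ℝ}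
    (hν : 0 < ν) (hg₁ : GAss Cg g₁) (hg₂ : GAss Cg g₂)
    (hsol : IsSolution ν g₁ g₂ v₁ v₂ l₁ l₂) (ξ : ℝ) (hξ : ξ ∈ Icc (0:ℝ) 1)
    (h1 : g₁ ((v₂ ξ) ^ 2) = l₁) (h2 : g₂ ((v₁ ξ) ^ 2) = l₂)
    (h3 : deriv v₁ ξ = 0) (h4 : deriv v₂ ξ = 0) :
    ∀ x ∈ Icc ξ 1, v₁ x = v₁ ξ ∧ v₂ x = v₂ ξ := by
  obtain ⟨a, b, c, d, e, f, p, q, r, s, t, u⟩ := hsol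
  obtain ⟨K₁, hK₁⟩ := aux_bound hν hg₁ a.continuous b.continuous c _ ξ hξ rfl h1
  obtain ⟨K₂, hK₂⟩ := aux_bound hν hg₂ b.continuous a.continuous d _ ξ hξ rfl h2
  refine aux_unique v₁ v₂ a b ξ 1 (max K₁ K₂) _ _ rfl rfl h3 h4 ?_ ?_
  · intro x hx
    refine (hK₁ x ⟨hξ.1.trans hx.1, hx.2⟩).trans ?_
    gcongr
    exact le_max_left _ _
  · intro x hx
    refine (hK₂ x ⟨hξ.1.trans hx.1, hx.2⟩).trans ?_
    gcongr
    exact le_max_right _ _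

theorem aux_one_s3 (v : ℝ → ℝ) (c : ℝ) (hc : 0 < c) (h : ∀ x ∈ Icc (0:ℝ) 1, v x = c)
    (hi : (∫ x in (0:ℝ)..1, (v x) ^ 2) = 1) : c = 1 := by
  have : (∫ x in (0:ℝ)..1, (v x) ^ 2) = ∫ x in (0:ℝ)..1, c ^ 2 := by
    apply intervalIntegral.integral_congr
    intro x hx
    rw [uIcc_of_le zero_le_one] at hx
    simp [h x hx]
  rw [this] at hi
  simp at hi
  rcases hi with hi | hi <;> linarith

theorem case_one {ν Cg l₁ l₂ : ℝ} {g₁ g₂ v₁ v₂ : ℝ → ℝ}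
    (hν : 0 < ν) (hg₁ : GAss Cg g₁) (hg₂ : GAss Cg g₂)
    (hsol : IsSolution ν g₁ g₂ v₁ v₂ l₁ l₂) (ξ : ℝ) (hξ : ξ ∈ Icc (0:ℝ) 1)
    (h1 : g₁ ((v₂ ξ) ^ 2) = l₁) (h2 : g₂ ((v₁ ξ) ^ 2) = l₂)
    (h3 : deriv v₁ ξ = 0) (h4 : deriv v₂ ξ = 0) : IsTrivialSol v₁ v₂ := by
  have hF := forward_const hν hg₁ hg₂ hsol ξ hξ h1 h2 h3 h4
  have hB := forward_const hν hg₁ hg₂ (sol_refl hsol) (1 - ξ)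
    ⟨by linarith [hξ.2], by linarith [hξ.1]⟩ (by simpa using h1) (by simpa using h2)
    (by simp [aux_refl_deriv, h3]) (by simp [aux_refl_deriv, h4])
  have hall : ∀ x ∈ Icc (0:ℝ) 1, v₁ x = v₁ ξ ∧ v₂ x = v₂ ξ := by
    intro x hx
    rcases le_total ξ x with h | h
    · exact hF x ⟨h, hx.2⟩
    · have := hB (1 - x) ⟨by linarith, by linarith [hx.1]⟩
      simpa using this
  obtain ⟨a, b, c, d, e, f, p, q, r, s, t, u⟩ := hsol
  have k1 := aux_one_s3 v₁ _ (e ξ hξ) (fun x hx => (hall x hx).1) t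
  have k2 := aux_one_s3 v₂ _ (f ξ hξ) (fun x hx => (hall x hx).2) u
  intro x hx
  exact ⟨(hall x hx).1.trans k1, (hall x hx).2.trans k2⟩

theorem case_two {ν Cg l₁ l₂ : ℝ} {g₁ g₂ v₁ v₂ : ℝ → ℝ}
    (hν : 0 < ν) (hg₁ : GAss Cg g₁) (hg₂ : GAss Cg g₂)
    (hsol : IsSolution ν g₁ g₂ v₁ v₂ l₁ l₂) (x₁ x₂ : ℝ) (h0 : 0 ≤ x₁) (h12 : x₁ < x₂)
    (h1 : x₂ ≤ 1) (hc : ∀ x ∈ Icc x₁ x₂, v₁ x = v₁ x₁) : IsTrivialSol v₁ v₂ := by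
  obtain ⟨a, b, c, d, e, f, -⟩ := id hsol
  have hsub : ∀ x ∈ Ioo x₁ x₂, x ∈ Icc (0:ℝ) 1 := fun x hx =>
    ⟨h0.trans hx.1.le, hx.2.le.trans h1⟩
  -- derivatives of a function constant on an open interval
  have hder : ∀ (w : ℝ → ℝ) (k : ℝ), (∀ x ∈ Ioo x₁ x₂, w x = k) →
      ∀ x ∈ Ioo x₁ x₂, deriv w x = 0 := by
    intro w k hw x hx
    have : w =ᶠ[nhds x] fun _ => k := by
      filter_upwards [isOpen_Ioo.mem_nhds hx] with y hy using hw y hy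
    rw [this.deriv_eq]
    simp
  have u1 := hder v₁ _ (fun x hx => hc x ⟨hx.1.le, hx.2.le⟩)
  have u2 := hder (deriv v₁) 0 u1
  have hg : ∀ x ∈ Ioo x₁ x₂, g₁ (v₂ x ^ 2) = l₁ := by
    intro x hx
    have := c x (hsub x hx)
    rw [u2 x hx] at this
    have hp := e x (hsub x hx)
    have h' : g₁ (v₂ x ^ 2) * v₁ x = l₁ * v₁ x := by linarith
    exact mul_right_cancel₀ hp.ne' h'
  have hm : (x₁ + x₂) / 2 ∈ Ioo x₁ x₂ := ⟨by linarith, by linarith⟩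
  have hv2 : ∀ x ∈ Ioo x₁ x₂, v₂ x = v₂ ((x₁ + x₂) / 2) := by
    intro x hx
    have h' := hg₁.2.1.injOn (sq_nonneg (v₂ x)) (sq_nonneg (v₂ ((x₁ + x₂) / 2)))
      ((hg x hx).trans (hg _ hm).symm)
    exact (pow_left_inj₀ (f x (hsub x hx)).le (f _ (hsub _ hm)).le two_ne_zero).1 h'
  have w1 := hder v₂ _ hv2
  have w2 := hder (deriv v₂) 0 w1
  refine case_one hν hg₁ hg₂ hsol _ (hsub _ hm) (hg _ hm) ?_ (u1 _ hm) (w1 _ hm)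
  have := d _ (hsub _ hm)
  rw [w2 _ hm] at this
  have hp := f _ (hsub _ hm)
  exact mul_right_cancel₀ hp.ne' (by linarith)

theorem case_three {ν Cg l₁ l₂ : ℝ} {g₁ g₂ v₁ v₂ : ℝ → ℝ}
    (hν : 0 < ν) (hg₁ : GAss Cg g₁) (hg₂ : GAss Cg g₂)
    (hsol : IsSolution ν g₁ g₂ v₁ v₂ l₁ l₂) (h : g₁ ((v₂ 0) ^ 2) = l₁) :
    IsTrivialSol v₁ v₂ := by
  obtain ⟨a, b, c, d, e, f, p, q, r, s, t, u⟩ := id hsol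
  have hz : (0:ℝ) ∈ Icc (0:ℝ) 1 := by simp
  have mono₁ : ∀ x y, 0 ≤ x → x ≤ y → g₁ (x ^ 2) ≤ g₁ (y ^ 2) := fun x y hx hxy =>
    hg₁.2.1.monotoneOn (sq_nonneg x) (sq_nonneg y) (pow_le_pow_left₀ hx hxy 2)
  have mono₂ : ∀ x y, 0 ≤ x → x ≤ y → g₂ (x ^ 2) ≤ g₂ (y ^ 2) := fun x y hx hxy =>
    hg₂.2.1.monotoneOn (sq_nonneg x) (sq_nonneg y) (pow_le_pow_left₀ hx hxy 2)
  rcases lt_trichotomy (g₂ (v₁ 0 ^ 2)) l₂ with hlt | heq | hgt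
  · exfalso
    have n1 : ∀ v : ℝ → ℝ, deriv (fun x => - v x) = fun x => - deriv v x := by
      intro v
      funext x
      exact deriv.fun_neg
    refine aux_sign (fun x => - v₁ x) (fun x => - v₂ x) a.neg b.neg (by simp [n1, p])
      (by simp [n1, r]) (by simp [n1, s]) ?_ ?_
    · intro x hx hle
      have h1 := mono₁ _ _ (f x hx).le (neg_le_neg_iff.1 hle)
      have h2 := c x hx
      rw [n1, n1]
      have h3 := mul_nonneg (sub_nonneg.2 (h1.trans h.le)) (e x hx).le
      have h4 : 0 ≤ ν * -deriv (deriv v₁) x := by linarith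
      exact (mul_nonneg_iff_of_pos_left hν).1 h4
    · intro x hx hle
      have h1 := mono₂ _ _ (e x hx).le (neg_le_neg_iff.1 hle)
      have h2 := d x hx
      rw [n1, n1]
      have h3 := mul_pos (sub_pos.2 (h1.trans_lt hlt)) (f x hx)
      have h4 : 0 < ν * -deriv (deriv v₂) x := by linarith
      exact (mul_pos_iff_of_pos_left hν).1 h4
  · exact case_one hν hg₁ hg₂ hsol 0 hz h heq p r
  · exfalso
    refine aux_sign v₁ v₂ a b p r s ?_ ?_
    · intro x hx hle
      have h1 := mono₁ _ _ (f 0 hz).le hle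
      have h2 := c x hx
      have h3 := mul_nonneg (sub_nonneg.2 (h.ge.trans h1)) (e x hx).le
      have h4 : 0 ≤ ν * deriv (deriv v₁) x := by linarith
      exact (mul_nonneg_iff_of_pos_left hν).1 h4
    · intro x hx hle
      have h1 := mono₂ _ _ (e 0 hz).le hle
      have h2 := d x hx
      have h3 := mul_pos (sub_pos.2 (hgt.trans_le h1)) (f x hx)
      have h4 : 0 < ν * deriv (deriv v₂) x := by linarith
      exact (mul_pos_iff_of_pos_left hν).1 h4

theorem triv_swap {v₁ v₂ : ℝ → ℝ} (h : IsTrivialSol v₂ v₁) : IsTrivialSol v₁ v₂ :=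
  fun x hx => (h x hx).symm

theorem triv_refl {v₁ v₂ : ℝ → ℝ}
    (h : IsTrivialSol (fun x => v₁ (1 - x)) (fun x => v₂ (1 - x))) : IsTrivialSol v₁ v₂ := by
  intro x hx
  simpa using h (1 - x) ⟨by linarith [hx.2], by linarith [hx.1]⟩

theorem stmt_3 (ν Cg l₁ l₂ : ℝ) (g₁ g₂ v₁ v₂ : ℝ → ℝ)
    (hν : 0 < ν) (hCg : 0 < Cg) (hg₁ : GAss Cg g₁) (hg₂ : GAss Cg g₂)
    (hsol : IsSolution ν g₁ g₂ v₁ v₂ l₁ l₂)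
    (hcond :
      (∃ ξ ∈ Set.Icc (0:ℝ) 1, g₁ ((v₂ ξ) ^ 2) = l₁ ∧ g₂ ((v₁ ξ) ^ 2) = l₂ ∧
        deriv v₁ ξ = 0 ∧ deriv v₂ ξ = 0) ∨
      (∃ x₁ x₂ : ℝ, 0 ≤ x₁ ∧ x₁ < x₂ ∧ x₂ ≤ 1 ∧
        ((∀ x ∈ Set.Icc x₁ x₂, v₁ x = v₁ x₁) ∨ (∀ x ∈ Set.Icc x₁ x₂, v₂ x = v₂ x₁))) ∨
      g₁ ((v₂ 0) ^ 2) = l₁ ∨ g₂ ((v₁ 0) ^ 2) = l₂ ∨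
      g₁ ((v₂ 1) ^ 2) = l₁ ∨ g₂ ((v₁ 1) ^ 2) = l₂) :
    IsTrivialSol v₁ v₂ := by
  rcases hcond with ⟨ξ, hξ, h1, h2, h3, h4⟩ | ⟨x₁, x₂, h0, h12, h1, h | h⟩ | h | h | h | h
  · exact case_one hν hg₁ hg₂ hsol ξ hξ h1 h2 h3 h4
  · exact case_two hν hg₁ hg₂ hsol x₁ x₂ h0 h12 h1 h
  · exact triv_swap (case_two hν hg₂ hg₁ (sol_swap hsol) x₁ x₂ h0 h12 h1 h)
  · exact case_three hν hg₁ hg₂ hsol h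
  · exact triv_swap (case_three hν hg₂ hg₁ (sol_swap hsol) h)
  · exact triv_refl (case_three hν hg₁ hg₂ (sol_refl hsol) (by simpa using h))
  · exact triv_refl (triv_swap (case_three hν hg₂ hg₁ (sol_swap (sol_refl hsol))
      (by simpa using h)))
end

section
/- Let (v₁,v₂,λ₁,λ₂) be a solution of the one-dimensional system with viscosity ν, and let 0 ≤ x₁ < x₂ ≤ 1 be such that for some i ∈ {1,2} (j = 3−i) one has v_i'(x₁) = v_i'(x₂) = 0, v_i''(x₁) ≤ 0 and v_i''(x₂) ≤ 0. Then either (v₁,v₂) is the trivial solution, or there exists ξ ∈ (x₁,x₂) such that g_j(v_i(ξ)²) < λ_j. Analogously, if v_i'(x₁) = v_i'(x₂) = 0, v_i''(x₁) ≥ 0 and v_i''(x₂) ≥ 0, then either the solution is trivial or there exists ξ ∈ (x₁,x₂) with g_j(v_i(ξ)²) > λ_j. -/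
open Set Filter MeasureTheory

lemma aux_lip {ν Cg l m : ℝ} {g u w : ℝ → ℝ} (hν : 0 < ν) (hg : GAss Cg g)
    (hu : Continuous u) (hw : Continuous w) (hm : m ∈ Set.Icc (0:ℝ) 1)
    (hl : g ((w m) ^ 2) = l)
    (ode : ∀ x ∈ Set.Icc (0:ℝ) 1,
      -ν * deriv (deriv u) x + g ((w x) ^ 2) * u x = l * u x) :
    ∃ K : ℝ, 0 ≤ K ∧ ∀ x ∈ Set.Icc (0:ℝ) 1, |deriv (deriv u) x| ≤ K * |w x - w m| := by
  have hG : ContDiff ℝ 2 (fun y : ℝ => g (y ^ 2)) := by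
    rw [← contDiffOn_univ]
    exact hg.1.comp (by fun_prop) (fun y _ => sq_nonneg y)
  have hc : IsCompact (w '' Set.Icc (0:ℝ) 1) := isCompact_Icc.image hw
  obtain ⟨K, hK⟩ := LocallyLipschitzOn.exists_lipschitzOnWith_of_compact hc
    ((hG.of_le (by norm_num : (1 : WithTop ℕ∞) ≤ 2)).locallyLipschitz.locallyLipschitzOn)
  obtain ⟨M, hM⟩ := (isCompact_Icc (a := (0:ℝ)) (b := 1)).exists_bound_of_continuousOn
    hu.continuousOn
  have hM0 : 0 ≤ M := (norm_nonneg _).trans (hM m hm)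
  refine ⟨K * M / ν, by positivity, fun x hx => ?_⟩
  have h1 := hK.dist_le_mul (w x) (mem_image_of_mem w hx) (w m) (mem_image_of_mem w hm)
  simp only [Real.dist_eq] at h1
  rw [hl] at h1
  have h2 := hM x hx
  rw [Real.norm_eq_abs] at h2
  have h3 : deriv (deriv u) x = (g ((w x) ^ 2) - l) * u x / ν := by
    field_simp
    linarith [ode x hx]
  rw [h3, abs_div, abs_mul, abs_of_pos hν, div_mul_eq_mul_div]
  refine div_le_div_of_nonneg_right ?_ hν.le
  calc _ ≤ (K * |w x - w m|) * M := by gcongr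
    _ = _ := by ring

lemma aux_diff {u : ℝ → ℝ} (hu : ContDiff ℝ 2 u) :
    Differentiable ℝ u ∧ Differentiable ℝ (deriv u) := by
  have h := contDiff_succ_iff_deriv.1 (show ContDiff ℝ (1 + 1) u by simpa [one_add_one_eq_two] using hu)
  exact ⟨h.1, h.2.2.differentiable (by norm_num)⟩

/-- Gronwall-type uniqueness. -/
lemma aux_zero {E E' : ℝ → ℝ} {C m : ℝ} (hm : m ∈ Set.Icc (0:ℝ) 1)
    (hE : ∀ x, HasDerivAt E (E' x) x) (h0 : E m = 0)
    (hb : ∀ x ∈ Set.Icc (0:ℝ) 1, |E' x| ≤ C * E x) :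
    ∀ x ∈ Set.Icc (0:ℝ) 1, E x ≤ 0 := by
  have key : ∀ c x : ℝ, HasDerivAt (fun y => Real.exp (c * y) * E y)
      (Real.exp (c * x) * (c * E x + E' x)) x := by
    intro c x
    have h1 : HasDerivAt (fun y : ℝ => Real.exp (c * y)) (Real.exp (c * x) * (c * 1)) x :=
      ((hasDerivAt_id x).const_mul c).exp
    exact (h1.mul (hE x)).congr_deriv (by ring)
  intro x hx
  rcases le_total m x with h | h
  · have ha : AntitoneOn (fun y => Real.exp (-C * y) * E y) (Set.Icc m 1) := by
      apply antitoneOn_of_deriv_nonpos (convex_Icc _ _)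
      · exact fun y _ => (key _ y).continuousAt.continuousWithinAt
      · exact fun y _ => (key _ y).differentiableAt.differentiableWithinAt
      · intro y hy
        rw [interior_Icc] at hy
        rw [(key _ y).deriv]
        have := (abs_le.1 (hb y ⟨hm.1.trans hy.1.le, hy.2.le⟩)).2
        exact mul_nonpos_of_nonneg_of_nonpos (Real.exp_pos _).le (by linarith)
    have := ha ⟨le_rfl, hm.2⟩ ⟨h, hx.2⟩ h
    simp only [h0, mul_zero] at this
    exact nonpos_of_mul_nonpos_right this (Real.exp_pos _)
  · have ha : MonotoneOn (fun y => Real.exp (C * y) * E y) (Set.Icc 0 m) := by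
      apply monotoneOn_of_deriv_nonneg (convex_Icc _ _)
      · exact fun y _ => (key _ y).continuousAt.continuousWithinAt
      · exact fun y _ => (key _ y).differentiableAt.differentiableWithinAt
      · intro y hy
        rw [interior_Icc] at hy
        rw [(key _ y).deriv]
        have := (abs_le.1 (hb y ⟨hy.1.le, hy.2.le.trans hm.2⟩)).1
        exact mul_nonneg (Real.exp_pos _).le (by linarith)
    have := ha ⟨hx.1, h⟩ ⟨hm.1, le_rfl⟩ h
    simp only [h0, mul_zero] at this
    exact nonpos_of_mul_nonpos_right this (Real.exp_pos _)

lemma aux_one_s4 {u : ℝ → ℝ} {a : ℝ} (h : ∀ x ∈ Set.Icc (0:ℝ) 1, u x = a)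
    (hpos : ∀ x ∈ Set.Icc (0:ℝ) 1, 0 < u x)
    (hi : (∫ x in (0:ℝ)..1, (u x) ^ 2) = 1) : a = 1 := by
  have h1 : (∫ x in (0:ℝ)..1, (u x) ^ 2) = ∫ x in (0:ℝ)..1, a ^ 2 := by
    apply intervalIntegral.integral_congr
    intro x hx
    rw [uIcc_of_le zero_le_one] at hx
    simp only [h x hx]
  rw [hi] at h1
  simp only [intervalIntegral.integral_const, sub_zero, one_smul] at h1
  have h2 := hpos 0 (by simp)
  rw [h 0 (by simp)] at h2
  nlinarith

lemma aux_unique_s4 {ν Cg l₁ l₂ m : ℝ} {g₁ g₂ u w : ℝ → ℝ} (hν : 0 < ν)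
    (hg₁ : GAss Cg g₁) (hg₂ : GAss Cg g₂) (hsol : IsSolution ν g₁ g₂ u w l₁ l₂)
    (hm : m ∈ Set.Icc (0:ℝ) 1) (hu' : deriv u m = 0) (hw' : deriv w m = 0)
    (h1 : g₁ ((w m) ^ 2) = l₁) (h2 : g₂ ((u m) ^ 2) = l₂) : IsTrivialSol u w := by
  obtain ⟨hu, hw, ode1, ode2, up, wp, -, -, -, -, iu, iw⟩ := hsol
  obtain ⟨K, hK0, hK⟩ := aux_lip hν hg₁ hu.continuous hw.continuous hm h1 ode1
  obtain ⟨L, hL0, hL⟩ := aux_lip hν hg₂ hw.continuous hu.continuous hm h2 ode2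
  obtain ⟨du, ddu⟩ := aux_diff hu
  obtain ⟨dw, ddw⟩ := aux_diff hw
  have hz := aux_zero (E := fun x => (u x - u m) ^ 2 + (deriv u x) ^ 2 +
      ((w x - w m) ^ 2 + (deriv w x) ^ 2))
    (E' := fun x => 2 * (u x - u m) * deriv u x + 2 * deriv u x * deriv (deriv u) x +
      (2 * (w x - w m) * deriv w x + 2 * deriv w x * deriv (deriv w) x))
    (C := 1 + K + L) hm ?_ ?_ ?_
  · have hz1 : ∀ x ∈ Set.Icc (0:ℝ) 1, u x = u m := fun x hx => by
      have := hz x hx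
      have h : (u x - u m) ^ 2 = 0 := by
        nlinarith [sq_nonneg (u x - u m), sq_nonneg (deriv u x), sq_nonneg (w x - w m),
          sq_nonneg (deriv w x)]
      have := pow_eq_zero_iff (two_ne_zero) |>.1 h
      linarith
    have hz2 : ∀ x ∈ Set.Icc (0:ℝ) 1, w x = w m := fun x hx => by
      have := hz x hx
      have h : (w x - w m) ^ 2 = 0 := by
        nlinarith [sq_nonneg (u x - u m), sq_nonneg (deriv u x), sq_nonneg (w x - w m),
          sq_nonneg (deriv w x)]
      have := pow_eq_zero_iff (two_ne_zero) |>.1 h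
      linarith
    have e1 := aux_one_s4 hz1 up iu
    have e2 := aux_one_s4 hz2 wp iw
    exact fun x hx => ⟨(hz1 x hx).trans e1, (hz2 x hx).trans e2⟩
  · intro x
    have a1 := ((du x).hasDerivAt.sub_const (u m)).pow 2
    have a2 := (ddu x).hasDerivAt.pow 2
    have a3 := ((dw x).hasDerivAt.sub_const (w m)).pow 2
    have a4 := (ddw x).hasDerivAt.pow 2
    exact ((a1.add a2).add (a3.add a4)).congr_deriv (by simp)
  · simp [hu', hw']
  · intro x hx
    have k1 := hK x hx
    have k2 := hL x hx
    generalize u x - u m = p at *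
    generalize w x - w m = q at *
    generalize deriv (deriv u) x = r at *
    generalize deriv (deriv w) x = s at *
    generalize deriv u x = P at *
    generalize deriv w x = Q at *
    have t1 : |2 * p * P| ≤ p ^ 2 + P ^ 2 := by
      rw [abs_le]; constructor <;> nlinarith [sq_nonneg (p - P), sq_nonneg (p + P)]
    have t2 : |2 * q * Q| ≤ q ^ 2 + Q ^ 2 := by
      rw [abs_le]; constructor <;> nlinarith [sq_nonneg (q - Q), sq_nonneg (q + Q)]
    have t3 : |2 * P * r| ≤ K * (P ^ 2 + q ^ 2) := by
      rw [abs_mul, abs_mul, abs_two]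
      calc 2 * |P| * |r| ≤ 2 * |P| * (K * |q|) := by gcongr
        _ = K * (2 * |P| * |q|) := by ring
        _ ≤ K * (P ^ 2 + q ^ 2) := by
          gcongr
          nlinarith [sq_nonneg (|P| - |q|), sq_abs P, sq_abs q]
    have t4 : |2 * Q * s| ≤ L * (Q ^ 2 + p ^ 2) := by
      rw [abs_mul, abs_mul, abs_two]
      calc 2 * |Q| * |s| ≤ 2 * |Q| * (L * |p|) := by gcongr
        _ = L * (2 * |Q| * |p|) := by ring
        _ ≤ L * (Q ^ 2 + p ^ 2) := by
          gcongr
          nlinarith [sq_nonneg (|Q| - |p|), sq_abs Q, sq_abs p]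
    have t5 := abs_add_le (2 * p * P + 2 * P * r) (2 * q * Q + 2 * Q * s)
    have t6 := abs_add_le (2 * p * P) (2 * P * r)
    have t7 := abs_add_le (2 * q * Q) (2 * Q * s)
    have t8 : 0 ≤ K * (p ^ 2 + Q ^ 2) := by positivity
    have t9 : 0 ≤ L * (P ^ 2 + q ^ 2) := by positivity
    linarith

lemma aux_finish {ν Cg l₁ l₂ x₁ x₂ : ℝ} {g₁ g₂ u w : ℝ → ℝ} (hν : 0 < ν)
    (hg₁ : GAss Cg g₁) (hg₂ : GAss Cg g₂) (hsol : IsSolution ν g₁ g₂ u w l₁ l₂)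
    (hx₁ : 0 ≤ x₁) (hx₁₂ : x₁ < x₂) (hx₂ : x₂ ≤ 1)
    (h : ∀ x ∈ Set.Icc x₁ x₂, deriv u x = 0) : IsTrivialSol u w := by
  have hsol' := hsol
  obtain ⟨hu, hw, ode1, ode2, up, wp, -, -, -, -, iu, iw⟩ := hsol'
  have hs : ∀ x ∈ Set.Ioo x₁ x₂, x ∈ Set.Icc (0:ℝ) 1 := fun x hx =>
    ⟨hx₁.trans hx.1.le, hx.2.le.trans hx₂⟩
  have hdz : ∀ f : ℝ → ℝ, ∀ c : ℝ, (∀ x ∈ Set.Ioo x₁ x₂, f x = c) →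
      ∀ x ∈ Set.Ioo x₁ x₂, deriv f x = 0 := by
    intro f c hf x hx
    have : f =ᶠ[nhds x] fun _ => c := by
      filter_upwards [isOpen_Ioo.mem_nhds hx] with y hy using hf y hy
    rw [this.deriv_eq]
    simp
  have hu2 := hdz (deriv u) 0 (fun x hx => h x (Ioo_subset_Icc_self hx))
  have e1 : ∀ x ∈ Set.Ioo x₁ x₂, g₁ ((w x) ^ 2) = l₁ := fun x hx => by
    have := ode1 x (hs x hx)
    rw [hu2 x hx] at this
    exact mul_right_cancel₀ (up x (hs x hx)).ne' (by linarith)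
  have hm : (x₁ + x₂) / 2 ∈ Set.Ioo x₁ x₂ := ⟨by linarith, by linarith⟩
  have hwc : ∀ x ∈ Set.Ioo x₁ x₂, w x = w ((x₁ + x₂) / 2) := fun x hx => by
    have := hg₁.2.1.injOn (sq_nonneg (w x)) (sq_nonneg (w ((x₁ + x₂) / 2)))
      ((e1 x hx).trans (e1 _ hm).symm)
    exact (pow_left_inj₀ (wp x (hs x hx)).le (wp _ (hs _ hm)).le two_ne_zero).1 this
  have hw1 := hdz w _ hwc
  have hw2 := hdz (deriv w) 0 hw1
  have e2 : g₂ ((u ((x₁ + x₂) / 2)) ^ 2) = l₂ := by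
    have := ode2 _ (hs _ hm)
    rw [hw2 _ hm] at this
    exact mul_right_cancel₀ (wp _ (hs _ hm)).ne' (by linarith)
  exact aux_unique_s4 hν hg₁ hg₂ hsol (hs _ hm) (h _ (Ioo_subset_Icc_self hm)) (hw1 _ hm)
    (e1 _ hm) e2

lemma aux_core1 {ν Cg l₁ l₂ x₁ x₂ : ℝ} {g₁ g₂ u w : ℝ → ℝ} (hν : 0 < ν)
    (hg₁ : GAss Cg g₁) (hg₂ : GAss Cg g₂) (hsol : IsSolution ν g₁ g₂ u w l₁ l₂)
    (hx₁ : 0 ≤ x₁) (hx₁₂ : x₁ < x₂) (hx₂ : x₂ ≤ 1)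
    (h : deriv u x₁ = 0 ∧ deriv u x₂ = 0 ∧
        deriv (deriv u) x₁ ≤ 0 ∧ deriv (deriv u) x₂ ≤ 0) :
    IsTrivialSol u w ∨ ∃ ξ ∈ Set.Ioo x₁ x₂, g₂ ((u ξ) ^ 2) < l₂ := by
  by_contra! hcon
  obtain ⟨hnt, hge⟩ := hcon
  apply hnt
  obtain ⟨hd1, hd2, hdd1, hdd2⟩ := h
  have hsol' := hsol
  obtain ⟨hu, hw, ode1, ode2, up, wp, -, -, -, -, iu, iw⟩ := hsol'
  obtain ⟨du, ddu⟩ := aux_diff hu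
  obtain ⟨dw, ddw⟩ := aux_diff hw
  have hs : ∀ x ∈ Set.Icc x₁ x₂, x ∈ Set.Icc (0:ℝ) 1 := fun x hx =>
    ⟨hx₁.trans hx.1, hx.2.trans hx₂⟩
  have m1 : x₁ ∈ Set.Icc x₁ x₂ := left_mem_Icc.2 hx₁₂.le
  have m2 : x₂ ∈ Set.Icc x₁ x₂ := right_mem_Icc.2 hx₁₂.le
  have hend : ∀ y ∈ Set.Icc x₁ x₂, deriv (deriv u) y ≤ 0 → g₁ ((w y) ^ 2) ≤ l₁ := by
    intro y hy hyy
    have := ode1 y (hs y hy)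
    have hp := up y (hs y hy)
    have : ν * deriv (deriv u) y ≤ 0 := mul_nonpos_of_nonneg_of_nonpos hν.le hyy
    exact le_of_mul_le_mul_right (by linarith) hp
  have hconv : ConvexOn ℝ (Set.Icc x₁ x₂) w := by
    apply convexOn_of_deriv2_nonneg (convex_Icc _ _) hw.continuous.continuousOn
      dw.differentiableOn ddw.differentiableOn
    intro x hx
    rw [interior_Icc] at hx
    have hx' := hs x (Ioo_subset_Icc_self hx)
    have h1 := ode2 x hx'
    have h2 := mul_le_mul_of_nonneg_right (hge x hx) (wp x hx').le
    have h3 : 0 ≤ ν * deriv (deriv w) x := by linarith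
    exact nonneg_of_mul_nonneg_right h3 hν
  have hall : ∀ x ∈ Set.Icc x₁ x₂, deriv (deriv u) x ≤ 0 := by
    intro x hx
    have hx' := hs x hx
    have hle : g₁ ((w x) ^ 2) ≤ l₁ := by
      rcases le_max_iff.1 (hconv.le_max_of_mem_Icc m1 m2 hx) with h | h
      · refine le_trans (hg₁.2.1.monotoneOn (mem_Ici.2 (sq_nonneg _)) (mem_Ici.2 (sq_nonneg _)) ?_) (hend x₁ m1 hdd1)
        exact pow_le_pow_left₀ (wp x hx').le h 2
      · refine le_trans (hg₁.2.1.monotoneOn (mem_Ici.2 (sq_nonneg _)) (mem_Ici.2 (sq_nonneg _)) ?_) (hend x₂ m2 hdd2)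
        exact pow_le_pow_left₀ (wp x hx').le h 2
    have h1 := ode1 x hx'
    have h2 := mul_le_mul_of_nonneg_right hle (up x hx').le
    have h3 : ν * deriv (deriv u) x ≤ 0 := by linarith
    exact nonpos_of_mul_nonpos_right h3 hν
  have hmono : AntitoneOn (deriv u) (Set.Icc x₁ x₂) :=
    antitoneOn_of_deriv_nonpos (convex_Icc _ _) ddu.continuous.continuousOn
      ddu.differentiableOn (fun x hx => hall x (interior_subset hx))
  refine aux_finish hν hg₁ hg₂ hsol hx₁ hx₁₂ hx₂ fun x hx => le_antisymm ?_ ?_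
  · rw [← hd1]; exact hmono m1 hx hx.1
  · rw [← hd2]; exact hmono hx m2 hx.2

lemma aux_core2 {ν Cg l₁ l₂ x₁ x₂ : ℝ} {g₁ g₂ u w : ℝ → ℝ} (hν : 0 < ν)
    (hg₁ : GAss Cg g₁) (hg₂ : GAss Cg g₂) (hsol : IsSolution ν g₁ g₂ u w l₁ l₂)
    (hx₁ : 0 ≤ x₁) (hx₁₂ : x₁ < x₂) (hx₂ : x₂ ≤ 1)
    (h : deriv u x₁ = 0 ∧ deriv u x₂ = 0 ∧
        0 ≤ deriv (deriv u) x₁ ∧ 0 ≤ deriv (deriv u) x₂) :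
    IsTrivialSol u w ∨ ∃ ξ ∈ Set.Ioo x₁ x₂, l₂ < g₂ ((u ξ) ^ 2) := by
  by_contra! hcon
  obtain ⟨hnt, hge⟩ := hcon
  apply hnt
  obtain ⟨hd1, hd2, hdd1, hdd2⟩ := h
  have hsol' := hsol
  obtain ⟨hu, hw, ode1, ode2, up, wp, -, -, -, -, iu, iw⟩ := hsol'
  obtain ⟨du, ddu⟩ := aux_diff hu
  obtain ⟨dw, ddw⟩ := aux_diff hw
  have hs : ∀ x ∈ Set.Icc x₁ x₂, x ∈ Set.Icc (0:ℝ) 1 := fun x hx =>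
    ⟨hx₁.trans hx.1, hx.2.trans hx₂⟩
  have m1 : x₁ ∈ Set.Icc x₁ x₂ := left_mem_Icc.2 hx₁₂.le
  have m2 : x₂ ∈ Set.Icc x₁ x₂ := right_mem_Icc.2 hx₁₂.le
  have hend : ∀ y ∈ Set.Icc x₁ x₂, 0 ≤ deriv (deriv u) y → l₁ ≤ g₁ ((w y) ^ 2) := by
    intro y hy hyy
    have := ode1 y (hs y hy)
    have hp := up y (hs y hy)
    have : 0 ≤ ν * deriv (deriv u) y := mul_nonneg hν.le hyy
    exact le_of_mul_le_mul_right (by linarith) hp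
  have hconv : ConcaveOn ℝ (Set.Icc x₁ x₂) w := by
    apply concaveOn_of_deriv2_nonpos (convex_Icc _ _) hw.continuous.continuousOn
      dw.differentiableOn ddw.differentiableOn
    intro x hx
    rw [interior_Icc] at hx
    have hx' := hs x (Ioo_subset_Icc_self hx)
    have h1 := ode2 x hx'
    have h2 := mul_le_mul_of_nonneg_right (hge x hx) (wp x hx').le
    have h3 : ν * deriv (deriv w) x ≤ 0 := by linarith
    exact nonpos_of_mul_nonpos_right h3 hν
  have hall : ∀ x ∈ Set.Icc x₁ x₂, 0 ≤ deriv (deriv u) x := by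
    intro x hx
    have hx' := hs x hx
    have hle : l₁ ≤ g₁ ((w x) ^ 2) := by
      rcases min_le_iff.1 (hconv.min_le_of_mem_Icc m1 m2 hx) with h | h
      · refine le_trans (hend x₁ m1 hdd1) (hg₁.2.1.monotoneOn (mem_Ici.2 (sq_nonneg _)) (mem_Ici.2 (sq_nonneg _)) ?_)
        exact pow_le_pow_left₀ (wp x₁ (hs x₁ m1)).le h 2
      · refine le_trans (hend x₂ m2 hdd2) (hg₁.2.1.monotoneOn (mem_Ici.2 (sq_nonneg _)) (mem_Ici.2 (sq_nonneg _)) ?_)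
        exact pow_le_pow_left₀ (wp x₂ (hs x₂ m2)).le h 2
    have h1 := ode1 x hx'
    have h2 := mul_le_mul_of_nonneg_right hle (up x hx').le
    have h3 : 0 ≤ ν * deriv (deriv u) x := by linarith
    exact nonneg_of_mul_nonneg_right h3 hν
  have hmono : MonotoneOn (deriv u) (Set.Icc x₁ x₂) :=
    monotoneOn_of_deriv_nonneg (convex_Icc _ _) ddu.continuous.continuousOn
      ddu.differentiableOn (fun x hx => hall x (interior_subset hx))
  refine aux_finish hν hg₁ hg₂ hsol hx₁ hx₁₂ hx₂ fun x hx => le_antisymm ?_ ?_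
  · rw [← hd2]; exact hmono hx m2 hx.2
  · rw [← hd1]; exact hmono m1 hx hx.1

theorem stmt_4 (ν Cg l₁ l₂ : ℝ) (g₁ g₂ v₁ v₂ : ℝ → ℝ) (x₁ x₂ : ℝ)
    (hν : 0 < ν) (hCg : 0 < Cg) (hg₁ : GAss Cg g₁) (hg₂ : GAss Cg g₂)
    (hsol : IsSolution ν g₁ g₂ v₁ v₂ l₁ l₂)
    (hx₁ : 0 ≤ x₁) (hx₁₂ : x₁ < x₂) (hx₂ : x₂ ≤ 1) :
    ((deriv v₁ x₁ = 0 ∧ deriv v₁ x₂ = 0 ∧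
        deriv (deriv v₁) x₁ ≤ 0 ∧ deriv (deriv v₁) x₂ ≤ 0) →
      (IsTrivialSol v₁ v₂ ∨ ∃ ξ ∈ Set.Ioo x₁ x₂, g₂ ((v₁ ξ) ^ 2) < l₂)) ∧
    ((deriv v₂ x₁ = 0 ∧ deriv v₂ x₂ = 0 ∧
        deriv (deriv v₂) x₁ ≤ 0 ∧ deriv (deriv v₂) x₂ ≤ 0) →
      (IsTrivialSol v₁ v₂ ∨ ∃ ξ ∈ Set.Ioo x₁ x₂, g₁ ((v₂ ξ) ^ 2) < l₁)) ∧
    ((deriv v₁ x₁ = 0 ∧ deriv v₁ x₂ = 0 ∧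
        0 ≤ deriv (deriv v₁) x₁ ∧ 0 ≤ deriv (deriv v₁) x₂) →
      (IsTrivialSol v₁ v₂ ∨ ∃ ξ ∈ Set.Ioo x₁ x₂, l₂ < g₂ ((v₁ ξ) ^ 2))) ∧
    ((deriv v₂ x₁ = 0 ∧ deriv v₂ x₂ = 0 ∧
        0 ≤ deriv (deriv v₂) x₁ ∧ 0 ≤ deriv (deriv v₂) x₂) →
      (IsTrivialSol v₁ v₂ ∨ ∃ ξ ∈ Set.Ioo x₁ x₂, l₁ < g₁ ((v₂ ξ) ^ 2))) := by
  have hsw : IsSolution ν g₂ g₁ v₂ v₁ l₂ l₁ := by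
    obtain ⟨a, b, c, d, e, f, p, q, r, s, i, j⟩ := hsol
    exact ⟨b, a, d, c, f, e, r, s, p, q, j, i⟩
  have ht : IsTrivialSol v₂ v₁ → IsTrivialSol v₁ v₂ := fun h x hx => (h x hx).symm
  exact ⟨aux_core1 hν hg₁ hg₂ hsol hx₁ hx₁₂ hx₂,
    fun h => (aux_core1 hν hg₂ hg₁ hsw hx₁ hx₁₂ hx₂ h).imp_left ht,
    aux_core2 hν hg₁ hg₂ hsol hx₁ hx₁₂ hx₂,
    fun h => (aux_core2 hν hg₂ hg₁ hsw hx₁ hx₁₂ hx₂ h).imp_left ht⟩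
end

section
/- Let (v₁,v₂,λ₁,λ₂) be a nontrivial solution of the one-dimensional system with viscosity ν. Then for each i ∈ {1,2} every critical point of v_i is isolated: if ξ ∈ [0,1] and v_i'(ξ) = 0, then there is a neighborhood of ξ containing no other point at which v_i' vanishes. -/
open Set Filter MeasureTheory

/-- Zeros of `f` in `[0,1]` accumulate at `ξ`. -/
def AccZ (f : ℝ → ℝ) (ξ : ℝ) : Prop :=
  ∀ ε > 0, ∃ x ∈ Set.Icc (0:ℝ) 1, x ≠ ξ ∧ |x - ξ| < ε ∧ f x = 0

lemma AccZ.zero {f : ℝ → ℝ} {ξ : ℝ} (h : AccZ f ξ) (hf : Continuous f) : f ξ = 0 := by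
  have hcl : IsClosed {x | f x = 0} := isClosed_eq hf continuous_const
  have : ξ ∈ closure {x | f x = 0} := by
    rw [Metric.mem_closure_iff]
    intro ε hε
    obtain ⟨x, -, -, h2, h3⟩ := h ε hε
    exact ⟨x, h3, by rw [dist_comm, Real.dist_eq]; exact h2⟩
  rw [hcl.closure_eq] at this
  exact this

lemma AccZ.deriv {f : ℝ → ℝ} {ξ : ℝ} (hξ : ξ ∈ Set.Icc (0:ℝ) 1) (h : AccZ f ξ)
    (hf : Continuous f) : AccZ (deriv f) ξ := by
  have h0 := h.zero hf
  intro ε hε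
  obtain ⟨x, hx, hne, h2, h3⟩ := h ε hε
  rw [abs_lt] at h2
  rcases lt_or_gt_of_ne hne with hlt | hlt
  · obtain ⟨c, hc, hc'⟩ := exists_deriv_eq_zero hlt hf.continuousOn (h3.trans h0.symm)
    exact ⟨c, ⟨hx.1.trans hc.1.le, hc.2.le.trans hξ.2⟩, hc.2.ne,
      abs_lt.2 ⟨by linarith [hc.1], by linarith [hc.2]⟩, hc'⟩
  · obtain ⟨c, hc, hc'⟩ := exists_deriv_eq_zero hlt hf.continuousOn (h0.trans h3.symm)
    exact ⟨c, ⟨hξ.1.trans hc.1.le, hc.2.le.trans hx.2⟩, hc.1.ne',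
      abs_lt.2 ⟨by linarith [hc.1], by linarith [hc.2]⟩, hc'⟩

lemma gronwall_zero {E E' : ℝ → ℝ} {K ξ : ℝ} (hξ : ξ ∈ Set.Icc (0:ℝ) 1)
    (hE : ∀ x, HasDerivAt E (E' x) x) (hE0 : ∀ x, 0 ≤ E x)
    (hb : ∀ x ∈ Set.Icc (0:ℝ) 1, |E' x| ≤ K * E x) (h0 : E ξ = 0) :
    ∀ x ∈ Set.Icc (0:ℝ) 1, E x = 0 := by
  have hd : ∀ c x : ℝ, HasDerivAt (fun x => E x * Real.exp (c * x))
      (E' x * Real.exp (c * x) + E x * (Real.exp (c * x) * (c * 1))) x := fun c x =>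
    (hE x).mul (((hasDerivAt_id x).const_mul c).exp)
  have hanti : AntitoneOn (fun x => E x * Real.exp (-K * x)) (Set.Icc 0 1) := by
    apply antitoneOn_of_deriv_nonpos (convex_Icc 0 1)
    · exact fun x _ => (hd _ x).continuousAt.continuousWithinAt
    · exact fun x _ => (hd _ x).differentiableAt.differentiableWithinAt
    · intro x hx
      rw [interior_Icc] at hx
      rw [(hd _ x).deriv]
      have := (abs_le.1 (hb x ⟨hx.1.le, hx.2.le⟩)).2
      nlinarith [Real.exp_pos (-K * x)]
  have hmono : MonotoneOn (fun x => E x * Real.exp (K * x)) (Set.Icc 0 1) := by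
    apply monotoneOn_of_deriv_nonneg (convex_Icc 0 1)
    · exact fun x _ => (hd _ x).continuousAt.continuousWithinAt
    · exact fun x _ => (hd _ x).differentiableAt.differentiableWithinAt
    · intro x hx
      rw [interior_Icc] at hx
      rw [(hd _ x).deriv]
      have := (abs_le.1 (hb x ⟨hx.1.le, hx.2.le⟩)).1
      nlinarith [Real.exp_pos (K * x)]
  intro x hx
  refine le_antisymm ?_ (hE0 x)
  rcases le_total x ξ with h | h
  · have := hmono hx hξ h
    simp only [h0, zero_mul] at this
    exact nonpos_of_mul_nonpos_left this (Real.exp_pos _)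
  · have := hanti hξ hx h
    simp only [h0, zero_mul] at this
    exact nonpos_of_mul_nonpos_left this (Real.exp_pos _)

lemma g_lip {Cg : ℝ} {g u w : ℝ → ℝ} (hg : GAss Cg g) (hu : Continuous u) (hw : Continuous w)
    (hup : ∀ x ∈ Set.Icc (0:ℝ) 1, 0 < u x) {ξ : ℝ} (hξ : ξ ∈ Set.Icc (0:ℝ) 1) :
    ∃ C : ℝ, 0 ≤ C ∧ ∀ x ∈ Set.Icc (0:ℝ) 1,
      |(g (u x ^ 2) - g (u ξ ^ 2)) * w x| ≤ C * |u x - u ξ| := by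
  obtain ⟨M, hM⟩ := isCompact_Icc.exists_bound_of_continuousOn (s := Set.Icc (0:ℝ) 1)
    hu.continuousOn
  obtain ⟨N, hN⟩ := isCompact_Icc.exists_bound_of_continuousOn (s := Set.Icc (0:ℝ) 1)
    hw.continuousOn
  have hM0 : 0 ≤ M := (norm_nonneg _).trans (hM ξ hξ)
  have hN0 : 0 ≤ N := (norm_nonneg _).trans (hN ξ hξ)
  obtain ⟨L, hL⟩ := ((hg.1.of_le one_le_two).mono
    (fun y hy => hy.1 : Set.Icc 0 (M ^ 2) ⊆ Set.Ici 0)).locallyLipschitzOn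
      (convex_Icc _ _) |>.exists_lipschitzOnWith_of_compact isCompact_Icc
  refine ⟨L * (2 * M) * N, by positivity, fun x hx => ?_⟩
  have hmem : ∀ y ∈ Set.Icc (0:ℝ) 1, u y ^ 2 ∈ Set.Icc 0 (M ^ 2) := fun y hy =>
    ⟨sq_nonneg _, sq_le_sq' (by linarith [hup y hy]) ((le_abs_self _).trans (hM y hy))⟩
  have h1 := hL.dist_le_mul _ (hmem x hx) _ (hmem ξ hξ)
  rw [Real.dist_eq, Real.dist_eq] at h1
  have h2 : |u x ^ 2 - u ξ ^ 2| ≤ 2 * M * |u x - u ξ| := by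
    rw [sq_sub_sq, abs_mul]
    gcongr
    have a := hM x hx
    have b := hM ξ hξ
    rw [Real.norm_eq_abs] at a b
    linarith [abs_add_le (u x) (u ξ)]
  have h3 : |w x| ≤ N := hN x hx
  rw [abs_mul]
  calc _ ≤ (L * (2 * M * |u x - u ξ|)) * N := by
        gcongr
        exact h1.trans (by gcongr)
    _ = _ := by ring

lemma const_one {v : ℝ → ℝ} {a : ℝ} (hp : 0 < a) (h : ∀ x ∈ Set.Icc (0:ℝ) 1, v x = a)
    (hi : (∫ x in (0:ℝ)..1, (v x) ^ 2) = 1) : a = 1 := by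
  have : (∫ x in (0:ℝ)..1, (v x) ^ 2) = ∫ x in (0:ℝ)..1, a ^ 2 := by
    apply intervalIntegral.integral_congr
    intro x hx
    rw [Set.uIcc_of_le zero_le_one] at hx
    simp only [h x hx]
  rw [this] at hi
  simp at hi
  rcases hi with hi | hi <;> linarith

lemma young {K p q r : ℝ} (hK : 0 ≤ K) (h : |r| ≤ K * |p|) :
    2 * |q * r| ≤ K * (p ^ 2 + q ^ 2) := by
  rw [abs_mul]
  have h1 : |q| * |r| ≤ |q| * (K * |p|) := by gcongr
  have h2 : 0 ≤ K * (|p| - |q|) ^ 2 := by positivity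
  rw [← sq_abs p, ← sq_abs q]
  nlinarith

lemma key (ν Cg l₁ l₂ : ℝ) (g₁ g₂ v₁ v₂ : ℝ → ℝ)
    (hν : 0 < ν) (hg₁ : GAss Cg g₁) (hg₂ : GAss Cg g₂)
    (hsol : IsSolution ν g₁ g₂ v₁ v₂ l₁ l₂)
    {ξ : ℝ} (hξ : ξ ∈ Set.Icc (0:ℝ) 1) (hacc : AccZ (deriv v₁) ξ) : IsTrivialSol v₁ v₂ := by
  obtain ⟨c1, c2, e1, e2, p1, p2, -, -, -, -, i1, i2⟩ := hsol
  have d1 : Differentiable ℝ v₁ := c1.differentiable (by norm_num)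
  have d2 : Differentiable ℝ v₂ := c2.differentiable (by norm_num)
  have c1' : ContDiff ℝ 1 (deriv v₁) := ((contDiff_succ_iff_deriv (n := 1)).1 c1).2.2
  have c2' : ContDiff ℝ 1 (deriv v₂) := ((contDiff_succ_iff_deriv (n := 1)).1 c2).2.2
  have d1' : Differentiable ℝ (deriv v₁) := c1'.differentiable (by norm_num)
  have d2' : Differentiable ℝ (deriv v₂) := c2'.differentiable (by norm_num)
  have k1 : Continuous (deriv (deriv v₁)) := c1'.continuous_deriv (by norm_num)
  have k2 : Continuous (deriv (deriv v₂)) := c2'.continuous_deriv (by norm_num)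
  have a1 := hacc.deriv hξ c1'.continuous
  have z1 := a1.zero k1
  have hl1 : ∀ x ∈ Set.Icc (0:ℝ) 1, deriv (deriv v₁) x = 0 → g₁ (v₂ x ^ 2) = l₁ := by
    intro x hx h
    have := e1 x hx
    rw [h, mul_zero, zero_add] at this
    exact mul_right_cancel₀ (p1 x hx).ne' this
  have L1 := hl1 ξ hξ z1
  have a2 : AccZ (fun x => v₂ x - v₂ ξ) ξ := by
    intro ε hε
    obtain ⟨x, hx, hne, h2, h3⟩ := a1 ε hε
    refine ⟨x, hx, hne, h2, ?_⟩
    have := hg₁.2.1.injOn (sq_nonneg (v₂ x)) (sq_nonneg (v₂ ξ)) ((hl1 x hx h3).trans L1.symm)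
    have := (sq_eq_sq₀ (p2 x hx).le (p2 ξ hξ).le).1 this
    simp [this]
  have a3 := a2.deriv hξ (d2.continuous.sub continuous_const)
  have : deriv (fun x => v₂ x - v₂ ξ) = deriv v₂ := by
    ext x; simp
  rw [this] at a3
  have z2' := a3.zero c2'.continuous
  have z2 := (a3.deriv hξ c2'.continuous).zero k2
  have L2 : g₂ (v₁ ξ ^ 2) = l₂ := by
    have := e2 ξ hξ
    rw [z2, mul_zero, zero_add] at this
    exact mul_right_cancel₀ (p2 ξ hξ).ne' this
  have z1' := hacc.zero c1'.continuous
  obtain ⟨A, hA0, hA⟩ := g_lip hg₁ d2.continuous d1.continuous p2 hξ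
  obtain ⟨B, hB0, hB⟩ := g_lip hg₂ d1.continuous d2.continuous p1 hξ
  have f1 : ∀ x ∈ Set.Icc (0:ℝ) 1, |deriv (deriv v₁) x| ≤ A / ν * |v₂ x - v₂ ξ| := by
    intro x hx
    have : deriv (deriv v₁) x = (g₁ (v₂ x ^ 2) - g₁ (v₂ ξ ^ 2)) * v₁ x / ν := by
      rw [L1, eq_div_iff hν.ne']; linarith [e1 x hx]
    rw [this, abs_div, abs_of_pos hν, div_mul_eq_mul_div]
    gcongr
    exact hA x hx
  have f2 : ∀ x ∈ Set.Icc (0:ℝ) 1, |deriv (deriv v₂) x| ≤ B / ν * |v₁ x - v₁ ξ| := by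
    intro x hx
    have : deriv (deriv v₂) x = (g₂ (v₁ x ^ 2) - g₂ (v₁ ξ ^ 2)) * v₂ x / ν := by
      rw [L2, eq_div_iff hν.ne']; linarith [e2 x hx]
    rw [this, abs_div, abs_of_pos hν, div_mul_eq_mul_div]
    gcongr
    exact hB x hx
  have hz := gronwall_zero (ξ := ξ) (K := 2 + A / ν + B / ν)
    (E := fun x => (v₁ x - v₁ ξ) ^ 2 + (v₂ x - v₂ ξ) ^ 2 + deriv v₁ x ^ 2 + deriv v₂ x ^ 2)
    (E' := fun x => 2 * ((v₁ x - v₁ ξ) * deriv v₁ x + (v₂ x - v₂ ξ) * deriv v₂ x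
      + deriv v₁ x * deriv (deriv v₁) x + deriv v₂ x * deriv (deriv v₂) x)) hξ
    (by
      intro x
      have := (((((d1 x).hasDerivAt.sub_const (v₁ ξ)).pow 2).add
        (((d2 x).hasDerivAt.sub_const (v₂ ξ)).pow 2)).add ((d1' x).hasDerivAt.pow 2)).add
        ((d2' x).hasDerivAt.pow 2)
      refine HasDerivAt.congr_deriv this ?_
      push_cast
      ring)
    (fun x => by positivity)
    (by
      intro x hx
      have t1 := young (div_nonneg hA0 hν.le) (q := deriv v₁ x) (f1 x hx)
      have t2 := young (div_nonneg hB0 hν.le) (q := deriv v₂ x) (f2 x hx)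
      have t3 := young (K := 1) (p := deriv v₁ x) (q := v₁ x - v₁ ξ) (r := deriv v₁ x)
        zero_le_one (by simp)
      have t4 := young (K := 1) (p := deriv v₂ x) (q := v₂ x - v₂ ξ) (r := deriv v₂ x)
        zero_le_one (by simp)
      have hA' : 0 ≤ A / ν := div_nonneg hA0 hν.le
      have hB' : 0 ≤ B / ν := div_nonneg hB0 hν.le
      generalize A / ν = P at *
      generalize B / ν = Q at *
      generalize v₁ x - v₁ ξ = s at *
      generalize v₂ x - v₂ ξ = t at *
      generalize deriv v₁ x = s' at *
      generalize deriv v₂ x = t' at *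
      generalize s' * deriv (deriv v₁) x = m at *
      generalize t' * deriv (deriv v₂) x = n at *
      rw [abs_mul, abs_two]
      have u1 := abs_add_le (s * s' + t * t' + m) n
      have u2 := abs_add_le (s * s' + t * t') m
      have u3 := abs_add_le (s * s') (t * t')
      have w1 : 0 ≤ P * (s ^ 2 + t' ^ 2) := by positivity
      have w2 : 0 ≤ Q * (t ^ 2 + s' ^ 2) := by positivity
      nlinarith [sq_nonneg s, sq_nonneg t, sq_nonneg s', sq_nonneg t'])
    (by simp [z1', z2'])
  have q1 : ∀ x ∈ Set.Icc (0:ℝ) 1, v₁ x = v₁ ξ := by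
    intro x hx
    have := hz x hx
    nlinarith [sq_nonneg (v₁ x - v₁ ξ), sq_nonneg (v₂ x - v₂ ξ), sq_nonneg (deriv v₁ x), sq_nonneg (deriv v₂ x)]
  have q2 : ∀ x ∈ Set.Icc (0:ℝ) 1, v₂ x = v₂ ξ := by
    intro x hx
    have := hz x hx
    nlinarith [sq_nonneg (v₁ x - v₁ ξ), sq_nonneg (v₂ x - v₂ ξ), sq_nonneg (deriv v₁ x), sq_nonneg (deriv v₂ x)]
  intro x hx
  exact ⟨(q1 x hx).trans (const_one (p1 ξ hξ) q1 i1), (q2 x hx).trans (const_one (p2 ξ hξ) q2 i2)⟩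

lemma iso_of_not_acc {f : ℝ → ℝ} {ξ : ℝ} (h : ¬ AccZ f ξ) :
    ∃ ε > 0, ∀ x ∈ Set.Icc (0:ℝ) 1, x ≠ ξ → |x - ξ| < ε → f x ≠ 0 := by
  unfold AccZ at h
  push Not at h
  exact h

theorem stmt_5 (ν Cg l₁ l₂ : ℝ) (g₁ g₂ v₁ v₂ : ℝ → ℝ)
    (hν : 0 < ν) (hCg : 0 < Cg) (hg₁ : GAss Cg g₁) (hg₂ : GAss Cg g₂)
    (hsol : IsSolution ν g₁ g₂ v₁ v₂ l₁ l₂)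
    (hnt : ¬ IsTrivialSol v₁ v₂) :
    (∀ ξ ∈ Set.Icc (0:ℝ) 1, deriv v₁ ξ = 0 →
      ∃ ε > 0, ∀ x ∈ Set.Icc (0:ℝ) 1, x ≠ ξ → |x - ξ| < ε → deriv v₁ x ≠ 0) ∧
    (∀ ξ ∈ Set.Icc (0:ℝ) 1, deriv v₂ ξ = 0 →
      ∃ ε > 0, ∀ x ∈ Set.Icc (0:ℝ) 1, x ≠ ξ → |x - ξ| < ε → deriv v₂ x ≠ 0) := by
  refine ⟨fun ξ hξ _ => iso_of_not_acc fun h => hnt ?_, fun ξ hξ _ => iso_of_not_acc fun h => hnt ?_⟩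
  · exact key ν Cg l₁ l₂ g₁ g₂ v₁ v₂ hν hg₁ hg₂ hsol hξ h
  · obtain ⟨c1, c2, e1, e2, p1, p2, b1, b2, b3, b4, i1, i2⟩ := hsol
    have := key ν Cg l₂ l₁ g₂ g₁ v₂ v₁ hν hg₂ hg₁
      ⟨c2, c1, e2, e1, p2, p1, b3, b4, b1, b2, i2, i1⟩ hξ h
    exact fun x hx => ⟨(this x hx).2, (this x hx).1⟩
end

section
/- Let (v₁,v₂,λ₁,λ₂) be a solution of the one-dimensional system with viscosity ν, and let x₀ ∈ [0,1] be a point of local minimum of v_i for some i ∈ {1,2} (j = 3−i). Then either (v₁,v₂) is the trivial solution, or g_j(v_i(x₀)²) < λ_j and g_i(v_j(x₀)²) > λ_i (in particular the local minimum is non-degenerate: v_i''(x₀) > 0). Analogously, if x₀ is a point of local maximum of v_i, then either the solution is trivial or g_j(v_i(x₀)²) > λ_j and g_i(v_j(x₀)²) < λ_i. -/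
open Set Filter MeasureTheory

lemma aux_negsq (y : ℝ) :
    HasDerivAt (fun y : ℝ => (max (-y) 0) ^ 2) (-2 * max (-y) 0) y := by
  rcases lt_trichotomy y 0 with h | h | h
  · have h1 : HasDerivAt (fun y : ℝ => y ^ 2) (2 * y) y := by
      simpa using hasDerivAt_pow 2 y
    rw [max_eq_left (by linarith)]
    have h2 : -2 * -y = 2 * y := by ring
    rw [h2]
    refine h1.congr_of_eventuallyEq ?_
    filter_upwards [Iio_mem_nhds h] with z hz
    have hz' : z < 0 := hz
    rw [max_eq_left (by linarith)]; ring
  · subst h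
    simp only [neg_zero, max_self, mul_zero]
    rw [hasDerivAt_iff_isLittleO_nhds_zero]
    simp only [zero_add, neg_zero, max_self, smul_zero]
    have h1 : (fun h : ℝ => h ^ 2) =o[nhds 0] (fun h : ℝ => h) := by
      simpa using (Asymptotics.isLittleO_pow_id (𝕜 := ℝ) (n := 2) (by norm_num))
    refine Asymptotics.IsBigO.trans_isLittleO ?_ h1
    refine Asymptotics.IsBigO.of_bound 1 (Eventually.of_forall fun x => ?_)
    simp only [Real.norm_eq_abs, one_mul]
    rw [abs_of_nonneg (by positivity : (0:ℝ) ≤ x ^ 2)]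
    rcases le_total (-x) 0 with hx | hx
    · rw [max_eq_right hx]; simp; positivity
    · rw [max_eq_left hx]; simp
  · rw [max_eq_right (by linarith)]
    simp only [mul_zero]
    refine (hasDerivAt_const y (0:ℝ)).congr_of_eventuallyEq ?_
    filter_upwards [Ioi_mem_nhds h] with z hz
    have hz' : 0 < z := hz
    rw [max_eq_right (by linarith)]; ring

lemma aux_d1 {f : ℝ → ℝ} (hf : ContDiff ℝ 2 f) (x : ℝ) : HasDerivAt f (deriv f x) x :=
  (hf.differentiable (by norm_num) x).hasDerivAt

lemma aux_c1 {f : ℝ → ℝ} (hf : ContDiff ℝ 2 f) : ContDiff ℝ 1 (deriv f) := by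
  have h : ContDiff ℝ (1 + 1) f := by simpa [one_add_one_eq_two] using hf
  exact (contDiff_succ_iff_deriv.1 h).2.2

lemma aux_d2 {f : ℝ → ℝ} (hf : ContDiff ℝ 2 f) (x : ℝ) :
    HasDerivAt (deriv f) (deriv (deriv f) x) x :=
  ((aux_c1 hf).differentiable (by norm_num) x).hasDerivAt

lemma aux_c2 {f : ℝ → ℝ} (hf : ContDiff ℝ 2 f) : Continuous (deriv (deriv f)) :=
  (aux_c1 hf).continuous_deriv (by norm_num)

/-- strict decrease to the right -/
lemma aux_SD {f : ℝ → ℝ} (hf : ContDiff ℝ 2 f) {a b : ℝ} (h1 : deriv f a ≤ 0)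
    (h2 : ∀ x ∈ Ioo a b, deriv (deriv f) x < 0) : ∀ x ∈ Ioc a b, f x < f a := by
  have hA : StrictAntiOn (deriv f) (Icc a b) := by
    apply strictAntiOn_of_deriv_neg (convex_Icc a b) (aux_c1 hf).continuous.continuousOn
    simpa using h2
  intro x hx
  have hB : StrictAntiOn f (Icc a b) := by
    apply strictAntiOn_of_deriv_neg (convex_Icc a b) hf.continuous.continuousOn
    intro y hy
    rw [interior_Icc] at hy
    have := hA (left_mem_Icc.2 (hx.1.le.trans hx.2)) (Ioo_subset_Icc_self hy) hy.1
    linarith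
  exact hB (left_mem_Icc.2 (hx.1.le.trans hx.2)) (Ioc_subset_Icc_self hx) hx.1

lemma aux_coop {P Q : ℝ → ℝ} (hP : ContDiff ℝ 2 P) (hQ : ContDiff ℝ 2 Q) {a b L : ℝ}
    (hab : a ≤ b) (hL : 0 ≤ L)
    (hPQ : ∀ x ∈ Icc a b, -L * max (-Q x) 0 ≤ deriv (deriv P) x)
    (hQP : ∀ x ∈ Icc a b, -L * max (-P x) 0 ≤ deriv (deriv Q) x)
    (hPa : P a = 0) (hQa : Q a = 0) (hPa' : 0 ≤ deriv P a) (hQa' : 0 ≤ deriv Q a)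
    (hPb : deriv P b = 0) (hQb : deriv Q b = 0) :
    ∀ x ∈ Icc a b, P x = 0 ∧ Q x = 0 ∧ deriv P x = 0 ∧ deriv Q x = 0 := by
  set n : ℝ → ℝ := fun y => max (-y) 0 with hn
  have n0 : ∀ y, 0 ≤ n y := fun y => le_max_right _ _
  have n1 : ∀ y, -y ≤ n y := fun y => le_max_left _ _
  have nd : ∀ y, HasDerivAt (fun y => n y ^ 2) (-2 * n y) y := aux_negsq
  set E : ℝ → ℝ := fun x => n (P x) ^ 2 + n (Q x) ^ 2 + n (deriv P x) ^ 2 + n (deriv Q x) ^ 2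
    with hE
  set E' : ℝ → ℝ := fun x => (-2 * n (P x)) * deriv P x + (-2 * n (Q x)) * deriv Q x
    + (-2 * n (deriv P x)) * deriv (deriv P) x + (-2 * n (deriv Q x)) * deriv (deriv Q) x with hE'
  have hEd : ∀ x, HasDerivAt E (E' x) x := by
    intro x
    have e1 := (nd (P x)).comp x (aux_d1 hP x)
    have e2 := (nd (Q x)).comp x (aux_d1 hQ x)
    have e3 := (nd (deriv P x)).comp x (aux_d2 hP x)
    have e4 := (nd (deriv Q x)).comp x (aux_d2 hQ x)
    exact ((e1.add e2).add e3).add e4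
  have hE1 : ∀ x ∈ Icc a b, E' x ≤ (1 + L) * E x := by
    intro x hx
    have k1 := hPQ x hx
    have k2 := hQP x hx
    change -L * n (Q x) ≤ _ at k1
    change -L * n (P x) ≤ _ at k2
    have m1 := mul_le_mul_of_nonneg_left k1 (n0 (deriv P x))
    have m2 := mul_le_mul_of_nonneg_left k2 (n0 (deriv Q x))
    have m3 := mul_le_mul_of_nonneg_left (n1 (deriv P x)) (n0 (P x))
    have m4 := mul_le_mul_of_nonneg_left (n1 (deriv Q x)) (n0 (Q x))
    have s1 := sq_nonneg (n (P x) - n (deriv P x))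
    have s2 := sq_nonneg (n (Q x) - n (deriv Q x))
    have s3 := mul_nonneg hL (sq_nonneg (n (Q x) - n (deriv P x)))
    have s4 := mul_nonneg hL (sq_nonneg (n (P x) - n (deriv Q x)))
    simp only [hE, hE']
    nlinarith
  have hF : AntitoneOn (fun x => E x * Real.exp (-(1 + L) * x)) (Icc a b) := by
    have hd : ∀ x, HasDerivAt (fun x => E x * Real.exp (-(1 + L) * x))
        (E' x * Real.exp (-(1 + L) * x) + E x * (Real.exp (-(1 + L) * x) * (-(1 + L)))) x := by
      intro x
      have := ((hasDerivAt_id x).const_mul (-(1 + L))).exp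
      simp only [id, mul_one] at this
      exact (hEd x).mul this
    apply antitoneOn_of_deriv_nonpos (convex_Icc a b)
    · exact fun x _ => (hd x).continuousAt.continuousWithinAt
    · exact fun x _ => (hd x).differentiableAt.differentiableWithinAt
    · intro x hx
      rw [(hd x).deriv]
      have := hE1 x (interior_subset hx)
      have := mul_nonneg (Real.exp_pos (-(1 + L) * x)).le (sub_nonneg.2 this)
      nlinarith
  have hEa : E a = 0 := by
    simp only [hE, hn, hPa, hQa]
    rw [max_eq_right (by linarith : -deriv P a ≤ 0), max_eq_right (by linarith : -deriv Q a ≤ 0)]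
    simp
  have hE0 : ∀ x ∈ Icc a b, E x ≤ 0 := by
    intro x hx
    have := hF (left_mem_Icc.2 hab) hx hx.1
    simp only [hEa, zero_mul] at this
    by_contra hc
    push Not at hc
    have := mul_pos hc (Real.exp_pos (-(1 + L) * x))
    linarith
  have hnn : ∀ x ∈ Icc a b, n (P x) = 0 ∧ n (Q x) = 0 ∧ n (deriv P x) = 0 ∧ n (deriv Q x) = 0 := by
    intro x hx
    have h := hE0 x hx
    simp only [hE] at h
    have s1 := sq_nonneg (n (P x))
    have s2 := sq_nonneg (n (Q x))
    have s3 := sq_nonneg (n (deriv P x))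
    have s4 := sq_nonneg (n (deriv Q x))
    refine ⟨?_, ?_, ?_, ?_⟩ <;> apply pow_eq_zero_iff (two_ne_zero) |>.1 <;> linarith
  have key : ∀ R : ℝ → ℝ, ContDiff ℝ 2 R → (∀ x ∈ Icc a b, 0 ≤ deriv (deriv R) x) →
      (∀ x ∈ Icc a b, 0 ≤ deriv R x) → R a = 0 → deriv R b = 0 →
      ∀ x ∈ Icc a b, R x = 0 ∧ deriv R x = 0 := by
    intro R hR h2 h1 ha hb
    have hm : MonotoneOn (deriv R) (Icc a b) := by
      apply monotoneOn_of_deriv_nonneg (convex_Icc a b) (aux_c1 hR).continuous.continuousOn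
      · exact fun x _ => (aux_d2 hR x).differentiableAt.differentiableWithinAt
      · exact fun x hx => h2 x (interior_subset hx)
    have hz : ∀ x ∈ Icc a b, deriv R x = 0 := by
      intro x hx
      have := hm hx (right_mem_Icc.2 hab) hx.2
      have := h1 x hx
      linarith
    intro x hx
    refine ⟨?_, hz x hx⟩
    have h3 := constant_of_derivWithin_zero (f := R) (a := a) (b := b)
      (hR.differentiable (by norm_num)).differentiableOn (by
        intro y hy
        have hy' : y ∈ Icc a b := Ico_subset_Icc_self hy
        rw [((aux_d1 hR y).hasDerivWithinAt).derivWithin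
          (uniqueDiffOn_Icc (hy.1.trans_lt hy.2) y hy')]
        exact hz y hy') x hx
    rw [h3, ha]
  have kP := key P hP (fun x hx => by
      have := hPQ x hx
      have h0 := (hnn x hx).2.1
      change -L * n (Q x) ≤ _ at this
      rw [h0] at this; linarith)
    (fun x hx => by
      have := n1 (deriv P x); rw [(hnn x hx).2.2.1] at this; linarith) hPa hPb
  have kQ := key Q hQ (fun x hx => by
      have := hQP x hx
      have h0 := (hnn x hx).1
      change -L * n (P x) ≤ _ at this
      rw [h0] at this; linarith)
    (fun x hx => by
      have := n1 (deriv Q x); rw [(hnn x hx).2.2.2] at this; linarith) hQa hQb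
  intro x hx
  exact ⟨(kP x hx).1, (kQ x hx).1, (kP x hx).2, (kQ x hx).2⟩

lemma aux_lip_s6 {Cg : ℝ} {g : ℝ → ℝ} (hg : GAss Cg g) (R : ℝ) :
    ∃ K : ℝ, 0 ≤ K ∧ ∀ s ∈ Icc (0:ℝ) R, ∀ t ∈ Icc (0:ℝ) R,
      |g (s ^ 2) - g (t ^ 2)| ≤ K * |s - t| := by
  have h1 : ContDiffOn ℝ 1 (fun s : ℝ => g (s ^ 2)) (Icc 0 R) := by
    have : ContDiffOn ℝ 1 g (Ici 0) := hg.1.of_le (by norm_num)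
    refine this.comp (t := Ici 0) (f := fun s : ℝ => s ^ 2) (by fun_prop) ?_
    intro s _
    exact sq_nonneg s
  obtain ⟨K, hK⟩ := h1.exists_lipschitzOnWith (by norm_num) (convex_Icc 0 R) isCompact_Icc
  refine ⟨K, K.2, fun s hs t ht => ?_⟩
  have := hK.dist_le_mul s hs t ht
  simpa [Real.dist_eq] using this

lemma aux_swap {ν l₁ l₂ : ℝ} {g₁ g₂ u w : ℝ → ℝ} (h : IsSolution ν g₁ g₂ u w l₁ l₂) :
    IsSolution ν g₂ g₁ w u l₂ l₁ := by
  obtain ⟨a1, a2, a3, a4, a5, a6, a7, a8, a9, a10, a11, a12⟩ := h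
  exact ⟨a2, a1, a4, a3, a6, a5, a9, a10, a7, a8, a12, a11⟩

lemma aux_refl_d (f : ℝ → ℝ) (x : ℝ) :
    deriv (fun x => f (1 - x)) x = - deriv f (1 - x) := by
  simpa using deriv_comp_const_sub (f := f) 1 x

lemma aux_refl_dd (f : ℝ → ℝ) (x : ℝ) :
    deriv (deriv (fun x => f (1 - x))) x = deriv (deriv f) (1 - x) := by
  have : deriv (fun x => f (1 - x)) = fun x => - deriv f (1 - x) := funext (aux_refl_d f)
  rw [this, deriv.fun_neg, aux_refl_d (deriv f) x, neg_neg]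

lemma aux_refl {ν l₁ l₂ : ℝ} {g₁ g₂ u w : ℝ → ℝ} (h : IsSolution ν g₁ g₂ u w l₁ l₂) :
    IsSolution ν g₁ g₂ (fun x => u (1 - x)) (fun x => w (1 - x)) l₁ l₂ := by
  obtain ⟨a1, a2, a3, a4, a5, a6, a7, a8, a9, a10, a11, a12⟩ := h
  have hm : ∀ x ∈ Icc (0:ℝ) 1, 1 - x ∈ Icc (0:ℝ) 1 := fun x hx =>
    ⟨by linarith [hx.2], by linarith [hx.1]⟩
  refine ⟨a1.comp (by fun_prop), a2.comp (by fun_prop), ?_, ?_, ?_, ?_, ?_, ?_, ?_, ?_, ?_, ?_⟩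
  · intro x hx; rw [aux_refl_dd]; exact a3 _ (hm x hx)
  · intro x hx; rw [aux_refl_dd]; exact a4 _ (hm x hx)
  · intro x hx; exact a5 _ (hm x hx)
  · intro x hx; exact a6 _ (hm x hx)
  · rw [aux_refl_d]; simp [a8]
  · rw [aux_refl_d]; simp [a7]
  · rw [aux_refl_d]; simp [a10]
  · rw [aux_refl_d]; simp [a9]
  · rw [intervalIntegral.integral_comp_sub_left (fun x => u x ^ 2) 1]; simpa using a11
  · rw [intervalIntegral.integral_comp_sub_left (fun x => w x ^ 2) 1]; simpa using a12

lemma aux_sderiv (s c : ℝ) {u : ℝ → ℝ} :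
    (deriv (fun x => s * (u x - c)) = fun x => s * deriv u x) ∧
    (deriv (deriv (fun x => s * (u x - c))) = fun x => s * deriv (deriv u) x) := by
  have h : deriv (fun x => s * (u x - c)) = fun x => s * deriv u x := by
    funext x
    simp
  refine ⟨h, ?_⟩
  rw [h]
  funext x
  simp

lemma aux_ineq {ν l K M s a b g g0 u d : ℝ} (hs : s = 1 ∨ s = -1) (hν : 0 < ν)
    (ode : -ν * d + g * u = l * u) (hu : 0 < u) (huM : u ≤ M) (hK : 0 ≤ K)
    (h0 : 0 ≤ s * (g0 - l)) (hlip : |g - g0| ≤ K * |a - b|)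
    (hmono : 0 ≤ s * (a - b) → 0 ≤ s * (g - g0)) :
    -(K * M / ν) * max (-(s * (a - b))) 0 ≤ s * d := by
  have hd : s * d = (s * (g - g0) + s * (g0 - l)) * u / ν := by
    field_simp; linear_combination -s * ode
  have hM : 0 ≤ M := hu.le.trans huM
  rw [hd]
  have hs2 : |s| = 1 := by rcases hs with rfl | rfl <;> simp
  rcases le_total 0 (s * (a - b)) with h | h
  · rw [max_eq_right (by linarith)]
    have := hmono h
    rw [mul_zero]
    positivity
  · rw [max_eq_left (by linarith)]
    have e1 : |a - b| = -(s * (a - b)) := by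
      rw [← abs_of_nonpos h, abs_mul, hs2, one_mul]
    have e2 : -(K * |a - b|) ≤ s * (g - g0) := by
      have : |s * (g - g0)| ≤ K * |a - b| := by rw [abs_mul, hs2, one_mul]; exact hlip
      exact (abs_le.1 this).1
    rw [← e1, le_div_iff₀ hν]
    have e3 : -(K * M / ν) * |a - b| * ν = -(K * |a - b|) * M := by field_simp
    rw [e3]
    have e4 : 0 ≤ K * |a - b| := by positivity
    nlinarith

lemma aux_mono_s6 {Cg s : ℝ} {g : ℝ → ℝ} (hs : s = 1 ∨ s = -1) (hg : GAss Cg g) {a b : ℝ}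
    (ha : 0 < a) (hb : 0 < b) (h : 0 ≤ s * (a - b)) : 0 ≤ s * (g (a ^ 2) - g (b ^ 2)) := by
  rcases hs with rfl | rfl
  · have := hg.2.1.monotoneOn (sq_nonneg b) (sq_nonneg a) (by nlinarith : b ^ 2 ≤ a ^ 2)
    linarith
  · have := hg.2.1.monotoneOn (sq_nonneg a) (sq_nonneg b) (by nlinarith : a ^ 2 ≤ b ^ 2)
    linarith

lemma aux_smono {Cg s : ℝ} {g : ℝ → ℝ} (hs : s = 1 ∨ s = -1) (hg : GAss Cg g) {a b : ℝ}
    (ha : 0 < a) (hb : 0 < b) (h : s * (a - b) < 0) : s * (g (a ^ 2) - g (b ^ 2)) < 0 := by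
  rcases hs with rfl | rfl
  · have := hg.2.1 (sq_nonneg a) (sq_nonneg b) (by nlinarith : a ^ 2 < b ^ 2)
    linarith
  · have := hg.2.1 (sq_nonneg b) (sq_nonneg a) (by nlinarith : b ^ 2 < a ^ 2)
    linarith

lemma aux_right {ν Cg l₁ l₂ s x₀ : ℝ} {g₁ g₂ u w : ℝ → ℝ} (hs : s = 1 ∨ s = -1)
    (hν : 0 < ν) (hg₁ : GAss Cg g₁) (hg₂ : GAss Cg g₂)
    (h : IsSolution ν g₁ g₂ u w l₁ l₂) (hx₀ : x₀ ∈ Icc (0:ℝ) 1)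
    (hu' : deriv u x₀ = 0) (hw' : 0 ≤ s * deriv w x₀)
    (h1 : 0 ≤ s * (g₁ (w x₀ ^ 2) - l₁)) (h2 : 0 ≤ s * (g₂ (u x₀ ^ 2) - l₂)) :
    ∀ x ∈ Icc x₀ 1, u x = u x₀ ∧ w x = w x₀ ∧ deriv w x = 0 := by
  obtain ⟨a1, a2, a3, a4, a5, a6, a7, a8, a9, a10, a11, a12⟩ := h
  obtain ⟨M1, hM1⟩ := isCompact_Icc.bddAbove_image (a1.continuous.continuousOn (s := Icc (0:ℝ) 1))
  obtain ⟨M2, hM2⟩ := isCompact_Icc.bddAbove_image (a2.continuous.continuousOn (s := Icc (0:ℝ) 1))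
  set M := max M1 M2
  have hM1 : ∀ x ∈ Icc (0:ℝ) 1, u x ≤ M := fun x hx =>
    (hM1 (mem_image_of_mem _ hx)).trans (le_max_left _ _)
  have hM2 : ∀ x ∈ Icc (0:ℝ) 1, w x ≤ M := fun x hx =>
    (hM2 (mem_image_of_mem _ hx)).trans (le_max_right _ _)
  obtain ⟨K1, hK1, hl1⟩ := aux_lip_s6 hg₁ M
  obtain ⟨K2, hK2, hl2⟩ := aux_lip_s6 hg₂ M
  have hM0 : 0 ≤ M := (a5 x₀ hx₀).le.trans (hM1 x₀ hx₀)
  have hsub : ∀ x ∈ Icc x₀ 1, x ∈ Icc (0:ℝ) 1 := fun x hx => ⟨hx₀.1.trans hx.1, hx.2⟩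
  have dP := aux_sderiv s (u x₀) (u := u)
  have dQ := aux_sderiv s (w x₀) (u := w)
  have hc := aux_coop (P := fun x => s * (u x - u x₀)) (Q := fun x => s * (w x - w x₀))
    (a := x₀) (b := 1) (L := max K1 K2 * M / ν) (by fun_prop) (by fun_prop) hx₀.2 (by positivity)
    (by
      intro x hx
      rw [dP.2]
      have hx' := hsub x hx
      exact aux_ineq hs hν (a3 x hx') (a5 x hx') (hM1 x hx') (by positivity) h1
        ((hl1 _ ⟨(a6 x hx').le, hM2 x hx'⟩ _ ⟨(a6 _ hx₀).le, hM2 _ hx₀⟩).trans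
          (mul_le_mul_of_nonneg_right (le_max_left _ _) (abs_nonneg _)))
        (aux_mono_s6 hs hg₁ (a6 x hx') (a6 _ hx₀)))
    (by
      intro x hx
      rw [dQ.2]
      have hx' := hsub x hx
      exact aux_ineq hs hν (a4 x hx') (a6 x hx') (hM2 x hx') (by positivity) h2
        ((hl2 _ ⟨(a5 x hx').le, hM1 x hx'⟩ _ ⟨(a5 _ hx₀).le, hM1 _ hx₀⟩).trans
          (mul_le_mul_of_nonneg_right (le_max_right _ _) (abs_nonneg _)))
        (aux_mono_s6 hs hg₂ (a5 x hx') (a5 _ hx₀)))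
    (by simp) (by simp) (by rw [dP.1]; simp [hu']) (by rw [dQ.1]; exact hw')
    (by rw [dP.1]; simp [a8]) (by rw [dQ.1]; simp [a10])
  have hs0 : s ≠ 0 := by rcases hs with rfl | rfl <;> norm_num
  intro x hx
  obtain ⟨c1, c2, -, c4⟩ := hc x hx
  rw [dQ.1] at c4
  simp only [mul_eq_zero, hs0, false_or] at c1 c2 c4
  exact ⟨by linarith, by linarith, c4⟩

lemma aux_const_s6 {f : ℝ → ℝ} {c : ℝ} (hc : 0 < c) (hf : ∀ x ∈ Icc (0:ℝ) 1, f x = c)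
    (hi : (∫ x in (0:ℝ)..1, (f x) ^ 2) = 1) : c = 1 := by
  have : (∫ x in (0:ℝ)..1, (f x) ^ 2) = ∫ x in (0:ℝ)..1, c ^ 2 := by
    apply intervalIntegral.integral_congr
    intro x hx
    rw [uIcc_of_le zero_le_one] at hx
    simp only [hf x hx]
  rw [this] at hi
  simp at hi
  rcases hi with h | h <;> linarith

lemma aux_trivial {ν Cg l₁ l₂ s x₀ : ℝ} {g₁ g₂ u w : ℝ → ℝ} (hs : s = 1 ∨ s = -1)
    (hν : 0 < ν) (hg₁ : GAss Cg g₁) (hg₂ : GAss Cg g₂)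
    (h : IsSolution ν g₁ g₂ u w l₁ l₂) (hx₀ : x₀ ∈ Icc (0:ℝ) 1)
    (hu' : deriv u x₀ = 0)
    (h1 : 0 ≤ s * (g₁ (w x₀ ^ 2) - l₁)) (h2 : 0 ≤ s * (g₂ (u x₀ ^ 2) - l₂)) :
    IsTrivialSol u w := by
  have e0 : 1 - (1 - x₀) = x₀ := by ring
  have hx₁ : 1 - x₀ ∈ Icc (0:ℝ) 1 := ⟨by linarith [hx₀.2], by linarith [hx₀.1]⟩
  have R := fun hw => aux_right hs hν hg₁ hg₂ h hx₀ hu' hw h1 h2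
  have L := fun hw => aux_right hs hν hg₁ hg₂ (aux_refl h) hx₁
    (by rw [aux_refl_d, e0, hu', neg_zero]) hw (by simpa only [e0] using h1)
    (by simpa only [e0] using h2)
  simp only [aux_refl_d, e0] at L
  have hw0 : deriv w x₀ = 0 := by
    rcases le_total 0 (s * deriv w x₀) with hh | hh
    · exact (R hh x₀ ⟨le_rfl, hx₀.2⟩).2.2
    · have := (L (by linarith) (1 - x₀) ⟨le_rfl, hx₁.2⟩).2.2
      rw [e0] at this; linarith
  have R := R (by simp [hw0])
  have L := L (by simp [hw0])
  have hall : ∀ x ∈ Icc (0:ℝ) 1, u x = u x₀ ∧ w x = w x₀ := by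
    intro x hx
    rcases le_total x₀ x with hh | hh
    · exact ⟨(R x ⟨hh, hx.2⟩).1, (R x ⟨hh, hx.2⟩).2.1⟩
    · have := L (1 - x) ⟨by linarith, by linarith [hx.1]⟩
      have e : 1 - (1 - x) = x := by ring
      rw [e] at this
      exact ⟨this.1, this.2.1⟩
  obtain ⟨a1, a2, a3, a4, a5, a6, a7, a8, a9, a10, a11, a12⟩ := h
  have c1 := aux_const_s6 (a5 x₀ hx₀) (fun x hx => (hall x hx).1) a11
  have c2 := aux_const_s6 (a6 x₀ hx₀) (fun x hx => (hall x hx).2) a12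
  intro x hx
  rw [← c1]
  exact ⟨(hall x hx).1, by rw [c1, ← c2]; exact (hall x hx).2⟩

/-- local extremum, in sign form -/
def AuxExt (s : ℝ) (u : ℝ → ℝ) (x₀ : ℝ) : Prop :=
  ∀ᶠ x in nhdsWithin x₀ (Icc (0:ℝ) 1), 0 ≤ s * (u x - u x₀)

lemma aux_ext_refl {s : ℝ} {u : ℝ → ℝ} {x₀ : ℝ} (h : AuxExt s u x₀) :
    AuxExt s (fun x => u (1 - x)) (1 - x₀) := by
  unfold AuxExt at *
  have e0 : 1 - (1 - x₀) = x₀ := by ring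
  have ht : Tendsto (fun x : ℝ => 1 - x) (nhdsWithin (1 - x₀) (Icc (0:ℝ) 1))
      (nhdsWithin x₀ (Icc (0:ℝ) 1)) := by
    apply tendsto_nhdsWithin_of_tendsto_nhds_of_eventually_within
    · have : ContinuousAt (fun x : ℝ => 1 - x) (1 - x₀) := by fun_prop
      have h2 : Tendsto (fun x : ℝ => 1 - x) (nhds (1 - x₀)) (nhds (1 - (1 - x₀))) := this
      rw [e0] at h2
      exact h2.mono_left nhdsWithin_le_nhds
    · filter_upwards [self_mem_nhdsWithin] with x hx
      exact ⟨by linarith [hx.2], by linarith [hx.1]⟩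
  simpa only [e0] using ht.eventually h

/-- no strict decrease to the right of a minimum -/
lemma aux_nodec {s : ℝ} {u : ℝ → ℝ} {x₀ b : ℝ} (hu : ContDiff ℝ 2 u) (h : AuxExt s u x₀)
    (h0 : 0 ≤ x₀) (h1 : x₀ < 1)
    (hb : x₀ < b) (hu' : deriv u x₀ = 0) (hneg : ∀ x ∈ Ioo x₀ b, s * deriv (deriv u) x < 0) :
    False := by
  have dP := aux_sderiv s (u x₀) (u := u)
  have hd := aux_SD (f := fun x => s * (u x - u x₀)) (a := x₀) (b := b) (by fun_prop)
    (by rw [dP.1]; simp [hu']) (by rw [dP.2]; exact hneg)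
  have hsub : nhdsWithin x₀ (Ioo x₀ 1) ≤ nhdsWithin x₀ (Icc (0:ℝ) 1) :=
    nhdsWithin_mono _ (fun x hx => ⟨h0.trans hx.1.le, hx.2.le⟩)
  rw [nhdsWithin_Ioo_eq_nhdsGT h1] at hsub
  have e1 := h.filter_mono hsub
  have e2 : ∀ᶠ x in nhdsWithin x₀ (Ioi x₀), x ∈ Ioo x₀ b := Ioo_mem_nhdsGT hb
  obtain ⟨x, hx1, hx2⟩ := (e1.and e2).exists
  have := hd x ⟨hx2.1, hx2.2.le⟩
  simp only [sub_self, mul_zero] at this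
  linarith

lemma aux_evneg {F : ℝ → ℝ} {x₀ : ℝ} (hF : Continuous F) (h : F x₀ < 0) :
    ∃ b, x₀ < b ∧ ∀ x ∈ Ioo x₀ b, F x < 0 := by
  have h1 : ∀ᶠ x in nhds x₀, F x < 0 := hF.continuousAt.eventually (Iio_mem_nhds h)
  obtain ⟨e, he, h2⟩ := Metric.eventually_nhds_iff.1 h1
  refine ⟨x₀ + e, by linarith, fun x hx => h2 ?_⟩
  rw [Real.dist_eq, abs_lt]
  exact ⟨by linarith [hx.1], by linarith [hx.2]⟩

lemma aux_dd {s : ℝ} {u : ℝ → ℝ} {x₀ : ℝ} (hu : ContDiff ℝ 2 u) (h : AuxExt s u x₀)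
    (hx₀ : x₀ ∈ Icc (0:ℝ) 1) (hu' : deriv u x₀ = 0) : 0 ≤ s * deriv (deriv u) x₀ := by
  have half : ∀ (u : ℝ → ℝ) (x₀ : ℝ), ContDiff ℝ 2 u → AuxExt s u x₀ → 0 ≤ x₀ → x₀ < 1 →
      deriv u x₀ = 0 → 0 ≤ s * deriv (deriv u) x₀ := by
    intro u x₀ hu h h0 h1 hu'
    by_contra hc
    push Not at hc
    obtain ⟨b, hb, hn⟩ := aux_evneg (F := fun x => s * deriv (deriv u) x)
      (continuous_const.mul (aux_c2 hu)) hc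
    exact aux_nodec hu h h0 h1 hb hu' hn
  rcases hx₀.2.lt_or_eq with h1 | h1
  · exact half u x₀ hu h hx₀.1 h1 hu'
  · have e0 : 1 - (1 - x₀) = x₀ := by ring
    have := half (fun x => u (1 - x)) (1 - x₀) (hu.comp (by fun_prop)) (aux_ext_refl h)
      (by linarith) (by linarith) (by rw [aux_refl_d, e0, hu', neg_zero])
    rwa [aux_refl_dd, e0] at this

lemma aux_d0 {s : ℝ} {u : ℝ → ℝ} {x₀ : ℝ} (hs : s = 1 ∨ s = -1) (h : AuxExt s u x₀)
    (hx₀ : x₀ ∈ Icc (0:ℝ) 1) (hu0 : deriv u 0 = 0) (hu1 : deriv u 1 = 0) : deriv u x₀ = 0 := by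
  rcases hx₀.1.eq_or_lt with h0 | h0
  · rw [← h0]; exact hu0
  rcases hx₀.2.eq_or_lt with h1 | h1
  · rw [h1]; exact hu1
  have hn : nhdsWithin x₀ (Icc (0:ℝ) 1) = nhds x₀ := nhdsWithin_eq_nhds.2 (Icc_mem_nhds h0 h1)
  unfold AuxExt at h
  rw [hn] at h
  rcases hs with rfl | rfl
  · have : IsLocalMin u x₀ := by
      filter_upwards [h] with x hx; linarith
    exact this.deriv_eq_zero
  · have : IsLocalMax u x₀ := by
      filter_upwards [h] with x hx; linarith
    exact this.deriv_eq_zero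

lemma aux_strict {ν Cg l₁ l₂ s x₀ : ℝ} {g₁ g₂ u w : ℝ → ℝ} (hs : s = 1 ∨ s = -1)
    (hν : 0 < ν) (hg₁ : GAss Cg g₁)
    (h : IsSolution ν g₁ g₂ u w l₁ l₂) (h0 : 0 ≤ x₀) (h01 : x₀ < 1)
    (he : AuxExt s u x₀) (hu' : deriv u x₀ = 0) (hw' : s * deriv w x₀ ≤ 0)
    (h1 : s * (g₁ (w x₀ ^ 2) - l₁) = 0) (h2 : s * (g₂ (u x₀ ^ 2) - l₂) < 0) : False := by
  obtain ⟨a1, a2, a3, a4, a5, a6, a7, a8, a9, a10, a11, a12⟩ := h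
  have hx₀ : x₀ ∈ Icc (0:ℝ) 1 := ⟨h0, h01.le⟩
  have hw2 : s * deriv (deriv w) x₀ < 0 := by
    have o := a4 x₀ hx₀
    have : ν * (s * deriv (deriv w) x₀) = s * (g₂ (u x₀ ^ 2) - l₂) * w x₀ := by
      linear_combination -s * o
    have h3 := mul_neg_of_neg_of_pos h2 (a6 x₀ hx₀)
    rw [← this] at h3
    by_contra hc
    push Not at hc
    have := mul_nonneg hν.le hc
    linarith
  obtain ⟨b, hb, hn⟩ := aux_evneg (F := fun x => s * deriv (deriv w) x)
      (continuous_const.mul (aux_c2 a2)) hw2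
  have dQ := aux_sderiv s (w x₀) (u := w)
  have hd := aux_SD (f := fun x => s * (w x - w x₀)) (a := x₀) (b := b) (by fun_prop)
    (by rw [dQ.1]; exact hw') (by rw [dQ.2]; exact hn)
  refine aux_nodec a1 he h0 h01 (lt_min hb h01) hu' ?_
  intro x hx
  have hx1 : x ∈ Icc (0:ℝ) 1 := ⟨h0.trans hx.1.le, hx.2.le.trans (min_le_right _ _)⟩
  have hx2 := hd x ⟨hx.1, hx.2.le.trans (min_le_left _ _)⟩
  simp only [sub_self, mul_zero] at hx2
  have h3 := aux_smono hs hg₁ (a6 x hx1) (a6 x₀ hx₀) hx2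
  have o := a3 x hx1
  have : ν * (s * deriv (deriv u) x) = s * (g₁ (w x ^ 2) - g₁ (w x₀ ^ 2)) * u x := by
    linear_combination -s * o + u x * h1
  have h4 := mul_neg_of_neg_of_pos h3 (a5 x hx1)
  rw [← this] at h4
  by_contra hc
  push Not at hc
  have := mul_nonneg hν.le hc
  linarith

lemma aux_core {ν Cg l₁ l₂ s x₀ : ℝ} {g₁ g₂ u w : ℝ → ℝ} (hs : s = 1 ∨ s = -1)
    (hν : 0 < ν) (hg₁ : GAss Cg g₁) (hg₂ : GAss Cg g₂)
    (h : IsSolution ν g₁ g₂ u w l₁ l₂) (hx₀ : x₀ ∈ Icc (0:ℝ) 1) (he : AuxExt s u x₀) :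
    IsTrivialSol u w ∨ (s * (g₂ (u x₀ ^ 2) - l₂) < 0 ∧ 0 < s * (g₁ (w x₀ ^ 2) - l₁) ∧
      0 < s * deriv (deriv u) x₀) := by
  obtain ⟨a1, a2, a3, a4, a5, a6, a7, a8, a9, a10, a11, a12⟩ := id h
  have hu' := aux_d0 hs he hx₀ a7 a8
  have hdd := aux_dd a1 he hx₀ hu'
  have o : ν * (s * deriv (deriv u) x₀) = s * (g₁ (w x₀ ^ 2) - l₁) * u x₀ := by
    linear_combination -s * a3 x₀ hx₀
  have up := a5 x₀ hx₀
  have h1 : 0 ≤ s * (g₁ (w x₀ ^ 2) - l₁) := by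
    have := mul_nonneg hν.le hdd
    rw [o] at this
    exact nonneg_of_mul_nonneg_left this up
  by_cases h2 : 0 ≤ s * (g₂ (u x₀ ^ 2) - l₂)
  · exact Or.inl (aux_trivial hs hν hg₁ hg₂ h hx₀ hu' h1 h2)
  push Not at h2
  right
  have h3 : 0 < s * (g₁ (w x₀ ^ 2) - l₁) := by
    rcases h1.lt_or_eq with hh | hh
    · exact hh
    exfalso
    have e0 : 1 - (1 - x₀) = x₀ := by ring
    by_cases hc : x₀ < 1 ∧ s * deriv w x₀ ≤ 0
    · exact aux_strict hs hν hg₁ h hx₀.1 hc.1 he hu' hc.2 hh.symm h2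
    · have hp : 0 < x₀ ∧ 0 ≤ s * deriv w x₀ := by
        rcases hx₀.2.lt_or_eq with hl | hl
        · have hw : 0 < s * deriv w x₀ := by
            by_contra hcc; exact hc ⟨hl, not_lt.1 hcc⟩
          refine ⟨?_, hw.le⟩
          rcases hx₀.1.eq_or_lt with hz | hz
          · rw [← hz, a9] at hw; simp at hw
          · exact hz
        · rw [hl, a10]; simp
      refine aux_strict (x₀ := 1 - x₀) hs hν hg₁ (aux_refl h) (by linarith [hx₀.2])
        (by linarith [hp.1]) (aux_ext_refl he) ?_ ?_ ?_ ?_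
      · rw [aux_refl_d, e0, hu', neg_zero]
      · rw [aux_refl_d, e0]; linarith [hp.2]
      · simp only [e0]; exact hh.symm
      · simp only [e0]; exact h2
  refine ⟨h2, h3, ?_⟩
  have := mul_pos h3 up
  rw [← o] at this
  exact pos_of_mul_pos_right this hν.le

lemma aux_min {u : ℝ → ℝ} {x₀ : ℝ} (h : IsLocalMinOn u (Icc (0:ℝ) 1) x₀) : AuxExt 1 u x₀ := by
  unfold AuxExt
  filter_upwards [h] with x hx
  linarith

lemma aux_max {u : ℝ → ℝ} {x₀ : ℝ} (h : IsLocalMaxOn u (Icc (0:ℝ) 1) x₀) : AuxExt (-1) u x₀ := by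
  unfold AuxExt
  filter_upwards [h] with x hx
  linarith

lemma aux_triv_swap {u w : ℝ → ℝ} (h : IsTrivialSol u w) : IsTrivialSol w u :=
  fun x hx => ⟨(h x hx).2, (h x hx).1⟩

theorem stmt_6 (ν Cg l₁ l₂ : ℝ) (g₁ g₂ v₁ v₂ : ℝ → ℝ) (x₀ : ℝ)
    (hν : 0 < ν) (hCg : 0 < Cg) (hg₁ : GAss Cg g₁) (hg₂ : GAss Cg g₂)
    (hsol : IsSolution ν g₁ g₂ v₁ v₂ l₁ l₂)
    (hx₀ : x₀ ∈ Set.Icc (0:ℝ) 1) :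
    (IsLocalMinOn v₁ (Set.Icc (0:ℝ) 1) x₀ →
      (IsTrivialSol v₁ v₂ ∨
        (g₂ ((v₁ x₀) ^ 2) < l₂ ∧ l₁ < g₁ ((v₂ x₀) ^ 2) ∧ 0 < deriv (deriv v₁) x₀))) ∧
    (IsLocalMinOn v₂ (Set.Icc (0:ℝ) 1) x₀ →
      (IsTrivialSol v₁ v₂ ∨
        (g₁ ((v₂ x₀) ^ 2) < l₁ ∧ l₂ < g₂ ((v₁ x₀) ^ 2) ∧ 0 < deriv (deriv v₂) x₀))) ∧
    (IsLocalMaxOn v₁ (Set.Icc (0:ℝ) 1) x₀ →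
      (IsTrivialSol v₁ v₂ ∨
        (l₂ < g₂ ((v₁ x₀) ^ 2) ∧ g₁ ((v₂ x₀) ^ 2) < l₁))) ∧
    (IsLocalMaxOn v₂ (Set.Icc (0:ℝ) 1) x₀ →
      (IsTrivialSol v₁ v₂ ∨
        (l₁ < g₁ ((v₂ x₀) ^ 2) ∧ g₂ ((v₁ x₀) ^ 2) < l₂))) := by
  have hsol' := aux_swap hsol
  refine ⟨fun h => ?_, fun h => ?_, fun h => ?_, fun h => ?_⟩
  · rcases aux_core (Or.inl rfl) hν hg₁ hg₂ hsol hx₀ (aux_min h) with t | ⟨p, q, r⟩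
    · exact Or.inl t
    · exact Or.inr ⟨by linarith, by linarith, by linarith⟩
  · rcases aux_core (Or.inl rfl) hν hg₂ hg₁ hsol' hx₀ (aux_min h) with t | ⟨p, q, r⟩
    · exact Or.inl (aux_triv_swap t)
    · exact Or.inr ⟨by linarith, by linarith, by linarith⟩
  · rcases aux_core (Or.inr rfl) hν hg₁ hg₂ hsol hx₀ (aux_max h) with t | ⟨p, q, r⟩
    · exact Or.inl t
    · exact Or.inr ⟨by linarith, by linarith⟩
  · rcases aux_core (Or.inr rfl) hν hg₂ hg₁ hsol' hx₀ (aux_max h) with t | ⟨p, q, r⟩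
    · exact Or.inl (aux_triv_swap t)
    · exact Or.inr ⟨by linarith, by linarith⟩
end

section
/- Let (v₁,v₂,λ₁,λ₂) be a nontrivial solution of the one-dimensional system with viscosity ν. Then every critical point of each component is non-degenerate: for each i ∈ {1,2} and every ξ ∈ [0,1] with v_i'(ξ) = 0, one has v_i''(ξ) ≠ 0. -/
open Set Filter MeasureTheory

/-- Auxiliary sign-coupled second order system on `[0,1]`. -/
structure SignSys (K : ℝ) (u u1 u2 w w1 w2 : ℝ → ℝ) : Prop where
  du : ∀ x, HasDerivAt u (u1 x) x
  du1 : ∀ x, HasDerivAt u1 (u2 x) x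
  dw : ∀ x, HasDerivAt w (w1 x) x
  dw1 : ∀ x, HasDerivAt w1 (w2 x) x
  up : ∀ x ∈ Icc (0:ℝ) 1, 0 < w x → 0 < u2 x
  un : ∀ x ∈ Icc (0:ℝ) 1, w x < 0 → u2 x < 0
  wp : ∀ x ∈ Icc (0:ℝ) 1, 0 < u x → 0 < w2 x
  wn : ∀ x ∈ Icc (0:ℝ) 1, u x < 0 → w2 x < 0
  bu : ∀ x ∈ Icc (0:ℝ) 1, |u2 x| ≤ K * |w x|
  bw : ∀ x ∈ Icc (0:ℝ) 1, |w2 x| ≤ K * |u x|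
  u0 : u1 0 = 0
  u1' : u1 1 = 0
  w0 : w1 0 = 0
  w1' : w1 1 = 0

theorem SignSys.neg {K : ℝ} {u u1 u2 w w1 w2 : ℝ → ℝ} (h : SignSys K u u1 u2 w w1 w2) :
    SignSys K (fun x => -u x) (fun x => -u1 x) (fun x => -u2 x)
      (fun x => -w x) (fun x => -w1 x) (fun x => -w2 x) where
  du x := (h.du x).neg
  du1 x := (h.du1 x).neg
  dw x := (h.dw x).neg
  dw1 x := (h.dw1 x).neg
  up x hx hh := by have := h.un x hx (by linarith); linarith
  un x hx hh := by have := h.up x hx (by linarith); linarith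
  wp x hx hh := by have := h.wn x hx (by linarith); linarith
  wn x hx hh := by have := h.wp x hx (by linarith); linarith
  bu x hx := by simpa using h.bu x hx
  bw x hx := by simpa using h.bw x hx
  u0 := by simp [h.u0]
  u1' := by simp [h.u1']
  w0 := by simp [h.w0]
  w1' := by simp [h.w1']

theorem hasDerivAt_refl {f f' : ℝ → ℝ} (h : ∀ x, HasDerivAt f (f' x) x) (x : ℝ) :
    HasDerivAt (fun x => f (1 - x)) (-f' (1 - x)) x := by
  have h1 : HasDerivAt (fun x : ℝ => 1 - x) (-1) x := by
    simpa using (hasDerivAt_id x).const_sub 1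
  simpa [Function.comp_def] using (h (1 - x)).comp x h1

theorem mem_refl {x : ℝ} (hx : x ∈ Icc (0:ℝ) 1) : 1 - x ∈ Icc (0:ℝ) 1 :=
  ⟨by linarith [hx.2], by linarith [hx.1]⟩

theorem SignSys.reflect {K : ℝ} {u u1 u2 w w1 w2 : ℝ → ℝ} (h : SignSys K u u1 u2 w w1 w2) :
    SignSys K (fun x => u (1 - x)) (fun x => -u1 (1 - x)) (fun x => u2 (1 - x))
      (fun x => w (1 - x)) (fun x => -w1 (1 - x)) (fun x => w2 (1 - x)) where
  du x := hasDerivAt_refl h.du x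
  du1 x := by have := (hasDerivAt_refl h.du1 x).neg; rw [neg_neg] at this; exact this
  dw x := hasDerivAt_refl h.dw x
  dw1 x := by have := (hasDerivAt_refl h.dw1 x).neg; rw [neg_neg] at this; exact this
  up x hx hh := h.up _ (mem_refl hx) hh
  un x hx hh := h.un _ (mem_refl hx) hh
  wp x hx hh := h.wp _ (mem_refl hx) hh
  wn x hx hh := h.wn _ (mem_refl hx) hh
  bu x hx := h.bu _ (mem_refl hx)
  bw x hx := h.bw _ (mem_refl hx)
  u0 := by simp [h.u1']
  u1' := by simp [h.u0]
  w0 := by simp [h.w1']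
  w1' := by simp [h.w0]

theorem mono_aux {f f' : ℝ → ℝ} (h : ∀ x, HasDerivAt f (f' x) x) {a b : ℝ} (hab : a ≤ b)
    (hp : ∀ x ∈ Icc a b, 0 ≤ f' x) : f a ≤ f b := by
  have : MonotoneOn f (Icc a b) := by
    apply monotoneOn_of_deriv_nonneg (convex_Icc a b)
    · exact fun x _ => (h x).continuousAt.continuousWithinAt
    · exact fun x _ => (h x).differentiableAt.differentiableWithinAt
    · intro x hx
      rw [(h x).deriv]
      exact hp x (interior_subset hx)
  exact this ⟨le_rfl, hab⟩ ⟨hab, le_rfl⟩ hab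

theorem smono_aux {f f' : ℝ → ℝ} (h : ∀ x, HasDerivAt f (f' x) x) {a b : ℝ} (hab : a < b)
    (hp : ∀ x ∈ Ioo a b, 0 < f' x) : f a < f b := by
  have : StrictMonoOn f (Icc a b) := by
    apply strictMonoOn_of_deriv_pos (convex_Icc a b)
    · exact fun x _ => (h x).continuousAt.continuousWithinAt
    · intro x hx
      rw [(h x).deriv]
      rw [interior_Icc] at hx
      exact hp x hx
  exact this ⟨le_rfl, hab.le⟩ ⟨hab.le, le_rfl⟩ hab

theorem first_time {f : ℝ → ℝ} (hf : Continuous f) {a b : ℝ} (ha : 0 < f a)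
    (H : ∀ T ∈ Icc a b, (∀ x ∈ Icc a T, 0 ≤ f x) → f a ≤ f T) :
    ∀ x ∈ Icc a b, 0 < f x := by
  intro x hx
  by_contra! hneg
  have ivt : ∀ y, a ≤ y → f y ≤ 0 → ∃ z ∈ Icc a y, f z = 0 := fun y hy hfy =>
    intermediate_value_Icc' hy hf.continuousOn ⟨hfy, ha.le⟩
  have hc : IsCompact (Icc a b ∩ f ⁻¹' {0}) :=
    isCompact_Icc.inter_right (isClosed_singleton.preimage hf)
  obtain ⟨z, hz, hz0⟩ := ivt x hx.1 hneg
  obtain ⟨T, ⟨hT, hT0⟩, hmin⟩ := hc.exists_isLeast ⟨z, ⟨hz.1, hz.2.trans hx.2⟩, hz0⟩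
  have hT0 : f T = 0 := hT0
  have := H T hT (by
    intro y hy
    by_contra! hn
    obtain ⟨s, hs, hs0⟩ := ivt y hy.1 hn.le
    have h1 : T ≤ s := hmin ⟨⟨hs.1, hs.2.trans (hy.2.trans hT.2)⟩, hs0⟩
    have : y = T := le_antisymm hy.2 (h1.trans hs.2)
    rw [this] at hn
    linarith)
  linarith

section
variable {K : ℝ} {u u1 u2 w w1 w2 : ℝ → ℝ}

theorem SignSys.up' (h : SignSys K u u1 u2 w w1 w2) {x : ℝ} (hx : x ∈ Icc (0:ℝ) 1)
    (hw : 0 ≤ w x) : 0 ≤ u2 x := by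
  rcases hw.lt_or_eq with hw | hw
  · exact (h.up x hx hw).le
  · have := h.bu x hx
    rw [← hw] at this
    simp at this
    exact this.ge

theorem SignSys.wp' (h : SignSys K u u1 u2 w w1 w2) {x : ℝ} (hx : x ∈ Icc (0:ℝ) 1)
    (hw : 0 ≤ u x) : 0 ≤ w2 x := by
  rcases hw.lt_or_eq with hw | hw
  · exact (h.wp x hx hw).le
  · have := h.bw x hx
    rw [← hw] at this
    simp at this
    exact this.ge

theorem SignSys.forward (h : SignSys K u u1 u2 w w1 w2) {a : ℝ} (ha : 0 ≤ a) (ha1 : a < 1)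
    (hu1 : u1 a = 0) (hw : w a = 0) (hu : 0 ≤ u a) (hw1 : 0 ≤ w1 a)
    (hne : 0 < u a ∨ 0 < w1 a) : False := by
  have mem : ∀ x ∈ Icc a 1, x ∈ Icc (0:ℝ) 1 := fun x hx => ⟨ha.trans hx.1, hx.2⟩
  -- it suffices that `w1 > 0` on `(a,1]`
  suffices hpos : ∀ x ∈ Ioc a 1, 0 < w1 x by
    have hwpos : ∀ x ∈ Ioc a 1, 0 < w x := by
      intro x hx
      have := smono_aux h.dw hx.1 (fun y hy => hpos y ⟨hy.1, hy.2.le.trans hx.2⟩)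
      linarith
    have := smono_aux h.du1 ha1 (fun y hy =>
      h.up y (mem y ⟨hy.1.le, hy.2.le⟩) (hwpos y ⟨hy.1, hy.2.le⟩))
    rw [hu1, h.u1'] at this
    exact lt_irrefl _ this
  -- consequences of `w1 ≥ 0` on `[a,T]`
  have key : ∀ T ∈ Icc a 1, (∀ x ∈ Icc a T, 0 ≤ w1 x) → u a ≤ u T := by
    intro T hT hx
    have e1 : ∀ x ∈ Icc a T, 0 ≤ w x := by
      intro x hxT
      have := mono_aux h.dw hxT.1 (fun y hy => hx y ⟨hy.1, hy.2.trans hxT.2⟩)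
      linarith
    have e2 : ∀ x ∈ Icc a T, 0 ≤ u1 x := by
      intro x hxT
      have := mono_aux h.du1 hxT.1 (fun y hy =>
        h.up' (mem y ⟨hy.1, hy.2.trans (hxT.2.trans hT.2)⟩) (e1 y ⟨hy.1, hy.2.trans hxT.2⟩))
      linarith
    exact mono_aux h.du hT.1 e2
  rcases hne with hne | hne
  · have hup : ∀ x ∈ Icc a 1, 0 < u x := by
      apply first_time (continuous_iff_continuousAt.2 fun x => (h.du x).continuousAt) hne
      intro T hT hx
      apply key T hT
      intro x hxT
      have := mono_aux h.dw1 hxT.1 (fun y hy =>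
        h.wp' (mem y ⟨hy.1, hy.2.trans (hxT.2.trans hT.2)⟩) (hx y ⟨hy.1, hy.2.trans hxT.2⟩))
      linarith
    intro x hx
    have := smono_aux h.dw1 hx.1 (fun y hy =>
      have hy' : y ∈ Icc a 1 := ⟨hy.1.le, hy.2.le.trans hx.2⟩
      h.wp y (mem y hy') (hup y hy'))
    linarith
  · have := first_time (f := w1) (a := a) (b := 1)
      (continuous_iff_continuousAt.2 fun x => (h.dw1 x).continuousAt) hne (by
        intro T hT hx
        apply mono_aux h.dw1 hT.1
        intro x hxT
        have hx1 : x ∈ Icc a 1 := ⟨hxT.1, hxT.2.trans hT.2⟩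
        apply h.wp' (mem x hx1)
        exact hu.trans (key x hx1 fun y hy => hx y ⟨hy.1, hy.2.trans hxT.2⟩))
    exact fun x hx => this x ⟨hx.1.le, hx.2⟩

theorem SignSys.unique_forward (h : SignSys K u u1 u2 w w1 w2) {a : ℝ} (ha : 0 ≤ a)
    (hu1 : u1 a = 0) (hw : w a = 0) (hu : u a = 0) (hw1 : w1 a = 0) :
    ∀ x ∈ Icc a 1, u x = 0 ∧ w x = 0 := by
  intro x hx
  have := norm_le_gronwallBound_of_norm_deriv_right_le
    (f := fun x => ((u x, u1 x), (w x, w1 x))) (f' := fun x => ((u1 x, u2 x), (w1 x, w2 x)))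
    (δ := 0) (K := max 1 K) (ε := 0) (a := a) (b := 1)
    (fun x _ => (((h.du x).prodMk (h.du1 x)).prodMk
      ((h.dw x).prodMk (h.dw1 x))).continuousAt.continuousWithinAt)
    (fun x _ => (((h.du x).prodMk (h.du1 x)).prodMk
      ((h.dw x).prodMk (h.dw1 x))).hasDerivWithinAt)
    (by simp [hu1, hw, hu, hw1]) (by
      intro x hx
      have hx' : x ∈ Icc (0:ℝ) 1 := ⟨ha.trans hx.1, hx.2.le⟩
      have b1 := h.bu x hx'
      have b2 := h.bw x hx'
      simp only [Prod.norm_def, Real.norm_eq_abs, add_zero]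
      set M := max (max |u x| |u1 x|) (max |w x| |w1 x|) with hM
      have m1 : |u x| ≤ M := by simp [hM]
      have m2 : |u1 x| ≤ M := by simp [hM]
      have m3 : |w x| ≤ M := by simp [hM]
      have m4 : |w1 x| ≤ M := by simp [hM]
      have m0 : 0 ≤ M := (abs_nonneg _).trans m1
      have k1 : (1:ℝ) ≤ max 1 K := le_max_left _ _
      have k2 : K ≤ max 1 K := le_max_right _ _
      have k0 : (0:ℝ) ≤ max 1 K := by linarith
      have c1 : K * |w x| ≤ max 1 K * M := mul_le_mul k2 m3 (abs_nonneg _) k0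
      have c2 : K * |u x| ≤ max 1 K * M := mul_le_mul k2 m1 (abs_nonneg _) k0
      have c3 : M ≤ max 1 K * M := le_mul_of_one_le_left m0 k1
      refine max_le (max_le ?_ ?_) (max_le ?_ ?_) <;> linarith) x hx
  rw [gronwallBound_ε0_δ0] at this
  have := norm_le_zero_iff.1 this
  simp only [Prod.mk_eq_zero] at this
  exact ⟨this.1.1, this.2.1⟩

theorem SignSys.main (h : SignSys K u u1 u2 w w1 w2) {a : ℝ} (ha : a ∈ Icc (0:ℝ) 1)
    (hu1 : u1 a = 0) (hw : w a = 0) : ∀ x ∈ Icc (0:ℝ) 1, u x = 0 ∧ w x = 0 := by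
  by_cases hz : u a = 0 ∧ w1 a = 0
  · intro x hx
    rcases le_total a x with hax | hax
    · exact h.unique_forward ha.1 hu1 hw hz.1 hz.2 x ⟨hax, hx.2⟩
    · have := h.reflect.unique_forward (a := 1 - a) (mem_refl ha).1 (by simpa using hu1)
        (by simpa using hw) (by simpa using hz.1) (by simpa using hz.2) (1 - x)
        ⟨by linarith, by linarith [hx.1]⟩
      simpa using this
  · exfalso
    -- forward with the same sign
    have F : ∀ {u u1 u2 w w1 w2 : ℝ → ℝ} {a : ℝ}, SignSys K u u1 u2 w w1 w2 → 0 ≤ a → a < 1 →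
        u1 a = 0 → w a = 0 → ¬ (u a = 0 ∧ w1 a = 0) → 0 ≤ u a * w1 a → False := by
      intro u u1 u2 w w1 w2 a h h0 h1 hu1 hw hz hs
      rcases mul_nonneg_iff.1 hs with ⟨p, q⟩ | ⟨p, q⟩
      · refine h.forward h0 h1 hu1 hw p q ?_
        by_contra! hh
        exact hz ⟨le_antisymm hh.1 p, le_antisymm hh.2 q⟩
      · refine h.neg.forward h0 h1 (by simpa using hu1) (by simpa using hw) (by linarith)
          (by linarith) ?_
        by_contra! hh
        exact hz ⟨le_antisymm p (by linarith [hh.1]), le_antisymm q (by linarith [hh.2])⟩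
    have R : 0 < a → u a * w1 a ≤ 0 → False := by
      intro h0 hs
      refine F h.reflect (a := 1 - a) (mem_refl ha).1 (by linarith) (by simpa using hu1)
        (by simpa using hw) (by simpa using hz) (by simpa using hs)
    rcases ha.1.eq_or_lt with e | e
    · subst e
      exact F h le_rfl one_pos hu1 hw hz (by simp [h.w0])
    · rcases ha.2.eq_or_lt with e' | e'
      · subst e'
        exact R one_pos (by simp [h.w1'])
      · rcases le_total 0 (u a * w1 a) with hs | hs
        · exact F h e.le e' hu1 hw hz hs
        · exact R e hs
end

theorem sq_g_lt {Cg : ℝ} {g : ℝ → ℝ} (hg : GAss Cg g) {a b : ℝ} (ha : 0 ≤ a) (hab : a < b) :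
    g (a ^ 2) < g (b ^ 2) :=
  hg.2.1 (sq_nonneg a) (sq_nonneg b) (by nlinarith)

theorem g_lip_s7 {Cg : ℝ} {g : ℝ → ℝ} (hg : GAss Cg g) (M : ℝ) :
    ∃ L : ℝ, 0 ≤ L ∧ ∀ a b, 0 ≤ a → a ≤ M → 0 ≤ b → b ≤ M →
      |g (a ^ 2) - g (b ^ 2)| ≤ L * |a - b| := by
  have hc : ContDiffOn ℝ 1 g (Icc 0 (M ^ 2)) := 
    (hg.1.of_le (by norm_num)).mono fun x hx => hx.1
  obtain ⟨C, hC⟩ := hc.exists_lipschitzOnWith (by norm_num) (convex_Icc _ _) isCompact_Icc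
  refine ⟨C * (2 * |M|), by positivity, ?_⟩
  intro a b ha haM hb hbM
  have h1 := hC.dist_le_mul (a ^ 2) ⟨sq_nonneg a, by nlinarith⟩ (b ^ 2) ⟨sq_nonneg b, by nlinarith⟩
  rw [Real.dist_eq, Real.dist_eq] at h1
  have h2 : |a ^ 2 - b ^ 2| ≤ 2 * |M| * |a - b| := by
    have : a ^ 2 - b ^ 2 = (a + b) * (a - b) := by ring
    rw [this, abs_mul]
    apply mul_le_mul_of_nonneg_right _ (abs_nonneg _)
    rw [abs_of_nonneg (by linarith)]
    linarith [le_abs_self M]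
  calc _ ≤ _ := h1
    _ ≤ C * (2 * |M| * |a - b|) := mul_le_mul_of_nonneg_left h2 C.2
    _ = _ := by ring

theorem upper_bd {v : ℝ → ℝ} (hv : Continuous v) : ∃ M, ∀ x ∈ Icc (0:ℝ) 1, v x ≤ M := by
  obtain ⟨M, hM⟩ := (isCompact_Icc (a := (0:ℝ)) (b := 1)).bddAbove_image hv.continuousOn
  exact ⟨M, fun x hx => hM ⟨x, hx, rfl⟩⟩

/-- Signs and bounds for one equation. -/
theorem eq_aux {ν Cg l c M : ℝ} {g v w v2 : ℝ → ℝ} (hν : 0 < ν) (hg : GAss Cg g)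
    (hv : ∀ x ∈ Icc (0:ℝ) 1, 0 < v x) (hw : ∀ x ∈ Icc (0:ℝ) 1, 0 < w x)
    (hvM : ∀ x ∈ Icc (0:ℝ) 1, v x ≤ M) (hwM : ∀ x ∈ Icc (0:ℝ) 1, w x ≤ M)
    (hc : 0 < c) (hcM : c ≤ M) (hgc : g (c ^ 2) = l)
    (heq : ∀ x ∈ Icc (0:ℝ) 1, -ν * v2 x + g ((w x) ^ 2) * v x = l * v x) :
    (∀ x ∈ Icc (0:ℝ) 1, 0 < w x - c → 0 < v2 x) ∧
    (∀ x ∈ Icc (0:ℝ) 1, w x - c < 0 → v2 x < 0) ∧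
    ∃ K, ∀ x ∈ Icc (0:ℝ) 1, |v2 x| ≤ K * |w x - c| := by
  have e : ∀ x ∈ Icc (0:ℝ) 1, v2 x = (g ((w x) ^ 2) - g (c ^ 2)) * (v x / ν) := by
    intro x hx
    have := heq x hx
    field_simp
    rw [hgc]
    linarith
  have p : ∀ x ∈ Icc (0:ℝ) 1, 0 < v x / ν := fun x hx => div_pos (hv x hx) hν
  refine ⟨?_, ?_, ?_⟩
  · intro x hx h
    rw [e x hx]
    exact mul_pos (sub_pos.2 (sq_g_lt hg hc.le (by linarith))) (p x hx)
  · intro x hx h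
    rw [e x hx]
    exact mul_neg_of_neg_of_pos (sub_neg.2 (sq_g_lt hg (hw x hx).le (by linarith))) (p x hx)
  · obtain ⟨L, hL, hl⟩ := g_lip_s7 hg M
    refine ⟨L * (M / ν), fun x hx => ?_⟩
    rw [e x hx, abs_mul, abs_of_pos (p x hx)]
    calc _ ≤ (L * |w x - c|) * (M / ν) :=
          mul_le_mul (hl _ _ (hw x hx).le (hwM x hx) hc.le hcM)
            (div_le_div_of_nonneg_right (hvM x hx) hν.le) (p x hx).le (by positivity)
      _ = _ := by ring

theorem const_one_s7 {v : ℝ → ℝ} {c : ℝ} (hc : 0 < c) (hv : ∀ x ∈ Icc (0:ℝ) 1, v x = c)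
    (hi : (∫ x in (0:ℝ)..1, (v x) ^ 2) = 1) : c = 1 := by
  have : (∫ x in (0:ℝ)..1, (v x) ^ 2) = ∫ x in (0:ℝ)..1, c ^ 2 := by
    apply intervalIntegral.integral_congr
    intro x hx
    rw [uIcc_of_le zero_le_one] at hx
    simp [hv x hx]
  rw [this] at hi
  simp at hi
  rcases hi with h | h <;> linarith

theorem half (ν Cg l₁ l₂ : ℝ) (g₁ g₂ v₁ v₂ : ℝ → ℝ)
    (hν : 0 < ν) (hg₁ : GAss Cg g₁) (hg₂ : GAss Cg g₂)
    (hsol : IsSolution ν g₁ g₂ v₁ v₂ l₁ l₂)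
    (hnt : ¬ IsTrivialSol v₁ v₂) :
    ∀ ξ ∈ Set.Icc (0:ℝ) 1, deriv v₁ ξ = 0 → deriv (deriv v₁) ξ ≠ 0 := by
  obtain ⟨s1, s2, e1, e2, p1, p2, a0, a1, b0, b1, i1, i2⟩ := hsol
  intro ξ hξ hd hdd
  apply hnt
  have D : ∀ {v : ℝ → ℝ}, ContDiff ℝ 2 v → (∀ x, HasDerivAt v (deriv v x) x) ∧
      (∀ x, HasDerivAt (deriv v) (deriv (deriv v) x) x) := by
    intro v hv
    have h2 : ContDiff ℝ 1 (deriv v) := by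
      have : ContDiff ℝ (1 + 1) v := by simpa [one_add_one_eq_two] using hv
      exact (contDiff_succ_iff_deriv.1 this).2.2
    exact ⟨fun x => (hv.differentiable (by norm_num) x).hasDerivAt,
      fun x => (h2.differentiable (by norm_num) x).hasDerivAt⟩
  obtain ⟨d1, d1'⟩ := D s1
  obtain ⟨d2, d2'⟩ := D s2
  obtain ⟨M1, hM1⟩ := upper_bd s1.continuous
  obtain ⟨M2, hM2⟩ := upper_bd s2.continuous
  obtain ⟨η, hη, hη2⟩ := exists_hasDerivAt_eq_zero (f := deriv v₂) (f' := deriv (deriv v₂))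
    (zero_lt_one' ℝ) (fun x _ => (d2' x).continuousAt.continuousWithinAt) (by rw [b0, b1])
    (fun x _ => d2' x)
  have hη' : η ∈ Icc (0:ℝ) 1 := ⟨hη.1.le, hη.2.le⟩
  have c1 : g₁ ((v₂ ξ) ^ 2) = l₁ := by
    have := e1 ξ hξ
    rw [hdd] at this
    exact mul_right_cancel₀ (p1 ξ hξ).ne' (by linarith)
  have c2 : g₂ ((v₁ η) ^ 2) = l₂ := by
    have := e2 η hη'
    rw [hη2] at this
    exact mul_right_cancel₀ (p2 η hη').ne' (by linarith)
  have m1 : ∀ x ∈ Icc (0:ℝ) 1, v₁ x ≤ max M1 M2 := fun x hx => (hM1 x hx).trans (le_max_left _ _)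
  have m2 : ∀ x ∈ Icc (0:ℝ) 1, v₂ x ≤ max M1 M2 := fun x hx => (hM2 x hx).trans (le_max_right _ _)
  obtain ⟨q1, q2, K1, q3⟩ := eq_aux hν hg₁ p1 p2 m1 m2 (p2 ξ hξ) (m2 ξ hξ) c1 e1
  obtain ⟨r1, r2, K2, r3⟩ := eq_aux hν hg₂ p2 p1 m2 m1 (p1 η hη') (m1 η hη') c2 e2
  have S : SignSys (max K1 K2) (fun x => v₁ x - v₁ η) (deriv v₁) (deriv (deriv v₁))
      (fun x => v₂ x - v₂ ξ) (deriv v₂) (deriv (deriv v₂)) :=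
    { du := fun x => (d1 x).sub_const _
      du1 := d1'
      dw := fun x => (d2 x).sub_const _
      dw1 := d2'
      up := q1
      un := q2
      wp := r1
      wn := r2
      bu := fun x hx => (q3 x hx).trans
        (mul_le_mul_of_nonneg_right (le_max_left _ _) (abs_nonneg _))
      bw := fun x hx => (r3 x hx).trans
        (mul_le_mul_of_nonneg_right (le_max_right _ _) (abs_nonneg _))
      u0 := a0
      u1' := a1
      w0 := b0
      w1' := b1 }
  have hmain := S.main hξ hd (by simp)
  have z1 : ∀ x ∈ Icc (0:ℝ) 1, v₁ x = v₁ η := fun x hx => sub_eq_zero.1 (hmain x hx).1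
  have z2 : ∀ x ∈ Icc (0:ℝ) 1, v₂ x = v₂ ξ := fun x hx => sub_eq_zero.1 (hmain x hx).2
  have o1 := const_one_s7 (p1 η hη') z1 i1
  have o2 := const_one_s7 (p2 ξ hξ) z2 i2
  exact fun x hx => ⟨(z1 x hx).trans o1, (z2 x hx).trans o2⟩

theorem stmt_7 (ν Cg l₁ l₂ : ℝ) (g₁ g₂ v₁ v₂ : ℝ → ℝ)
    (hν : 0 < ν) (hCg : 0 < Cg) (hg₁ : GAss Cg g₁) (hg₂ : GAss Cg g₂)
    (hsol : IsSolution ν g₁ g₂ v₁ v₂ l₁ l₂)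
    (hnt : ¬ IsTrivialSol v₁ v₂) :
    (∀ ξ ∈ Set.Icc (0:ℝ) 1, deriv v₁ ξ = 0 → deriv (deriv v₁) ξ ≠ 0) ∧
    (∀ ξ ∈ Set.Icc (0:ℝ) 1, deriv v₂ ξ = 0 → deriv (deriv v₂) ξ ≠ 0) := by
  refine ⟨half ν Cg l₁ l₂ g₁ g₂ v₁ v₂ hν hg₁ hg₂ hsol hnt, ?_⟩
  obtain ⟨s1, s2, e1, e2, p1, p2, a0, a1, b0, b1, i1, i2⟩ := hsol
  exact half ν Cg l₂ l₁ g₂ g₁ v₂ v₁ hν hg₂ hg₁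
    ⟨s2, s1, e2, e1, p2, p1, b0, b1, a0, a1, i2, i1⟩ (fun h => hnt fun x hx => (h x hx).symm)
end

section
/- Let (v₁,v₂,λ₁,λ₂) be a nontrivial solution of the one-dimensional system with viscosity ν, and let x₁ < x₂ in [0,1] be such that, for some i ∈ {1,2} (j = 3−i), v_i'(x₁) = v_i'(x₂) = 0 and v_i' > 0 on (x₁,x₂). Then there is exactly one point ξ ∈ [x₁,x₂] with v_i''(ξ) = 0, and exactly one point η ∈ [x₁,x₂] with v_j''(η) = 0. The analogous statement holds when v_i' < 0 on (x₁,x₂). -/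
open Set Filter MeasureTheory

/-- Strict growth from a positive derivative in the open interval. -/
lemma aux_lt {f f' : ℝ → ℝ} {p T : ℝ} (hd : ∀ x ∈ Icc p T, HasDerivAt f (f' x) x)
    (hp : ∀ x ∈ Ioo p T, 0 < f' x) {x : ℝ} (hx : x ∈ Ioc p T) : f p < f x := by
  have hm : StrictMonoOn f (Icc p T) := by
    apply strictMonoOn_of_deriv_pos (convex_Icc p T)
    · intro y hy
      exact (hd y hy).continuousAt.continuousWithinAt
    · intro y hy
      rw [interior_Icc] at hy
      rw [(hd y (Ioo_subset_Icc_self hy)).deriv]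
      exact hp y hy
  exact hm ⟨le_rfl, hx.1.le.trans hx.2⟩ ⟨hx.1.le, hx.2⟩ hx.1

/-- Solutions given through explicit first and second derivatives. -/
structure Sol (ν : ℝ) (g₁ g₂ : ℝ → ℝ) (l₁ l₂ a b : ℝ) (v₁ v₂ d₁ d₂ e₁ e₂ : ℝ → ℝ) : Prop where
  hv₁ : ∀ x, HasDerivAt v₁ (d₁ x) x
  hv₂ : ∀ x, HasDerivAt v₂ (d₂ x) x
  hd₁ : ∀ x, HasDerivAt d₁ (e₁ x) x
  hd₂ : ∀ x, HasDerivAt d₂ (e₂ x) x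
  he₁ : ∀ x ∈ Icc a b, ν * e₁ x = (g₁ (v₂ x ^ 2) - l₁) * v₁ x
  he₂ : ∀ x ∈ Icc a b, ν * e₂ x = (g₂ (v₁ x ^ 2) - l₂) * v₂ x
  pos₁ : ∀ x ∈ Icc a b, 0 < v₁ x
  pos₂ : ∀ x ∈ Icc a b, 0 < v₂ x

lemma quot_lt {v u d k : ℝ → ℝ} {p T : ℝ} (hv : ∀ x, HasDerivAt v (d x) x)
    (hu : ∀ x, HasDerivAt u (k x) x) (hu0 : ∀ x ∈ Icc p T, 0 < u x)
    (hW : ∀ x ∈ Ioo p T, 0 < d x * u x - v x * k x) (h0 : v p = u p)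
    {x : ℝ} (hx : x ∈ Ioc p T) : u x < v x := by
  have h := aux_lt (f := fun y => v y / u y)
    (f' := fun y => (d y * u y - v y * k y) / u y ^ 2) (p := p) (T := T)
    (fun y hy => (hv y).div (hu y) (hu0 y hy).ne')
    (fun y hy => div_pos (hW y hy) (pow_pos (hu0 y (Ioo_subset_Icc_self hy)) 2)) hx
  have hpp := hu0 p ⟨le_rfl, hx.1.le.trans hx.2⟩
  have hxx := hu0 x ⟨hx.1.le, hx.2⟩
  rw [h0, div_self hpp.ne', lt_div_iff₀ hxx] at h
  linarith

lemma compare {ν l₁ l₂ p q : ℝ} {g₁ g₂ v₁ v₂ d₁ d₂ e₁ e₂ u₁ u₂ k₁ k₂ m₁ m₂ : ℝ → ℝ}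
    (hν : 0 < ν) (hg₁ : StrictMonoOn g₁ (Ici 0)) (hg₂ : StrictMonoOn g₂ (Ici 0))
    (V : Sol ν g₁ g₂ l₁ l₂ p q v₁ v₂ d₁ d₂ e₁ e₂)
    (U : Sol ν g₁ g₂ l₁ l₂ p q u₁ u₂ k₁ k₂ m₁ m₂) (hpq : p < q)
    (h1 : v₁ p = u₁ p) (h2 : v₂ p = u₂ p) (h3 : d₁ p = k₁ p) (h4 : k₂ p < d₂ p) :
    u₂ q < v₂ q := by
  set W₁ : ℝ → ℝ := fun x => d₁ x * u₁ x - v₁ x * k₁ x with hW₁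
  set W₂ : ℝ → ℝ := fun x => d₂ x * u₂ x - v₂ x * k₂ x with hW₂
  have hdW₁ : ∀ x, HasDerivAt W₁ (e₁ x * u₁ x - v₁ x * m₁ x) x := by
    intro x
    exact (((V.hd₁ x).mul (U.hv₁ x)).sub ((V.hv₁ x).mul (U.hd₁ x))).congr_deriv (by ring)
  have hdW₂ : ∀ x, HasDerivAt W₂ (e₂ x * u₂ x - v₂ x * m₂ x) x := by
    intro x
    exact (((V.hd₂ x).mul (U.hv₂ x)).sub ((V.hv₂ x).mul (U.hd₂ x))).congr_deriv (by ring)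
  have hs₁ : ∀ x ∈ Icc p q, u₂ x < v₂ x → 0 < e₁ x * u₁ x - v₁ x * m₁ x := by
    intro x hx hlt
    have hu := U.pos₂ x hx
    have hgl : g₁ (u₂ x ^ 2) < g₁ (v₂ x ^ 2) :=
      hg₁ (sq_nonneg (u₂ x)) (sq_nonneg (v₂ x)) (by nlinarith)
    have e := V.he₁ x hx
    have m := U.he₁ x hx
    have : ν * (e₁ x * u₁ x - v₁ x * m₁ x)
        = (g₁ (v₂ x ^ 2) - g₁ (u₂ x ^ 2)) * (v₁ x * u₁ x) := by
      linear_combination u₁ x * e - v₁ x * m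
    have hp : 0 < ν * (e₁ x * u₁ x - v₁ x * m₁ x) := by
      rw [this]
      exact mul_pos (by linarith) (mul_pos (V.pos₁ x hx) (U.pos₁ x hx))
    exact (mul_pos_iff_of_pos_left hν).1 hp
  have hs₂ : ∀ x ∈ Icc p q, u₁ x < v₁ x → 0 < e₂ x * u₂ x - v₂ x * m₂ x := by
    intro x hx hlt
    have hu := U.pos₁ x hx
    have hgl : g₂ (u₁ x ^ 2) < g₂ (v₁ x ^ 2) :=
      hg₂ (sq_nonneg (u₁ x)) (sq_nonneg (v₁ x)) (by nlinarith)
    have e := V.he₂ x hx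
    have m := U.he₂ x hx
    have : ν * (e₂ x * u₂ x - v₂ x * m₂ x)
        = (g₂ (v₁ x ^ 2) - g₂ (u₁ x ^ 2)) * (v₂ x * u₂ x) := by
      linear_combination u₂ x * e - v₂ x * m
    have hp : 0 < ν * (e₂ x * u₂ x - v₂ x * m₂ x) := by
      rw [this]
      exact mul_pos (by linarith) (mul_pos (V.pos₂ x hx) (U.pos₂ x hx))
    exact (mul_pos_iff_of_pos_left hν).1 hp
  have hup := U.pos₂ p ⟨le_rfl, hpq.le⟩
  have hW1p : W₁ p = 0 := by simp only [hW₁]; rw [h1, h3]; ring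
  have hW2p : 0 < W₂ p := by simp only [hW₂]; rw [h2]; nlinarith
  have step : ∀ T ∈ Icc p q, (∀ x ∈ Ico p T, 0 < W₂ x) → 0 < W₂ T := by
    intro T hT hpos
    rcases hT.1.eq_or_lt with rfl | hlt
    · exact hW2p
    have sub : ∀ x ∈ Icc p T, x ∈ Icc p q := fun x hx => ⟨hx.1, hx.2.trans hT.2⟩
    have a2 : ∀ x ∈ Ioc p T, u₂ x < v₂ x := fun x hx =>
      quot_lt V.hv₂ U.hv₂ (fun y hy => U.pos₂ y (sub y hy))
        (fun y hy => hpos y ⟨hy.1.le, hy.2⟩) h2 hx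
    have b1 : ∀ x ∈ Ioc p T, 0 < W₁ x := fun x hx => by
      rw [← hW1p]
      exact aux_lt (fun y _ => hdW₁ y)
        (fun y hy => hs₁ y (sub y (Ioo_subset_Icc_self hy)) (a2 y ⟨hy.1, hy.2.le⟩)) hx
    have a1 : ∀ x ∈ Ioc p T, u₁ x < v₁ x := fun x hx =>
      quot_lt V.hv₁ U.hv₁ (fun y hy => U.pos₁ y (sub y hy))
        (fun y hy => b1 y ⟨hy.1, hy.2.le⟩) h1 hx
    have := aux_lt (fun y _ => hdW₂ y)
        (fun y hy => hs₂ y (sub y (Ioo_subset_Icc_self hy)) (a1 y ⟨hy.1, hy.2.le⟩))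
        (show T ∈ Ioc p T from ⟨hlt, le_rfl⟩)
    linarith
  have hcont : Continuous W₂ := continuous_iff_continuousAt.2 fun x => (hdW₂ x).continuousAt
  have all : ∀ x ∈ Icc p q, 0 < W₂ x := by
    by_contra! hcon
    obtain ⟨y, hy, hy0⟩ := hcon
    have hK : IsCompact (Icc p q ∩ {x | W₂ x ≤ 0}) :=
      isCompact_Icc.inter_right (isClosed_le hcont continuous_const)
    obtain ⟨T, hT, hleast⟩ := hK.exists_isLeast ⟨y, hy, hy0⟩
    have h5 := step T hT.1 (by
      intro x hx
      by_contra! h0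
      have := hleast ⟨⟨hx.1, hx.2.le.trans hT.1.2⟩, h0⟩
      exact absurd hx.2 (not_lt.2 this))
    exact absurd h5 (not_lt.2 hT.2)
  exact quot_lt V.hv₂ U.hv₂ U.pos₂ (fun y hy => all y (Ioo_subset_Icc_self hy)) h2
    ⟨hpq, le_rfl⟩

/-- Reflection of `f` (restricted to the left of `b`) about `b`, with sign `s`. -/
noncomputable def refl_at (f : ℝ → ℝ) (b s x : ℝ) : ℝ := if x ≤ b then f x else s * f (2 * b - x)

lemma refl_at_le {f : ℝ → ℝ} {b s x : ℝ} (h : x ≤ b) : refl_at f b s x = f x := if_pos h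

lemma refl_at_ge {f : ℝ → ℝ} {b s x : ℝ} (h : b ≤ x) (hs : s * f b = f b) :
    refl_at f b s x = s * f (2 * b - x) := by
  rcases h.eq_or_lt with rfl | h
  · rw [refl_at_le le_rfl]
    ring_nf
    linarith
  · exact if_neg (not_le.2 h)

lemma refl_at_deriv {f f' : ℝ → ℝ} {b s : ℝ} (h : ∀ x, HasDerivAt f (f' x) x)
    (h1 : s * f b = f b) (h2 : (-s) * f' b = f' b) (x : ℝ) :
    HasDerivAt (refl_at f b s) (refl_at f' b (-s) x) x := by
  have hR : ∀ y, HasDerivAt (fun z => s * f (2 * b - z)) (-s * f' (2 * b - y)) y := by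
    intro y
    have h3 : HasDerivAt (fun z : ℝ => 2 * b - z) (-1) y := by
      simpa using (hasDerivAt_id y).const_sub (2 * b)
    exact (((h (2 * b - y)).comp y h3).const_mul s).congr_deriv (by ring)
  have L : x ≤ b → HasDerivWithinAt (refl_at f b s) (refl_at f' b (-s) x) (Iic b) x := by
    intro hx
    rw [refl_at_le hx]
    exact (h x).hasDerivWithinAt.congr (fun y hy => refl_at_le hy) (refl_at_le hx)
  have R : b ≤ x → HasDerivWithinAt (refl_at f b s) (refl_at f' b (-s) x) (Ici b) x := by
    intro hx
    rw [refl_at_ge hx h2]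
    exact (hR x).hasDerivWithinAt.congr (fun y hy => refl_at_ge hy h1) (refl_at_ge hx h1)
  rcases lt_trichotomy x b with hx | hx | hx
  · exact (L hx.le).hasDerivAt (Iic_mem_nhds hx)
  · have := (L hx.le).union (R hx.ge)
    rw [Iic_union_Ici] at this
    exact hasDerivWithinAt_univ.1 this
  · exact (R hx.le).hasDerivAt (Ici_mem_nhds hx)

lemma Sol.reflect {ν l₁ l₂ a b : ℝ} {g₁ g₂ v₁ v₂ d₁ d₂ e₁ e₂ : ℝ → ℝ}
    (V : Sol ν g₁ g₂ l₁ l₂ a b v₁ v₂ d₁ d₂ e₁ e₂) (h1 : d₁ b = 0) (h2 : d₂ b = 0) :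
    Sol ν g₁ g₂ l₁ l₂ a (2 * b - a) (refl_at v₁ b 1) (refl_at v₂ b 1) (refl_at d₁ b (-1))
      (refl_at d₂ b (-1)) (refl_at e₁ b 1) (refl_at e₂ b 1) := by
  have key : ∀ x ∈ Icc a (2 * b - a), ∃ y ∈ Icc a b, ∀ f : ℝ → ℝ, refl_at f b 1 x = f y := by
    intro x hx
    by_cases hxb : x ≤ b
    · exact ⟨x, ⟨hx.1, hxb⟩, fun f => refl_at_le hxb⟩
    · push Not at hxb
      refine ⟨2 * b - x, ⟨by linarith [hx.2], by linarith⟩, fun f => ?_⟩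
      rw [refl_at_ge hxb.le (one_mul _), one_mul]
  refine ⟨fun x => refl_at_deriv V.hv₁ (by simp) (by simp [h1]) x,
    fun x => refl_at_deriv V.hv₂ (by simp) (by simp [h2]) x, fun x => ?_, fun x => ?_, ?_, ?_, ?_, ?_⟩
  · have := refl_at_deriv (s := -1) V.hd₁ (b := b) (by simp [h1]) (by simp) x
    rwa [neg_neg] at this
  · have := refl_at_deriv (s := -1) V.hd₂ (b := b) (by simp [h2]) (by simp) x
    rwa [neg_neg] at this
  all_goals
    intro x hx
    obtain ⟨y, hy, hf⟩ := key x hx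
    simp only [hf]
  · exact V.he₁ y hy
  · exact V.he₂ y hy
  · exact V.pos₁ y hy
  · exact V.pos₂ y hy

lemma Sol.mono {ν l₁ l₂ a b a' b' : ℝ} {g₁ g₂ v₁ v₂ d₁ d₂ e₁ e₂ : ℝ → ℝ}
    (V : Sol ν g₁ g₂ l₁ l₂ a b v₁ v₂ d₁ d₂ e₁ e₂) (ha : a ≤ a') (hb : b' ≤ b) :
    Sol ν g₁ g₂ l₁ l₂ a' b' v₁ v₂ d₁ d₂ e₁ e₂ :=
  have s : ∀ x ∈ Icc a' b', x ∈ Icc a b := fun _ hx => ⟨ha.trans hx.1, hx.2.trans hb⟩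
  ⟨V.hv₁, V.hv₂, V.hd₁, V.hd₂, fun x hx => V.he₁ x (s x hx), fun x hx => V.he₂ x (s x hx),
    fun x hx => V.pos₁ x (s x hx), fun x hx => V.pos₂ x (s x hx)⟩

lemma Sol.shift {ν l₁ l₂ a b : ℝ} {g₁ g₂ v₁ v₂ d₁ d₂ e₁ e₂ : ℝ → ℝ}
    (V : Sol ν g₁ g₂ l₁ l₂ a b v₁ v₂ d₁ d₂ e₁ e₂) (t : ℝ) :
    Sol ν g₁ g₂ l₁ l₂ (a + t) (b + t) (fun x => v₁ (x - t)) (fun x => v₂ (x - t))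
      (fun x => d₁ (x - t)) (fun x => d₂ (x - t)) (fun x => e₁ (x - t)) (fun x => e₂ (x - t)) :=
  have s : ∀ x ∈ Icc (a + t) (b + t), x - t ∈ Icc a b :=
    fun _ hx => ⟨by linarith [hx.1], by linarith [hx.2]⟩
  ⟨fun x => (V.hv₁ (x - t)).comp_sub_const x t, fun x => (V.hv₂ (x - t)).comp_sub_const x t,
    fun x => (V.hd₁ (x - t)).comp_sub_const x t, fun x => (V.hd₂ (x - t)).comp_sub_const x t,
    fun x hx => V.he₁ _ (s x hx), fun x hx => V.he₂ _ (s x hx),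
    fun x hx => V.pos₁ _ (s x hx), fun x hx => V.pos₂ _ (s x hx)⟩

lemma Sol.crit {ν l₁ l₂ : ℝ} {g₁ g₂ v₁ v₂ d₁ d₂ e₁ e₂ : ℝ → ℝ}
    (hν : 0 < ν) (hg₁ : StrictMonoOn g₁ (Ici 0)) (hg₂ : StrictMonoOn g₂ (Ici 0))
    (V : Sol ν g₁ g₂ l₁ l₂ 0 1 v₁ v₂ d₁ d₂ e₁ e₂) (h10 : d₁ 0 = 0) (h11 : d₁ 1 = 0)
    (h20 : d₂ 0 = 0) (h21 : d₂ 1 = 0) {c : ℝ} (hc : c ∈ Icc (0:ℝ) 1) (h : d₁ c = 0) :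
    d₂ c = 0 := by
  have A := V.reflect h11 h21
  have a10 : refl_at d₁ 1 (-1) 2 = 0 := by
    rw [refl_at_ge (by norm_num) (by simp [h11])]; norm_num [h10]
  have a20 : refl_at d₂ 1 (-1) 2 = 0 := by
    rw [refl_at_ge (by norm_num) (by simp [h21])]; norm_num [h20]
  rw [show (2 * 1 - 0 : ℝ) = 2 by norm_num] at A
  have B := A.reflect a10 a20
  -- B is a solution on [0,4], symmetric about 1 and 2
  have fA : ∀ f : ℝ → ℝ, ∀ s r : ℝ, refl_at (refl_at f 1 s) 2 r c = f c := by
    intro f s r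
    rw [refl_at_le (by linarith [hc.2]), refl_at_le hc.2]
  have fB : ∀ f : ℝ → ℝ, ∀ s r : ℝ, s * f 1 = f 1 →
      refl_at (refl_at f 1 s) 2 r (2 - c) = s * f c := by
    intro f s r hs
    rw [refl_at_le (by linarith [hc.1]), refl_at_ge (by linarith [hc.2]) hs]
    congr 2; ring
  have fC : ∀ f : ℝ → ℝ,
      refl_at (refl_at f 1 1) 2 1 (3 - c) = refl_at (refl_at f 1 1) 2 1 (1 + c) := by
    intro f
    rw [refl_at_ge (b := 2) (x := 3 - c) (by linarith [hc.2]) (one_mul _),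
      refl_at_le (b := 2) (x := 1 + c) (by linarith [hc.2]), one_mul]
    congr 1; ring
  -- p = 2 - c, shift t = 2 - 2c, q = 3 - c
  have U := (B.shift (2 - 2 * c)).mono (a' := 2 - c) (b' := 3 - c) (by linarith [hc.1])
    (by linarith [hc.2])
  have W := B.mono (a' := 2 - c) (b' := 3 - c) (by linarith [hc.2]) (by linarith [hc.1])
  have e1 : 2 - c - (2 - 2 * c) = c := by ring
  have e2 : 3 - c - (2 - 2 * c) = 1 + c := by ring
  have n1 : (-1) * d₁ 1 = d₁ 1 := by simp [h11]
  have n2 : (-1) * d₂ 1 = d₂ 1 := by simp [h21]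
  rcases lt_trichotomy (d₂ c) 0 with hlt | heq | hgt
  · have := compare hν hg₁ hg₂ W U (by linarith) (by simp only [e1, fA]; rw [fB _ _ _ (by simp)]; simp)
      (by simp only [e1, fA]; rw [fB _ _ _ (by simp)]; simp)
      (by simp only [e1, fA]; rw [fB _ _ _ n1, h]; simp)
      (by simp only [e1, fA]; rw [fB _ _ _ n2]; linarith)
    simp only [e2, fC] at this
    exact absurd this (lt_irrefl _)
  · exact heq
  · have := compare hν hg₁ hg₂ U W (by linarith) (by simp only [e1, fA]; rw [fB _ _ _ (by simp)]; simp)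
      (by simp only [e1, fA]; rw [fB _ _ _ (by simp)]; simp)
      (by simp only [e1, fA]; rw [fB _ _ _ n1, h]; simp)
      (by simp only [e1, fA]; rw [fB _ _ _ n2]; linarith)
    simp only [e2, fC] at this
    exact absurd this (lt_irrefl _)

lemma IsSolution.swap {ν l₁ l₂ : ℝ} {g₁ g₂ v₁ v₂ : ℝ → ℝ}
    (h : IsSolution ν g₁ g₂ v₁ v₂ l₁ l₂) : IsSolution ν g₂ g₁ v₂ v₁ l₂ l₁ := by
  obtain ⟨a, b, c, d, e, f, g, h, i, j, k, l⟩ := h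
  exact ⟨b, a, d, c, f, e, i, j, g, h, l, k⟩

lemma d1 {v : ℝ → ℝ} (h : ContDiff ℝ 2 v) (x : ℝ) : HasDerivAt v (deriv v x) x :=
  ((h.differentiable (by norm_num)) x).hasDerivAt

lemma d2 {v : ℝ → ℝ} (h : ContDiff ℝ 2 v) (x : ℝ) :
    HasDerivAt (deriv v) (deriv (deriv v) x) x := by
  have h' : ContDiff ℝ (1 + 1) v := by
    rw [one_add_one_eq_two]; exact h
  exact (((contDiff_succ_iff_deriv.1 h').2.2.differentiable (by norm_num)) x).hasDerivAt

lemma IsSolution.crit {ν l₁ l₂ : ℝ} {g₁ g₂ v₁ v₂ : ℝ → ℝ}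
    (hν : 0 < ν) (hg₁ : StrictMonoOn g₁ (Ici 0)) (hg₂ : StrictMonoOn g₂ (Ici 0))
    (hs : IsSolution ν g₁ g₂ v₁ v₂ l₁ l₂) {c : ℝ} (hc : c ∈ Icc (0:ℝ) 1)
    (h : deriv v₁ c = 0) : deriv v₂ c = 0 := by
  obtain ⟨c1, c2, o1, o2, p1, p2, b1, b2, b3, b4, -, -⟩ := hs
  exact Sol.crit (l₁ := l₁) (l₂ := l₂) (e₁ := deriv (deriv v₁)) (e₂ := deriv (deriv v₂))
    hν hg₁ hg₂ ⟨d1 c1, d1 c2, d2 c1, d2 c2, fun x hx => by linarith [o1 x hx],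
      fun x hx => by linarith [o2 x hx], p1, p2⟩ b1 b2 b3 b4 hc h

lemma inj_of {v : ℝ → ℝ} (h : ContDiff ℝ 2 v) {a b : ℝ}
    (hne : ∀ x ∈ Ioo a b, deriv v x ≠ 0) {x y : ℝ} (hx : x ∈ Icc a b) (hy : y ∈ Icc a b)
    (hxy : v x = v y) : x = y := by
  rcases lt_trichotomy x y with hl | he | hl
  · obtain ⟨z, hz, h0⟩ := exists_deriv_eq_zero hl h.continuous.continuousOn hxy
    exact absurd h0 (hne z ⟨hx.1.trans_lt hz.1, hz.2.trans_le hy.2⟩)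
  · exact he
  · obtain ⟨z, hz, h0⟩ := exists_deriv_eq_zero hl h.continuous.continuousOn hxy.symm
    exact absurd h0 (hne z ⟨hy.1.trans_lt hz.1, hz.2.trans_le hx.2⟩)

lemma half_s8 {ν l a b : ℝ} {g v w : ℝ → ℝ} (hg : StrictMonoOn g (Ici 0))
    (cv : ContDiff ℝ 2 v) (cw : ContDiff ℝ 2 w) (hab : a < b)
    (o : ∀ x ∈ Icc a b, -ν * deriv (deriv v) x + g (w x ^ 2) * v x = l * v x)
    (pv : ∀ x ∈ Icc a b, 0 < v x) (pw : ∀ x ∈ Icc a b, 0 < w x)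
    (ha : deriv v a = 0) (hb : deriv v b = 0) (hne : ∀ x ∈ Ioo a b, deriv w x ≠ 0) :
    ∃! ξ, ξ ∈ Icc a b ∧ deriv (deriv v) ξ = 0 := by
  obtain ⟨z, hz, h0⟩ := exists_deriv_eq_zero (f := deriv v) hab
    (fun x _ => (d2 cv x).continuousAt.continuousWithinAt) (ha.trans hb.symm)
  have hl : ∀ x ∈ Icc a b, deriv (deriv v) x = 0 → g (w x ^ 2) = l := by
    intro x hx h
    have := o x hx
    rw [h, mul_zero, zero_add] at this
    exact mul_right_cancel₀ (pv x hx).ne' this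
  refine ⟨z, ⟨Ioo_subset_Icc_self hz, h0⟩, ?_⟩
  rintro y ⟨hy, hy0⟩
  have hz' := Ioo_subset_Icc_self hz
  have e := hg.injOn (sq_nonneg (w y)) (sq_nonneg (w z))
    ((hl y hy hy0).trans (hl z hz' h0).symm)
  exact inj_of cw hne hy hz' ((sq_eq_sq₀ (pw y hy).le (pw z hz').le).1 e)

lemma core {ν l₁ l₂ x₁ x₂ : ℝ} {g₁ g₂ v₁ v₂ : ℝ → ℝ}
    (hν : 0 < ν) (hg₁ : StrictMonoOn g₁ (Ici 0)) (hg₂ : StrictMonoOn g₂ (Ici 0))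
    (hs : IsSolution ν g₁ g₂ v₁ v₂ l₁ l₂)
    (hx₁ : 0 ≤ x₁) (hx₁₂ : x₁ < x₂) (hx₂ : x₂ ≤ 1)
    (ha : deriv v₁ x₁ = 0) (hb : deriv v₁ x₂ = 0) (hne : ∀ x ∈ Ioo x₁ x₂, deriv v₁ x ≠ 0) :
    (∃! ξ, ξ ∈ Icc x₁ x₂ ∧ deriv (deriv v₁) ξ = 0) ∧
       (∃! η, η ∈ Icc x₁ x₂ ∧ deriv (deriv v₂) η = 0) := by
  have ha' := hs.crit hν hg₁ hg₂ ⟨hx₁, hx₁₂.le.trans hx₂⟩ ha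
  have hb' := hs.crit hν hg₁ hg₂ ⟨hx₁.trans hx₁₂.le, hx₂⟩ hb
  have sub : ∀ x ∈ Icc x₁ x₂, x ∈ Icc (0:ℝ) 1 := fun x hx => ⟨hx₁.trans hx.1, hx.2.trans hx₂⟩
  have hne' : ∀ x ∈ Ioo x₁ x₂, deriv v₂ x ≠ 0 := fun x hx h =>
    hne x hx (hs.swap.crit hν hg₂ hg₁ (sub x (Ioo_subset_Icc_self hx)) h)
  obtain ⟨c1, c2, o1, o2, p1, p2, -⟩ := hs
  exact ⟨half_s8 hg₁ c1 c2 hx₁₂ (fun x hx => o1 x (sub x hx)) (fun x hx => p1 x (sub x hx))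
      (fun x hx => p2 x (sub x hx)) ha hb hne',
    half_s8 hg₂ c2 c1 hx₁₂ (fun x hx => o2 x (sub x hx)) (fun x hx => p2 x (sub x hx))
      (fun x hx => p1 x (sub x hx)) ha' hb' hne⟩

theorem stmt_8 (ν Cg l₁ l₂ : ℝ) (g₁ g₂ v₁ v₂ : ℝ → ℝ) (x₁ x₂ : ℝ)
    (hν : 0 < ν) (hCg : 0 < Cg) (hg₁ : GAss Cg g₁) (hg₂ : GAss Cg g₂)
    (hsol : IsSolution ν g₁ g₂ v₁ v₂ l₁ l₂)
    (hnt : ¬ IsTrivialSol v₁ v₂)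
    (hx₁ : 0 ≤ x₁) (hx₁₂ : x₁ < x₂) (hx₂ : x₂ ≤ 1) :
    ((deriv v₁ x₁ = 0 ∧ deriv v₁ x₂ = 0 ∧ (∀ x ∈ Set.Ioo x₁ x₂, 0 < deriv v₁ x)) →
      ((∃! ξ, ξ ∈ Set.Icc x₁ x₂ ∧ deriv (deriv v₁) ξ = 0) ∧
       (∃! η, η ∈ Set.Icc x₁ x₂ ∧ deriv (deriv v₂) η = 0))) ∧
    ((deriv v₂ x₁ = 0 ∧ deriv v₂ x₂ = 0 ∧ (∀ x ∈ Set.Ioo x₁ x₂, 0 < deriv v₂ x)) →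
      ((∃! ξ, ξ ∈ Set.Icc x₁ x₂ ∧ deriv (deriv v₂) ξ = 0) ∧
       (∃! η, η ∈ Set.Icc x₁ x₂ ∧ deriv (deriv v₁) η = 0))) ∧
    ((deriv v₁ x₁ = 0 ∧ deriv v₁ x₂ = 0 ∧ (∀ x ∈ Set.Ioo x₁ x₂, deriv v₁ x < 0)) →
      ((∃! ξ, ξ ∈ Set.Icc x₁ x₂ ∧ deriv (deriv v₁) ξ = 0) ∧
       (∃! η, η ∈ Set.Icc x₁ x₂ ∧ deriv (deriv v₂) η = 0))) ∧
    ((deriv v₂ x₁ = 0 ∧ deriv v₂ x₂ = 0 ∧ (∀ x ∈ Set.Ioo x₁ x₂, deriv v₂ x < 0)) →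
      ((∃! ξ, ξ ∈ Set.Icc x₁ x₂ ∧ deriv (deriv v₂) ξ = 0) ∧
       (∃! η, η ∈ Set.Icc x₁ x₂ ∧ deriv (deriv v₁) η = 0))) := by
  have m₁ := hg₁.2.1
  have m₂ := hg₂.2.1
  refine ⟨?_, ?_, ?_, ?_⟩
  · rintro ⟨a, b, h⟩
    exact core hν m₁ m₂ hsol hx₁ hx₁₂ hx₂ a b fun x hx => (h x hx).ne'
  · rintro ⟨a, b, h⟩
    exact core hν m₂ m₁ hsol.swap hx₁ hx₁₂ hx₂ a b fun x hx => (h x hx).ne'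
  · rintro ⟨a, b, h⟩
    exact core hν m₁ m₂ hsol hx₁ hx₁₂ hx₂ a b fun x hx => (h x hx).ne
  · rintro ⟨a, b, h⟩
    exact core hν m₂ m₁ hsol.swap hx₁ hx₁₂ hx₂ a b fun x hx => (h x hx).ne
end
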